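/- arXiv:1904.01961 — 6 statements merged into one kernel-verified Lean document; each statement's English description precedes it below -/
import Mathlib

section
/- For p ≥ 1 and positive semidefinite n×n complex matrices A, B, Tr(|A^p - B^p|) ≥ Tr((A - B)(A^(p-1) - B^(p-1))). -/
open Matrix ComplexOrder

noncomputable def matAbs {n : Type*} [Fintype n] [DecidableEq n] (X : Matrix n n ℂ) :
    Matrix n n ℂ := cfc Real.sqrt (Xᴴ * X)

section Helpers
open scoped MatrixOrder Matrix.Norms.L2Operator NNReal

variable {n : Type*} [Fintype n] [DecidableEq n]

lemma hlp_trace_mul_nonneg {X Y : Matrix n n ℂ} (hX : 0 ≤ X) (hY : 0 ≤ Y) :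
    0 ≤ (X * Y).trace := by
  obtain ⟨C, rfl⟩ := CStarAlgebra.nonneg_iff_eq_star_mul_self.mp hY
  rw [← mul_assoc, Matrix.trace_mul_comm, ← mul_assoc]
  exact ((Matrix.nonneg_iff_posSemidef.mp hX).mul_mul_conjTranspose_same C).trace_nonneg

lemma hlp_rpow (A : Matrix n n ℂ) (hA : 0 ≤ A) (q : ℝ≥0) (hq : 0 < q) :
    cfc (fun x : ℝ => x ^ (q : ℝ)) A = A ^ q := by
  rw [CFC.nnrpow_eq_rpow hq, CFC.rpow_eq_cfc_real hA]

lemma hlp_abs (D : Matrix n n ℂ) : matAbs D = CFC.abs D := by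
  unfold matAbs CFC.abs
  rw [CFC.sqrt_eq_real_sqrt _ (star_mul_self_nonneg D), cfcₙ_eq_cfc]
  rfl

lemma hlp_key (X Y : Matrix n n ℂ) (hX : 0 ≤ X) (hY : 0 ≤ Y) (s t : ℝ≥0) (hs : 0 < s)
    (ht : 0 < t) (hst : s + t = 1) :
    X.trace - (Y ^ s * X ^ t).trace ≤ ((X - Y)⁺).trace := by
  have hs1 : s ∈ Set.Icc (0 : ℝ≥0) 1 := ⟨hs.le, hst ▸ le_self_add⟩
  have ht1 : t ∈ Set.Icc (0 : ℝ≥0) 1 := ⟨ht.le, hst ▸ le_add_self⟩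
  have hD : IsSelfAdjoint (X - Y) := hX.isSelfAdjoint.sub hY.isSelfAdjoint
  set Z := Y + (X - Y)⁺ with hZd
  have hYZ : Y ≤ Z := le_add_of_nonneg_right (CFC.posPart_nonneg _)
  have hXZ : X ≤ Z := by
    have := add_le_add_right (CFC.le_posPart hD) Y
    simpa [hZd] using this
  have hZ : 0 ≤ Z := hY.trans hYZ
  have hsplit : ∀ W : Matrix n n ℂ, 0 ≤ W → W.trace = (W ^ s * W ^ t).trace := by
    intro W hW
    rw [← CFC.nnrpow_add hs ht, hst, CFC.nnrpow_one W hW]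
  have m1 : X ^ s ≤ Z ^ s := CFC.monotone_nnrpow hs1 hXZ
  have m2 : Y ^ s ≤ Z ^ s := CFC.monotone_nnrpow hs1 hYZ
  have m3 : X ^ t ≤ Z ^ t := CFC.monotone_nnrpow ht1 hXZ
  have m4 : Y ^ t ≤ Z ^ t := CFC.monotone_nnrpow ht1 hYZ
  have e1 := hlp_trace_mul_nonneg (sub_nonneg.mpr m1) (CFC.nnrpow_nonneg (a := X) (x := t))
  have e2 := hlp_trace_mul_nonneg (sub_nonneg.mpr m2) (sub_nonneg.mpr m3)
  have e3 := hlp_trace_mul_nonneg (CFC.nnrpow_nonneg (a := Y) (x := s)) (sub_nonneg.mpr m4)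
  have hT : ((X - Y)⁺).trace = Z.trace - Y.trace := by rw [hZd, Matrix.trace_add]; ring
  rw [hT, hsplit X hX, hsplit Y hY, hsplit Z hZ]
  simp only [sub_mul, mul_sub, Matrix.trace_sub] at e1 e2 e3
  rw [← sub_nonneg]
  convert add_nonneg (add_nonneg e1 e2) e3 using 1
  ring

end Helpers

open scoped MatrixOrder Matrix.Norms.L2Operator NNReal in
lemma hlp_main {n : Type*} [Fintype n] [DecidableEq n] (p : ℝ) (hp : 1 ≤ p)
    (A B : Matrix n n ℂ) (hA : A.PosSemidef) (hB : B.PosSemidef) :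
    Matrix.trace ((A - B) *
        (cfc (fun x : ℝ => x ^ (p - 1)) A - cfc (fun x : ℝ => x ^ (p - 1)) B)) ≤
      Matrix.trace (matAbs (cfc (fun x : ℝ => x ^ p) A - cfc (fun x : ℝ => x ^ p) B)) := by
  have hA0 := hA.nonneg
  have hB0 := hB.nonneg
  rw [hlp_abs]
  rcases hp.eq_or_lt with rfl | hp1
  · have h0 : (fun x : ℝ => x ^ ((1:ℝ) - 1)) = fun _ => 1 := by ext x; simp
    rw [h0, cfc_const_one ℝ A, cfc_const_one ℝ B, sub_self, mul_zero, Matrix.trace_zero]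
    exact (Matrix.nonneg_iff_posSemidef.mp (CFC.abs_nonneg _)).trace_nonneg
  · obtain ⟨r, hr⟩ : ∃ r : ℝ≥0, (r : ℝ) = p - 1 := ⟨⟨p - 1, by linarith⟩, rfl⟩
    have hr0 : 0 < r := by
      rw [← NNReal.coe_pos, hr]; linarith
    have hq : p = ((r + 1 : ℝ≥0) : ℝ) := by push_cast; linarith
    have hq0 : 0 < r + 1 := by positivity
    rw [← hr, hq, hlp_rpow A hA0 r hr0, hlp_rpow B hB0 r hr0, hlp_rpow A hA0 _ hq0,
      hlp_rpow B hB0 _ hq0]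
    set X := A ^ (r + 1) with hXd
    set Y := B ^ (r + 1) with hYd
    have hX : 0 ≤ X := CFC.nnrpow_nonneg
    have hY : 0 ≤ Y := CFC.nnrpow_nonneg
    have hD : IsSelfAdjoint (X - Y) := hX.isSelfAdjoint.sub hY.isSelfAdjoint
    have hs : 0 < (r + 1)⁻¹ := by positivity
    have ht : 0 < r / (r + 1) := by positivity
    have hst : (r + 1)⁻¹ + r / (r + 1) = 1 := by field_simp; ring
    have k1 := hlp_key X Y hX hY _ _ hs ht hst
    have k2 := hlp_key X Y hX hY _ _ ht hs (by rw [add_comm]; exact hst)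
    have c1 : (r + 1) * (r + 1)⁻¹ = 1 := mul_inv_cancel₀ hq0.ne'
    have c2 : (r + 1) * (r / (r + 1)) = r := by field_simp
    have hXs : X ^ ((r + 1)⁻¹) = A := by
      rw [hXd, CFC.nnrpow_nnrpow, c1, CFC.nnrpow_one A hA0]
    have hYs : Y ^ ((r + 1)⁻¹) = B := by
      rw [hYd, CFC.nnrpow_nnrpow, c1, CFC.nnrpow_one B hB0]
    have hXt : X ^ (r / (r + 1)) = A ^ r := by
      rw [hXd, CFC.nnrpow_nnrpow, c2]
    have hYt : Y ^ (r / (r + 1)) = B ^ r := by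
      rw [hYd, CFC.nnrpow_nnrpow, c2]
    rw [hXt, hYs] at k1
    rw [hXs, hYt] at k2
    have hsA : X.trace = (A * A ^ r).trace := by
      rw [hXd, add_comm, CFC.nnrpow_add one_pos hr0, CFC.nnrpow_one A hA0]
    have hsB : Y.trace = (B * B ^ r).trace := by
      rw [hYd, add_comm, CFC.nnrpow_add one_pos hr0, CFC.nnrpow_one B hB0]
    have habs := congrArg Matrix.trace (CFC.abs_add_self (X - Y) hD)
    rw [two_smul, Matrix.trace_add, Matrix.trace_add, Matrix.trace_sub] at habs
    rw [Matrix.trace_mul_comm (B ^ r) A] at k2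
    simp only [sub_mul, mul_sub, Matrix.trace_sub]
    rw [← hsA, ← hsB, ← sub_nonneg]
    convert add_nonneg (sub_nonneg.mpr k1) (sub_nonneg.mpr k2) using 1
    linear_combination habs

theorem stmt_4 {n : Type*} [Fintype n] [DecidableEq n] (p : ℝ) (hp : 1 ≤ p)
    (A B : Matrix n n ℂ) (hA : A.PosSemidef) (hB : B.PosSemidef) :
    Matrix.trace ((A - B) *
        (cfc (fun x : ℝ => x ^ (p - 1)) A - cfc (fun x : ℝ => x ^ (p - 1)) B)) ≤
      Matrix.trace (matAbs (cfc (fun x : ℝ => x ^ p) A - cfc (fun x : ℝ => x ^ p) B)) :=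
  hlp_main p hp A B hA hB
end

section
/- For p ∈ [1, 2] and positive semidefinite n×n complex matrices A, B, Tr(|A - B|^p) ≥ Tr((A - B)(A^(p-1) - B^(p-1))). -/
open Matrix ComplexOrder

section
open scoped MatrixOrder Matrix.Norms.L2Operator

variable {n : Type*} [Fintype n] [DecidableEq n]

lemma aux_trace_nonneg {X Y : Matrix n n ℂ} (hX : 0 ≤ X) (hY : 0 ≤ Y) : 0 ≤ trace (X * Y) := by
  obtain ⟨S, rfl⟩ := CStarAlgebra.nonneg_iff_eq_star_mul_self.mp hX
  rw [mul_assoc, trace_mul_comm, mul_assoc, ← mul_assoc]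
  have : 0 ≤ S * Y * star S := star_right_conjugate_nonneg hY S
  exact this.posSemidef.trace_nonneg

lemma aux_trace_mono {X Y Z : Matrix n n ℂ} (hX : 0 ≤ X) (h : Y ≤ Z) :
    trace (X * Y) ≤ trace (X * Z) := by
  have := aux_trace_nonneg hX (sub_nonneg.mpr h)
  rw [mul_sub, trace_sub] at this
  exact sub_nonneg.mp this

lemma aux_inv {M N : Matrix n n ℂ} (hM : M.PosDef) (h : M ≤ N) : N⁻¹ ≤ M⁻¹ := by
  have hN : N.PosDef := by
    have h2 : (N - M).PosSemidef := h
    have := hM.add_posSemidef h2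
    simpa using this
  have h1 := CStarAlgebra.inv_le_inv (a := hM.isUnit.unit) (b := hN.isUnit.unit)
    hM.posSemidef.nonneg h
  simpa [Matrix.coe_units_inv] using h1

lemma aux_wood {P M S : Matrix n n ℂ} (hP : 0 ≤ P) (hS : 0 ≤ S) (hSS : S * S = P) (hM : M.PosDef) :
    0 ≤ S * M⁻¹ * S ∧ trace (P * (M⁻¹ - (M + P)⁻¹)) =
      trace ((S * M⁻¹ * S) * (1 - (1 + S * M⁻¹ * S)⁻¹)) := by
  have hX : 0 ≤ S * M⁻¹ * S := by
    have h1 : 0 ≤ M⁻¹ := hM.inv.posSemidef.nonneg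
    have := star_right_conjugate_nonneg h1 S
    rwa [(IsSelfAdjoint.of_nonneg hS).star_eq] at this
  refine ⟨hX, ?_⟩
  have hMP : (M + P).PosDef := hM.add_posSemidef hP.posSemidef
  have hX1 : (1 + S * M⁻¹ * S).PosDef := PosDef.one.add_posSemidef hX.posSemidef
  have uM := (isUnit_iff_isUnit_det _).mp hM.isUnit
  have uMP := (isUnit_iff_isUnit_det _).mp hMP.isUnit
  have uX := (isUnit_iff_isUnit_det _).mp hX1.isUnit
  have e1 : M⁻¹ * P * (M+P)⁻¹ = M⁻¹ - (M+P)⁻¹ := by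
    have : P = (M + P) - M := by abel
    nth_rewrite 1 [this]
    rw [mul_sub, sub_mul, nonsing_inv_mul _ uM, mul_assoc, mul_nonsing_inv _ uMP]; simp
  have e2 : (1 + S * M⁻¹ * S) * (1 - S * (M+P)⁻¹ * S) = 1 := by
    have : S * M⁻¹ * S * (S * (M+P)⁻¹ * S) = S * M⁻¹ * S - S * (M+P)⁻¹ * S := by
      calc _ = S * (M⁻¹ * (S * S) * (M+P)⁻¹) * S := by noncomm_ring
        _ = _ := by rw [hSS, e1]; noncomm_ring
    rw [add_mul, mul_sub, mul_sub, this]; noncomm_ring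
  have e3 : (1 + S * M⁻¹ * S)⁻¹ = 1 - S * (M+P)⁻¹ * S := inv_eq_right_inv e2
  have e4 : (S * M⁻¹ * S) * (1 - (1 + S * M⁻¹ * S)⁻¹) = S * (M⁻¹ - (M + P)⁻¹) * S := by
    have h5 : (S * M⁻¹ * S) * (1 - (1 + S * M⁻¹ * S)⁻¹) = 
      S * M⁻¹ * S - ((1 + S * M⁻¹ * S) * (1 + S * M⁻¹ * S)⁻¹ - (1 + S * M⁻¹ * S)⁻¹) := by
        noncomm_ring
    rw [h5, mul_nonsing_inv _ uX, e3]; noncomm_ring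
  rw [e4, trace_mul_comm (S * _), ← mul_assoc, hSS]

lemma aux_res {P M : Matrix n n ℂ} {t : ℝ} (ht : 0 < t) (hP : 0 ≤ P) (hM : t • (1 : Matrix n n ℂ) ≤ M) :
    trace (P * (M⁻¹ - (M + P)⁻¹)) ≤
      trace (P * ((t • (1 : Matrix n n ℂ))⁻¹ - (t • (1 : Matrix n n ℂ) + P)⁻¹)) := by
  have hT : (t • (1 : Matrix n n ℂ)).PosDef := PosDef.one.smul ht
  have hM' : M.PosDef := by
    have h2 : (M - t • (1 : Matrix n n ℂ)).PosSemidef := hM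
    have := hT.add_posSemidef h2
    simpa using this
  obtain ⟨S, hS, hSS⟩ : ∃ S : Matrix n n ℂ, 0 ≤ S ∧ S * S = P :=
    ⟨CFC.sqrt P, CFC.sqrt_nonneg P, CFC.sqrt_mul_sqrt_self P hP⟩
  obtain ⟨hX, eX⟩ := aux_wood hP hS hSS hM'
  obtain ⟨hY, eY⟩ := aux_wood hP hS hSS hT
  rw [eX, eY]
  have hXY : S * M⁻¹ * S ≤ S * (t • (1 : Matrix n n ℂ))⁻¹ * S := by
    have := star_right_conjugate_le_conjugate (aux_inv hT hM) S
    rwa [(IsSelfAdjoint.of_nonneg hS).star_eq] at this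
  generalize S * M⁻¹ * S = X at *
  generalize S * (t • (1 : Matrix n n ℂ))⁻¹ * S = Y at *
  have hX1 : (1 + X).PosDef := PosDef.one.add_posSemidef hX.posSemidef
  refine (aux_trace_mono hX (sub_le_sub_left (aux_inv hX1 (add_le_add_right hXY 1)) 1)).trans ?_
  rw [trace_mul_comm X, trace_mul_comm Y]
  refine aux_trace_mono ?_ hXY
  have := aux_inv (M := (1 : Matrix n n ℂ)) PosDef.one (le_add_of_nonneg_right hY)
  simpa using this


lemma aux_cont (f : ℝ → ℝ) (A : Matrix n n ℂ) : ContinuousOn f (spectrum ℝ A) :=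
  (Matrix.finite_real_spectrum (A := A)).continuousOn f

lemma aux_cfc {A : Matrix n n ℂ} (hA : 0 ≤ A) {t s : ℝ} (ht : 0 < t) :
    cfc (Real.rpowIntegrand₀₁ s t) A =
      (t ^ s) • ((t • (1 : Matrix n n ℂ))⁻¹ - (t • (1 : Matrix n n ℂ) + A)⁻¹) := by
  have hsa : IsSelfAdjoint A := .of_nonneg hA
  have e1 : t • (1 : Matrix n n ℂ) = cfc (fun _ : ℝ => t) A := by
    rw [cfc_const t A hsa, Algebra.algebraMap_eq_smul_one]
  have e2 : t • (1 : Matrix n n ℂ) + A = cfc (fun x : ℝ => t + x) A := by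
    rw [cfc_add (a := A) (fun _ => t) (fun x => x) (aux_cont _ _) (aux_cont _ _), ← e1,
      cfc_id' ℝ A hsa]
  have hne1 : ∀ x ∈ spectrum ℝ A, (fun _ : ℝ => t) x ≠ 0 := fun x hx => ht.ne'
  have hne2 : ∀ x ∈ spectrum ℝ A, (fun x : ℝ => t + x) x ≠ 0 := by
    intro x hx
    have := spectrum_nonneg_of_nonneg hA hx
    exact (by positivity : (0 : ℝ) < t + x).ne'
  rw [e2, e1, nonsing_inv_eq_ringInverse, nonsing_inv_eq_ringInverse,
    ← cfc_inv _ A hne1 (aux_cont _ _) hsa, ← cfc_inv _ A hne2 (aux_cont _ _) hsa,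
    ← cfc_sub (hf := aux_cont _ _) (hg := aux_cont _ _), ← cfc_smul (hf := aux_cont _ _)]
  rfl

open MeasureTheory in
lemma aux_pos_Ioo {s : ℝ} (hs0 : 0 < s) (hs1 : s < 1) {P B : Matrix n n ℂ} (hP : 0 ≤ P) (hB : 0 ≤ B) :
    trace (P * (cfc (fun x : ℝ => x ^ s) (B + P) - cfc (fun x : ℝ => x ^ s) B)) ≤
      trace (P * cfc (fun x : ℝ => x ^ s) P) := by
  lift s to NNReal using hs0.le
  have hs0' : 0 < s := by exact_mod_cast hs0
  obtain ⟨μ, hμ⟩ := CFC.exists_measure_nnrpow_eq_integral_cfcₙ_rpowIntegrand₀₁ (Matrix n n ℂ)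
    (p := s) ⟨hs0', by exact_mod_cast hs1⟩
  have key : ∀ X : Matrix n n ℂ, 0 ≤ X → 
      IntegrableOn (fun t => trace (P * cfc (Real.rpowIntegrand₀₁ s t) X)) (Set.Ioi 0) μ ∧
      trace (P * cfc (fun x : ℝ => x ^ (s:ℝ)) X) =
        ∫ t in Set.Ioi 0, trace (P * cfc (Real.rpowIntegrand₀₁ s t) X) ∂μ := by
    intro X hX
    obtain ⟨h1, h2⟩ := hμ X hX
    have hc : ∀ t : ℝ, cfcₙ (Real.rpowIntegrand₀₁ s t) X = cfc (Real.rpowIntegrand₀₁ s t) X := by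
      intro t
      refine cfcₙ_eq_cfc ?_ (by simp)
      rw [quasispectrum_eq_spectrum_union_zero]
      exact ((Matrix.finite_real_spectrum (A := X)).union (Set.finite_singleton 0)).continuousOn _
    simp only [hc] at h1 h2
    rw [CFC.nnrpow_eq_rpow hs0', CFC.rpow_eq_cfc_real hX] at h2
    let L : Matrix n n ℂ →L[ℝ] ℂ := LinearMap.toContinuousLinearMap
      ((traceLinearMap n ℝ ℂ).comp (LinearMap.mulLeft ℝ P))
    have hL : ∀ Y, L Y = trace (P * Y) := fun Y => rfl
    refine ⟨L.integrable_comp h1, ?_⟩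
    rw [h2, ← hL, ← L.integral_comp_comm h1]
    rfl
  obtain ⟨i1, e1⟩ := key (B + P) (add_nonneg hB hP)
  obtain ⟨i2, e2⟩ := key B hB
  obtain ⟨i3, e3⟩ := key P hP
  rw [mul_sub, trace_sub, e1, e2, e3, ← integral_sub i1 i2]
  refine setIntegral_mono_on (i1.sub i2) i3 measurableSet_Ioi ?_
  intro t ht
  have ht : 0 < t := ht
  rw [aux_cfc hB ht, aux_cfc hP ht, aux_cfc (add_nonneg hB hP) ht, ← trace_sub, ← mul_sub, ← smul_sub,
    mul_smul_comm, mul_smul_comm, trace_smul, trace_smul]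
  refine smul_le_smul_of_nonneg_left ?_ (by positivity)
  have := aux_res (M := t • (1 : Matrix n n ℂ) + B) ht hP (le_add_of_nonneg_right hB)
  rw [add_assoc] at this
  rwa [sub_sub_sub_cancel_left]

lemma aux_pos {s : ℝ} (hs0 : 0 ≤ s) (hs1 : s ≤ 1) {P B : Matrix n n ℂ} (hP : 0 ≤ P) (hB : 0 ≤ B) :
    trace (P * (cfc (fun x : ℝ => x ^ s) (B + P) - cfc (fun x : ℝ => x ^ s) B)) ≤
      trace (P * cfc (fun x : ℝ => x ^ s) P) := by
  rcases hs0.eq_or_lt with rfl | h0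
  · rw [← CFC.rpow_eq_cfc_real hP, ← CFC.rpow_eq_cfc_real hB, ← CFC.rpow_eq_cfc_real (add_nonneg hB hP),
      CFC.rpow_zero _ hP, CFC.rpow_zero _ hB, CFC.rpow_zero _ (add_nonneg hB hP)]
    simpa using hP.posSemidef.trace_nonneg
  rcases hs1.eq_or_lt with rfl | h1
  · rw [← CFC.rpow_eq_cfc_real hP, ← CFC.rpow_eq_cfc_real hB, ← CFC.rpow_eq_cfc_real (add_nonneg hB hP),
      CFC.rpow_one _ hP, CFC.rpow_one _ hB, CFC.rpow_one _ (add_nonneg hB hP)]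
    simp
  exact aux_pos_Ioo h0 h1 hP hB

lemma aux_mono {s : ℝ} (hs0 : 0 ≤ s) (hs1 : s ≤ 1) {A B : Matrix n n ℂ} (hA : 0 ≤ A) (hAB : A ≤ B) :
    cfc (fun x : ℝ => x ^ s) A ≤ cfc (fun x : ℝ => x ^ s) B := by
  rw [← CFC.rpow_eq_cfc_real hA, ← CFC.rpow_eq_cfc_real (hA.trans hAB)]
  exact CFC.rpow_le_rpow ⟨hs0, hs1⟩ hAB

lemma aux_main {s : ℝ} (hs0 : 0 ≤ s) (hs1 : s ≤ 1) {A B P Q : Matrix n n ℂ} (hA : 0 ≤ A) (hB : 0 ≤ B)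
    (hP : 0 ≤ P) (hQ : 0 ≤ Q) (h : A - B = P - Q) :
    trace ((A - B) * (cfc (fun x : ℝ => x ^ s) A - cfc (fun x : ℝ => x ^ s) B)) ≤
      trace (P * cfc (fun x : ℝ => x ^ s) P) + trace (Q * cfc (fun x : ℝ => x ^ s) Q) := by
  have hC : B + P = A + Q := by
    have : A = P - Q + B := by rw [← h]; abel
    rw [this]; abel
  have h1 := aux_trace_mono hP (sub_le_sub_right (aux_mono hs0 hs1 hA
    (hC ▸ le_add_of_nonneg_right hQ : A ≤ B + P)) (cfc (fun x : ℝ => x ^ s) B))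
  have h2 := aux_trace_mono hQ (sub_le_sub_right (aux_mono hs0 hs1 hB
    (hC ▸ le_add_of_nonneg_right hP : B ≤ A + Q)) (cfc (fun x : ℝ => x ^ s) A))
  refine le_trans (le_of_eq ?_) (add_le_add (h1.trans (aux_pos hs0 hs1 hP hB))
    (h2.trans (aux_pos hs0 hs1 hQ hA)))
  rw [h, ← trace_add]
  congr 1
  noncomm_ring

lemma aux_abs {D : Matrix n n ℂ} (hD : IsSelfAdjoint D) {p : ℝ} (hp : 1 ≤ p) :
    ∃ P Q : Matrix n n ℂ, 0 ≤ P ∧ 0 ≤ Q ∧ D = P - Q ∧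
      cfc (fun x : ℝ => x ^ p) (cfc Real.sqrt (Dᴴ * D)) =
        P * cfc (fun x : ℝ => x ^ (p - 1)) P + Q * cfc (fun x : ℝ => x ^ (p - 1)) Q := by
  refine ⟨cfc (fun x : ℝ => max x 0) D, cfc (fun x : ℝ => max (-x) 0) D,
    cfc_nonneg fun _ _ => le_max_right _ _, cfc_nonneg fun _ _ => le_max_right _ _, ?_, ?_⟩
  · rw [← cfc_sub (hf := aux_cont _ _) (hg := aux_cont _ _)]
    nth_rewrite 1 [← cfc_id' ℝ D hD]
    congr 1
    ext x
    rcases le_total x 0 with h | h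
    · simp [h]
    · simp [h]
  · have hDD : Dᴴ * D = cfc (fun x : ℝ => x * x) D := by
      rw [cfc_mul (fun x : ℝ => x) (fun x : ℝ => x) D (aux_cont _ _) (aux_cont _ _), cfc_id' ℝ D hD]
      congr 1
    have fin : ∀ f g : ℝ → ℝ, ContinuousOn g (f '' spectrum ℝ D) := fun f g =>
      ((Matrix.finite_real_spectrum (A := D)).image f).continuousOn g
    rw [hDD, ← cfc_comp' _ _ D (fin _ _) (aux_cont _ _) hD, ← cfc_comp' _ _ D (fin _ _) (aux_cont _ _) hD,
      ← cfc_comp' _ _ D (fin _ _) (aux_cont _ _) hD, ← cfc_comp' _ _ D (fin _ _) (aux_cont _ _) hD,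
      ← cfc_mul (hf := aux_cont _ _) (hg := aux_cont _ _),
      ← cfc_mul (hf := aux_cont _ _) (hg := aux_cont _ _),
      ← cfc_add (hf := aux_cont _ _) (hg := aux_cont _ _)]
    congr 1
    ext x
    have hpow : ∀ y : ℝ, 0 ≤ y → y * y ^ (p - 1) = y ^ p := by
      intro y hy
      rcases hy.eq_or_lt with rfl | hy
      · rw [Real.zero_rpow (by linarith : p ≠ 0)]; simp
      · rw [Real.rpow_sub_one hy.ne']; field_simp
    rw [Real.sqrt_mul_self_eq_abs, hpow _ (le_max_right _ _), hpow _ (le_max_right _ _)]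
    have hp0 : p ≠ 0 := by linarith
    rcases le_total x 0 with h | h
    · simp [h, abs_of_nonpos h, Real.zero_rpow hp0]
    · simp [h, abs_of_nonneg h, Real.zero_rpow hp0]

end

theorem stmt_6 {n : Type*} [Fintype n] [DecidableEq n] (p : ℝ) (hp1 : 1 ≤ p) (hp2 : p ≤ 2)
    (A B : Matrix n n ℂ) (hA : A.PosSemidef) (hB : B.PosSemidef) :
    Matrix.trace ((A - B) *
        (cfc (fun x : ℝ => x ^ (p - 1)) A - cfc (fun x : ℝ => x ^ (p - 1)) B)) ≤
      Matrix.trace (cfc (fun x : ℝ => x ^ p) (matAbs (A - B))) := by 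
  obtain ⟨P, Q, hP, hQ, h, e⟩ := aux_abs (D := A - B) (hA.1.sub hB.1) hp1
  rw [matAbs, e, trace_add]
  exact aux_main (by linarith) (by linarith) (nonneg_iff_posSemidef.mpr hA)
    (nonneg_iff_posSemidef.mpr hB) hP hQ h
end

section
/- For p ≥ 2 and positive semidefinite n×n complex matrices A, B, Tr((A - B)(A^(p-1) - B^(p-1))) ≥ Tr(|A - B|^p). -/
open Matrix ComplexOrder

set_option linter.unusedSectionVars false

namespace Ric

variable {n : Type*} [Fintype n] [DecidableEq n]

/-- `U diag(f) Uᴴ`. -/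
noncomputable def Fn (U : Matrix n n ℂ) (f : n → ℝ) : Matrix n n ℂ :=
  U * diagonal (fun i => (f i : ℂ)) * Uᴴ

/-- Real part of the trace. -/
noncomputable def tr (X : Matrix n n ℂ) : ℝ := (trace X).re

def Un (U : Matrix n n ℂ) : Prop := Uᴴ * U = 1 ∧ U * Uᴴ = 1

lemma tr_add (X Y : Matrix n n ℂ) : tr (X + Y) = tr X + tr Y := by simp [tr]
lemma tr_sub (X Y : Matrix n n ℂ) : tr (X - Y) = tr X - tr Y := by simp [tr]
lemma tr_smul (c : ℝ) (X : Matrix n n ℂ) : tr (c • X) = c * tr X := by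
  simp [tr, trace_smul]
lemma tr_comm (X Y : Matrix n n ℂ) : tr (X * Y) = tr (Y * X) := by
  simp [tr, trace_mul_comm X Y]

lemma exists_spec {A : Matrix n n ℂ} (hA : A.IsHermitian) :
    ∃ (U : Matrix n n ℂ) (a : n → ℝ), Un U ∧ A = Fn U a ∧
      (∀ f : ℝ → ℝ, cfc f A = Fn U (fun i => f (a i))) ∧ (A.PosSemidef → ∀ i, 0 ≤ a i) := by
  refine ⟨hA.eigenvectorUnitary, hA.eigenvalues, ⟨?_, ?_⟩, ?_, ?_, ?_⟩
  · exact Unitary.coe_star_mul_self hA.eigenvectorUnitary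
  · exact Unitary.coe_mul_star_self hA.eigenvectorUnitary
  · conv_lhs => rw [hA.spectral_theorem]
    rfl
  · intro f
    rw [hA.cfc_eq]
    rfl
  · intro h i
    exact h.eigenvalues_nonneg i

lemma Fn_mul {U : Matrix n n ℂ} (hU : Un U) (f g : n → ℝ) :
    Fn U f * Fn U g = Fn U (fun i => f i * g i) := by
  have : Fn U f * Fn U g = U * diagonal (fun i => (f i : ℂ)) * (Uᴴ * U) *
      diagonal (fun i => (g i : ℂ)) * Uᴴ := by simp only [Fn, Matrix.mul_assoc]
  rw [this, hU.1, Matrix.mul_one, Matrix.mul_assoc U, diagonal_mul_diagonal]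
  simp [Fn]

lemma Fn_add (U : Matrix n n ℂ) (f g : n → ℝ) :
    Fn U f + Fn U g = Fn U (fun i => f i + g i) := by
  simp only [Fn, ← Matrix.add_mul, ← Matrix.mul_add, diagonal_add]
  simp

lemma Fn_sub (U : Matrix n n ℂ) (f g : n → ℝ) :
    Fn U f - Fn U g = Fn U (fun i => f i - g i) := by
  simp only [Fn, ← Matrix.sub_mul, ← Matrix.mul_sub, diagonal_sub]
  simp

lemma Fn_smul (U : Matrix n n ℂ) (c : ℝ) (f : n → ℝ) :
    c • Fn U f = Fn U (fun i => c * f i) := by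
  have : diagonal (fun i => ((c * f i : ℝ) : ℂ)) = c • diagonal (fun i => (f i : ℂ)) := by
    ext i j
    by_cases h : i = j
    · subst h; simp
    · simp [h]
  simp only [Fn, this, Matrix.mul_smul, Matrix.smul_mul]

lemma Fn_one {U : Matrix n n ℂ} (hU : Un U) : Fn U (fun _ => 1) = 1 := by
  simp [Fn, hU.2]

lemma Fn_herm (U : Matrix n n ℂ) (f : n → ℝ) : (Fn U f)ᴴ = Fn U f := by
  have : (diagonal (fun i => (f i : ℂ)))ᴴ = diagonal (fun i => (f i : ℂ)) := by
    rw [diagonal_conjTranspose]; congr 1; ext i; simp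
  simp only [Fn, conjTranspose_mul, conjTranspose_conjTranspose, this, Matrix.mul_assoc]

lemma Fn_psd (U : Matrix n n ℂ) (f : n → ℝ) (hf : ∀ i, 0 ≤ f i) : (Fn U f).PosSemidef := by
  refine PosSemidef.mul_mul_conjTranspose_same (PosSemidef.diagonal ?_) U
  intro i
  simpa using hf i

lemma tr_mul_Fn (X U : Matrix n n ℂ) (f : n → ℝ) :
    tr (X * Fn U f) = ∑ i, f i * ((Uᴴ * X * U) i i).re := by
  have : trace (X * Fn U f) = trace (diagonal (fun i => (f i : ℂ)) * (Uᴴ * X * U)) := by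
    rw [Fn, ← Matrix.mul_assoc, ← Matrix.mul_assoc, trace_mul_comm, ← Matrix.mul_assoc,
      ← Matrix.mul_assoc, trace_mul_comm]
  rw [tr, this, trace, Complex.re_sum]
  refine Finset.sum_congr rfl fun i _ => ?_
  simp [diagonal_mul]

lemma tr_Fn {U : Matrix n n ℂ} (hU : Un U) (f : n → ℝ) : tr (Fn U f) = ∑ i, f i := by
  have := tr_mul_Fn 1 U f
  rw [Matrix.one_mul] at this
  rw [this]
  simp [hU.1]

lemma conj_Fn {U : Matrix n n ℂ} (hU : Un U) (f : n → ℝ) :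
    Uᴴ * Fn U f * U = diagonal (fun i => (f i : ℂ)) := by
  have : Uᴴ * Fn U f * U = (Uᴴ * U) * diagonal (fun i => (f i : ℂ)) * (Uᴴ * U) := by
    simp only [Fn, Matrix.mul_assoc]
  rw [this, hU.1]; simp

lemma tr_conj {V : Matrix n n ℂ} (hV : Un V) (X : Matrix n n ℂ) :
    ∑ k, ((Vᴴ * X * V) k k).re = tr X := by
  have := tr_mul_Fn X V (fun _ => 1)
  rw [Fn_one hV, Matrix.mul_one] at this
  rw [this]; simp

lemma quad (V U : Matrix n n ℂ) (f : n → ℝ) (k : n) :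
    ((Vᴴ * Fn U f * V) k k).re = ∑ i, Complex.normSq ((Uᴴ * V) i k) * f i := by
  have : Vᴴ * Fn U f * V = (Uᴴ * V)ᴴ * (diagonal (fun i => (f i : ℂ)) * (Uᴴ * V)) := by
    simp only [Fn, conjTranspose_mul, conjTranspose_conjTranspose, Matrix.mul_assoc]
  rw [this, mul_apply, Complex.re_sum]
  refine Finset.sum_congr rfl fun i _ => ?_
  rw [diagonal_mul, conjTranspose_apply]
  simp [Complex.normSq_apply]
  ring

lemma weight {U V : Matrix n n ℂ} (hU : Un U) (hV : Un V) (k : n) :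
    ∑ i, Complex.normSq ((Uᴴ * V) i k) = 1 := by
  have := quad V U (fun _ => 1) k
  rw [Fn_one hU, Matrix.mul_one, hV.1] at this
  simpa using this.symm

/-- Jensen -/
lemma jensen {U V : Matrix n n ℂ} (hU : Un U) (hV : Un V) (a : n → ℝ) (ha : ∀ i, 0 ≤ a i)
    (φ : ℝ → ℝ) (hφ : ConvexOn ℝ (Set.Ici 0) φ) (k : n) :
    φ ((Vᴴ * Fn U a * V) k k).re ≤ ((Vᴴ * Fn U (fun i => φ (a i)) * V) k k).re := by
  rw [quad, quad]
  have := hφ.map_sum_le (t := Finset.univ) (w := fun i => Complex.normSq ((Uᴴ * V) i k))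
    (p := a) (fun i _ => Complex.normSq_nonneg _) (weight hU hV k) (fun i _ => ha i)
  simpa using this

lemma diag_re_nonneg {X : Matrix n n ℂ} (hX : X.PosSemidef) (V : Matrix n n ℂ) (k : n) :
    0 ≤ ((Vᴴ * X * V) k k).re := by
  have := (hX.conjTranspose_mul_mul_same V).diag_nonneg (i := k)
  exact (Complex.le_def.1 this).1

lemma tr_nonneg {X : Matrix n n ℂ} (hX : X.PosSemidef) : 0 ≤ tr X :=
  (Complex.le_def.1 hX.trace_nonneg).1

lemma tr_mul_nonneg {U X : Matrix n n ℂ} (f : n → ℝ) (hf : ∀ i, 0 ≤ f i) (hX : X.PosSemidef) :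
    0 ≤ tr (Fn U f * X) := by
  rw [tr_comm, tr_mul_Fn]
  exact Finset.sum_nonneg fun i _ => mul_nonneg (hf i) (diag_re_nonneg hX U i)

lemma inv_anti {X N R R' : Matrix n n ℂ} (hN : N.PosSemidef) (hR : R.PosSemidef)
    (hR' : R'.PosSemidef) (h1 : R * X = 1) (h3 : (X + N) * R' = 1) :
    (R - R').PosSemidef := by
  have h2 : X * R = 1 := mul_eq_one_comm.1 h1
  have h4 : R' * (X + N) = 1 := mul_eq_one_comm.1 h3
  have e1 : R - R' = R' * N * R := by
    calc R - R' = R' * (X + N) * R - R' * (X * R) := by rw [h4, h2]; simp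
      _ = _ := by noncomm_ring
  have e2 : R - R' = R * N * R' := by
    calc R - R' = R * ((X + N) * R') - (R * X) * R' := by rw [h3, h1]; simp
      _ = _ := by noncomm_ring
  have e3 : R - R' = R' * N * R'ᴴ + (R' * N) * R * (R' * N)ᴴ := by
    rw [conjTranspose_mul, hN.1.eq, hR'.1.eq]
    calc R - R' = R' * N * (R' + (R - R')) := by rw [add_sub_cancel]; exact e1
      _ = R' * N * (R' + R * N * R') := by rw [e2]
      _ = _ := by noncomm_ring
  rw [e3]
  exact (hN.mul_mul_conjTranspose_same R').add (hR.mul_mul_conjTranspose_same _)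

/-- the basic function -/
noncomputable def g (l x : ℝ) : ℝ := x - l + l ^ 2 * (l + x)⁻¹

lemma g_eq {l x : ℝ} (hl : 0 < l) (hx : 0 ≤ x) : g l x = x ^ 2 / (l + x) := by
  have : l + x ≠ 0 := by positivity
  unfold g; field_simp; ring

lemma g_convex {l : ℝ} (hl : 0 < l) : ConvexOn ℝ (Set.Ici 0) (g l) := by
  refine ⟨convex_Ici 0, ?_⟩
  intro x hx y hy a b ha hb hab
  have hx : 0 ≤ x := hx
  have hy : 0 ≤ y := hy
  have hz : 0 ≤ a * x + b * y := by positivity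
  simp only [smul_eq_mul]
  rw [g_eq hl hz, g_eq hl hx, g_eq hl hy, div_le_iff₀ (by positivity)]
  have h1 : 0 < l + x := by positivity
  have h2 : 0 < l + y := by positivity
  have hb' : b = 1 - a := by linarith
  have key : (a * (x ^ 2 / (l + x)) + b * (y ^ 2 / (l + y))) * (l + (a * x + b * y))
      - (a * x + b * y) ^ 2 = a * b * l ^ 2 * (x - y) ^ 2 / ((l + x) * (l + y)) := by
    subst hb'
    field_simp
    ring
  have : 0 ≤ a * b * l ^ 2 * (x - y) ^ 2 / ((l + x) * (l + y)) := by positivity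
  linarith

lemma g_mono {l x y : ℝ} (hl : 0 < l) (hx : 0 ≤ x) (hxy : x ≤ y) : g l x ≤ g l y := by
  have hy : 0 ≤ y := hx.trans hxy
  rw [g_eq hl hx, g_eq hl hy, div_le_div_iff₀ (by positivity) (by positivity)]
  nlinarith [mul_nonneg hx hy, mul_nonneg (mul_nonneg hx hy) (sub_nonneg.2 hxy),
    mul_nonneg hl.le (mul_nonneg (sub_nonneg.2 hxy) (add_nonneg hx hy))]

lemma Fn_g {U : Matrix n n ℂ} (hU : Un U) (a : n → ℝ) (l : ℝ) :
    Fn U (fun i => g l (a i)) =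
      Fn U a - l • 1 + (l ^ 2) • Fn U (fun i => (l + a i)⁻¹) := by
  rw [← Fn_one hU, Fn_smul, Fn_smul, Fn_sub, Fn_add]
  simp [g]

lemma Fn_res {U : Matrix n n ℂ} (hU : Un U) {a : n → ℝ} (ha : ∀ i, 0 ≤ a i) {l : ℝ}
    (hl : 0 < l) :
    Fn U (fun i => (l + a i)⁻¹) * (l • (1 : Matrix n n ℂ) + Fn U a) = 1 := by
  rw [← Fn_one hU, Fn_smul, Fn_add, Fn_mul hU]
  congr 1
  ext i
  have : l + a i ≠ 0 := by have := ha i; positivity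
  field_simp

lemma core1 {UB V : Matrix n n ℂ} (hB : Un UB) (hV : Un V) {b t : n → ℝ}
    (hb : ∀ i, 0 ≤ b i) (ht : ∀ i, 0 ≤ t i) {l : ℝ} (hl : 0 < l) {R : Matrix n n ℂ}
    (hR : (l • (1 : Matrix n n ℂ) + Fn UB b + Fn V t) * R = 1) :
    l * (tr (Fn V t * Fn UB (fun i => (l + b i)⁻¹)) - tr (Fn V t * R)) ≤ ∑ i, g l (t i) := by
  set S := Fn UB (fun i => (l + b i)⁻¹) with hS
  set T := Fn V t with hT
  set Q := Fn V (fun i => √(t i)) with hQ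
  have hQQ : Q * Q = T := by
    rw [hQ, Fn_mul hV, hT]; congr 1; ext i; exact Real.mul_self_sqrt (ht i)
  have hQh : Qᴴ = Q := Fn_herm _ _
  have hSpsd : S.PosSemidef := Fn_psd _ _ fun i => by have := hb i; positivity
  have hS1 : S * (l • (1 : Matrix n n ℂ) + Fn UB b) = 1 := Fn_res hB hb hl
  have hS2 : (l • (1 : Matrix n n ℂ) + Fn UB b) * S = 1 := mul_eq_one_comm.1 hS1
  have hR2 : R * (l • (1 : Matrix n n ℂ) + Fn UB b + T) = 1 := mul_eq_one_comm.1 hR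
  have hM : (Q * S * Q).PosSemidef := by
    have := hSpsd.mul_mul_conjTranspose_same Q
    rwa [hQh] at this
  obtain ⟨W, m, hW, hMW, -, hm⟩ := exists_spec hM.1
  have hm := hm hM
  -- push through
  have h1 : Q * R * Q * (1 + Q * S * Q) = Q * S * Q := by
    calc Q * R * Q * (1 + Q * S * Q) = Q * R * (Q + (Q * Q) * S * Q) := by noncomm_ring
      _ = Q * R * (((l • (1 : Matrix n n ℂ) + Fn UB b) * S) * Q + T * S * Q) := by
          rw [hQQ, hS2, Matrix.one_mul]
      _ = Q * (R * (l • (1 : Matrix n n ℂ) + Fn UB b + T)) * S * Q := by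
          simp only [Matrix.mul_add, Matrix.add_mul, Matrix.mul_assoc]
      _ = Q * S * Q := by rw [hR2, Matrix.mul_one]
  have h2 : Q * R * Q = Fn W (fun i => m i / (1 + m i)) := by
    have h3 : (1 + Q * S * Q) * Fn W (fun i => (1 + m i)⁻¹) = 1 := by
      rw [hMW, ← Fn_one hW, Fn_add, Fn_mul hW]
      congr 1; ext i
      have : 1 + m i ≠ 0 := by have := hm i; positivity
      field_simp
    calc Q * R * Q = Q * R * Q * ((1 + Q * S * Q) * Fn W (fun i => (1 + m i)⁻¹)) := by
          rw [h3, Matrix.mul_one]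
      _ = Q * S * Q * Fn W (fun i => (1 + m i)⁻¹) := by rw [← Matrix.mul_assoc, h1]
      _ = _ := by rw [hMW, Fn_mul hW]; rfl
  have cyc : ∀ X, tr (T * X) = tr (Q * X * Q) := fun X => by
    rw [← hQQ, tr_comm (Q * X) Q]; simp only [Matrix.mul_assoc]
  rw [cyc, cyc, h2, hMW, tr_Fn hW, tr_Fn hW, ← Finset.sum_sub_distrib, Finset.mul_sum]
  have hle : (T - l • Fn W m).PosSemidef := by
    have e : T - l • Fn W m = Q * (1 - l • S) * Qᴴ := by
      rw [← hMW, hQh, ← hQQ]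
      simp only [Matrix.mul_sub, Matrix.sub_mul, Matrix.mul_one, Matrix.mul_smul, Matrix.smul_mul]
    rw [e]
    refine PosSemidef.mul_mul_conjTranspose_same ?_ Q
    have : 1 - l • S = Fn UB (fun i => 1 - l * (l + b i)⁻¹) := by
      rw [← Fn_one hB, hS, Fn_smul, Fn_sub]
    rw [this]
    refine Fn_psd _ _ fun i => ?_
    have hbi := hb i
    rw [sub_nonneg, ← div_eq_mul_inv, div_le_one (by positivity)]
    linarith
  have hk : ∀ k, l * (m k - m k / (1 + m k)) ≤
      ((Wᴴ * Fn V (fun i => g l (t i)) * W) k k).re := by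
    intro k
    have hmk := hm k
    have e1 : l * (m k - m k / (1 + m k)) = g l (l * m k) := by
      rw [g_eq hl (by positivity)]
      field_simp
      ring
    have e2 : l * m k ≤ ((Wᴴ * T * W) k k).re := by
      have := diag_re_nonneg hle W k
      rw [Fn_smul, Matrix.mul_sub, Matrix.sub_mul, conj_Fn hW] at this
      simpa using this
    rw [e1]
    exact (g_mono hl (by positivity) e2).trans (jensen hV hW t ht (g l) (g_convex hl) k)
  refine (Finset.sum_le_sum fun k _ => hk k).trans ?_
  rw [tr_conj hW, tr_Fn hV]

lemma core2 {UA UB V N : Matrix n n ℂ} (hA : Un UA) (hB : Un UB) (hV : Un V) {a b t : n → ℝ}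
    (ha : ∀ i, 0 ≤ a i) (hb : ∀ i, 0 ≤ b i) (ht : ∀ i, 0 ≤ t i) (hN : N.PosSemidef)
    (hTN : Fn V t * N = 0) (hsum : Fn UA a + N = Fn UB b + Fn V t) {l : ℝ} (hl : 0 < l) :
    ∑ i, t i * g l (t i) ≤
      tr (Fn V t * (Fn UA (fun i => g l (a i)) - Fn UB (fun i => g l (b i)))) := by
  obtain ⟨C, hCdef⟩ : ∃ C, C = Fn UA a + N := ⟨_, rfl⟩
  have hC : C.PosSemidef := by rw [hCdef]; exact (Fn_psd _ _ ha).add hN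
  obtain ⟨W, c, hW, hCW, -, hc⟩ := exists_spec hC.1
  have hc := hc hC
  set R' := Fn W (fun i => (l + c i)⁻¹) with hR'
  have h1 : R' * (l • (1 : Matrix n n ℂ) + C) = 1 := by
    have := Fn_res hW hc hl; rwa [← hCW] at this
  have h2 : (l • (1 : Matrix n n ℂ) + C) * R' = 1 := mul_eq_one_comm.1 h1
  have hR'p : R'.PosSemidef := Fn_psd _ _ fun i => by have := hc i; positivity
  have hRp : (Fn UA (fun i => (l + a i)⁻¹)).PosSemidef :=
    Fn_psd _ _ fun i => by have := ha i; positivity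
  have h3 := inv_anti hN hRp hR'p (Fn_res hA ha hl) (by rw [add_assoc, ← hCdef]; exact h2)
  have h4 := tr_mul_nonneg (U := V) t ht h3
  rw [Matrix.mul_sub, tr_sub] at h4
  have h5 := core1 hB hV hb ht hl (R := R') (by rw [add_assoc, ← hsum, ← hCdef]; exact h2)
  have hAB : Fn UA a - Fn UB b = Fn V t - N := by
    rw [sub_eq_sub_iff_add_eq_add, hsum, add_comm]
  have h6 : tr (Fn V t * (Fn UA a - Fn UB b)) = ∑ i, t i ^ 2 := by
    rw [hAB, Matrix.mul_sub, hTN, sub_zero, Fn_mul hV, tr_Fn hV]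
    exact Finset.sum_congr rfl fun i _ => by ring
  have h7 : tr (Fn V t * (Fn UA (fun i => g l (a i)) - Fn UB (fun i => g l (b i)))) =
      ∑ i, t i ^ 2 + l ^ 2 * (tr (Fn V t * Fn UA (fun i => (l + a i)⁻¹)) -
        tr (Fn V t * Fn UB (fun i => (l + b i)⁻¹))) := by
    rw [← h6, ← tr_sub, ← Matrix.mul_sub, ← tr_smul, ← tr_add, ← Matrix.mul_smul,
      ← Matrix.mul_add, Fn_g hA, Fn_g hB]
    congr 2
    module
  have h8 : ∑ i, t i * g l (t i) = ∑ i, t i ^ 2 - l * ∑ i, g l (t i) := by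
    rw [Finset.mul_sum, ← Finset.sum_sub_distrib]
    refine Finset.sum_congr rfl fun i _ => ?_
    have := ht i
    rw [g_eq hl this]
    field_simp
    ring
  rw [h7, h8]
  nlinarith [mul_le_mul_of_nonneg_left h5 hl.le, mul_nonneg (sq_nonneg l) h4]

lemma core3 {UA UB V : Matrix n n ℂ} (hA : Un UA) (hB : Un UB) (hV : Un V) {a b d : n → ℝ}
    (ha : ∀ i, 0 ≤ a i) (hb : ∀ i, 0 ≤ b i) (hD : Fn UA a - Fn UB b = Fn V d)
    {l : ℝ} (hl : 0 < l) :
    ∑ i, |d i| * g l |d i| ≤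
      tr (Fn V d * (Fn UA (fun i => g l (a i)) - Fn UB (fun i => g l (b i)))) := by
  have hpn : ∀ x : ℝ, max x 0 * max (-x) 0 = 0 := fun x => by
    rcases le_total 0 x with h | h <;> simp [h]
  have hd : Fn V d = Fn V (fun i => max (d i) 0) - Fn V (fun i => max (-d i) 0) := by
    rw [Fn_sub]; congr 1; ext i
    rcases le_total 0 (d i) with h | h <;> simp [h]
  have h0 : Fn V (fun _ => (0 : ℝ)) = 0 := by simp [Fn]
  have hsum : Fn UA a + Fn V (fun i => max (-d i) 0) = Fn UB b + Fn V (fun i => max (d i) 0) := by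
    have := hD.trans hd
    rw [sub_eq_sub_iff_add_eq_add] at this
    rw [this, add_comm]
  have e1 := core2 hA hB hV ha hb (t := fun i => max (d i) 0) (fun i => le_max_right _ _)
    (Fn_psd V (fun i => max (-d i) 0) fun i => le_max_right _ _)
    (by rw [Fn_mul hV]; simp only [hpn, h0]) hsum hl
  have e2 := core2 hB hA hV hb ha (t := fun i => max (-d i) 0) (fun i => le_max_right _ _)
    (Fn_psd V (fun i => max (d i) 0) fun i => le_max_right _ _)
    (by rw [Fn_mul hV]; simp only [mul_comm, hpn, h0]) hsum.symm hl
  have h3 : ∑ i, |d i| * g l |d i| = ∑ i, max (d i) 0 * g l (max (d i) 0)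
      + ∑ i, max (-d i) 0 * g l (max (-d i) 0) := by
    rw [← Finset.sum_add_distrib]
    refine Finset.sum_congr rfl fun i _ => ?_
    rcases le_total 0 (d i) with h | h
    · simp [h, abs_of_nonneg h]
    · simp [h, abs_of_nonpos h]
  rw [h3, hd, Matrix.sub_mul, tr_sub]
  have e4 : tr (Fn V (fun i => max (-d i) 0) *
      (Fn UB (fun i => g l (b i)) - Fn UA (fun i => g l (a i)))) =
      - tr (Fn V (fun i => max (-d i) 0) *
      (Fn UA (fun i => g l (a i)) - Fn UB (fun i => g l (b i)))) := by
    rw [Matrix.mul_sub, Matrix.mul_sub, tr_sub, tr_sub]; ring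
  linarith

open MeasureTheory in
lemma case12 {UA UB V : Matrix n n ℂ} (hA : Un UA) (hB : Un UB) (hV : Un V) {a b d : n → ℝ}
    (ha : ∀ i, 0 ≤ a i) (hb : ∀ i, 0 ≤ b i) (hD : Fn UA a - Fn UB b = Fn V d)
    {q : ℝ} (hq : q ∈ Set.Ioo (1 : ℝ) 2) :
    ∑ i, |d i| * |d i| ^ q ≤
      tr (Fn V d * (Fn UA (fun i => a i ^ q) - Fn UB (fun i => b i ^ q))) := by
  obtain ⟨μ, hμ⟩ := Real.exists_measure_rpow_eq_integral_rpowIntegrand₁₂ hq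
  have hexp : ∀ f : ℝ → ℝ, tr (Fn V d * (Fn UA (fun i => f (a i)) - Fn UB (fun i => f (b i)))) =
      ∑ i, f (a i) * ((UAᴴ * Fn V d * UA) i i).re - ∑ i, f (b i) * ((UBᴴ * Fn V d * UB) i i).re := by
    intro f
    rw [Matrix.mul_sub, tr_sub, tr_mul_Fn, tr_mul_Fn]
  have key := hexp (fun x => x ^ q)
  rw [key]
  have i1 : ∀ x, 0 ≤ x → ∀ c : ℝ, IntegrableOn (fun t => Real.rpowIntegrand₁₂ q t x * c)
      (Set.Ioi 0) μ := fun x hx c => (hμ x hx).1.mul_const c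
  have i2 : ∀ x, 0 ≤ x → ∀ c : ℝ, x ^ q * c =
      ∫ t in Set.Ioi 0, Real.rpowIntegrand₁₂ q t x * c ∂μ := fun x hx c => by
    rw [integral_mul_const, ← (hμ x hx).2]
  have s1 : ∑ i, |d i| * |d i| ^ q =
      ∫ t in Set.Ioi 0, ∑ i, Real.rpowIntegrand₁₂ q t |d i| * |d i| ∂μ := by
    rw [integral_finsetSum _ fun i _ => i1 _ (abs_nonneg _) _]
    exact Finset.sum_congr rfl fun i _ => by rw [mul_comm]; exact i2 _ (abs_nonneg _) _
  have s2 : ∀ (e : n → ℝ) (he : ∀ i, 0 ≤ e i) (c : n → ℝ), ∑ i, e i ^ q * c i =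
      ∫ t in Set.Ioi 0, ∑ i, Real.rpowIntegrand₁₂ q t (e i) * c i ∂μ := by
    intro e he c
    rw [integral_finsetSum _ fun i _ => i1 _ (he i) _]
    exact Finset.sum_congr rfl fun i _ => i2 _ (he i) _
  rw [s1, s2 a ha, s2 b hb, ← integral_sub]
  · refine setIntegral_mono_on ?_ ?_ measurableSet_Ioi ?_
    · exact integrable_finsetSum _ fun i _ => i1 _ (abs_nonneg _) _
    · exact (integrable_finsetSum _ fun i _ => i1 _ (ha i) _).sub
        (integrable_finsetSum _ fun i _ => i1 _ (hb i) _)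
    · intro t ht
      have ht : 0 < t := ht
      have h1 := core3 hA hB hV ha hb hD ht
      have h2 := hexp (g t)
      rw [h2] at h1
      have h3 : ∀ x, Real.rpowIntegrand₁₂ q t x = (t ^ (q - 1) * t⁻¹) * g t x := by
        intro x
        unfold Real.rpowIntegrand₁₂ g
        field_simp
        ring
      simp only [h3, mul_assoc (t ^ (q - 1) * t⁻¹), ← Finset.mul_sum]
      rw [← mul_sub]
      refine mul_le_mul_of_nonneg_left ?_ (by positivity)
      refine le_of_eq_of_le ?_ h1
      exact Finset.sum_congr rfl fun i _ => by ring
  · exact integrable_finsetSum _ fun i _ => i1 _ (ha i) _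
  · exact integrable_finsetSum _ fun i _ => i1 _ (hb i) _

lemma tr_two {U V : Matrix n n ℂ} (hU : Un U) (hV : Un V) (X Y : Matrix n n ℂ) :
    tr (Xᴴ * Y) = ∑ j, ∑ i, (star ((Uᴴ * X * V) i j) * (Uᴴ * Y * V) i j).re := by
  have h : (Uᴴ * X * V)ᴴ * (Uᴴ * Y * V) = Vᴴ * (Xᴴ * Y) * V := by
    have : (Uᴴ * X * V)ᴴ * (Uᴴ * Y * V) = Vᴴ * (Xᴴ * ((U * Uᴴ) * Y)) * V := by
      simp only [conjTranspose_mul, conjTranspose_conjTranspose, Matrix.mul_assoc]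
    rw [this, hU.2, Matrix.one_mul]
  rw [← tr_conj hV, ← h]
  refine Finset.sum_congr rfl fun j _ => ?_
  rw [mul_apply, Complex.re_sum]
  rfl

lemma left_Fn {U V : Matrix n n ℂ} (hU : Un U) (f : n → ℝ) (X : Matrix n n ℂ) (i j : n) :
    (Uᴴ * (Fn U f * X) * V) i j = f i * (Uᴴ * X * V) i j := by
  have : Uᴴ * (Fn U f * X) * V = (Uᴴ * U) * (diagonal (fun i => (f i : ℂ)) * (Uᴴ * X * V)) := by
    simp only [Fn, Matrix.mul_assoc]
  rw [this, hU.1, Matrix.one_mul, diagonal_mul]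

lemma right_Fn {U V : Matrix n n ℂ} (hV : Un V) (f : n → ℝ) (X : Matrix n n ℂ) (i j : n) :
    (Uᴴ * (X * Fn V f) * V) i j = f j * (Uᴴ * X * V) i j := by
  have : Uᴴ * (X * Fn V f) * V = (Uᴴ * X * V) * diagonal (fun i => (f i : ℂ)) * (Vᴴ * V) := by
    simp only [Fn, Matrix.mul_assoc]
  rw [this, hV.1, Matrix.mul_one, mul_diagonal, mul_comm]

lemma diff_Fn {U V : Matrix n n ℂ} (hU : Un U) (hV : Un V) (f h : n → ℝ) (i j : n) :
    (Uᴴ * (Fn U f - Fn V h) * V) i j = ((f i - h j : ℝ) : ℂ) * (Uᴴ * V) i j := by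
  have h1 := left_Fn (V := V) hU f 1 i j
  have h2 := right_Fn (U := U) hV h 1 i j
  rw [Matrix.mul_one] at h1 h2
  rw [Matrix.one_mul] at h2
  rw [Matrix.mul_sub, Matrix.sub_mul, Matrix.sub_apply, h1, h2, Matrix.mul_one]
  push_cast; ring

lemma scal {a b q : ℝ} (hq : 2 ≤ q) (ha : 0 ≤ a) (hb : 0 ≤ b) :
    (a - b) ^ 2 * a ^ (q - 1) + (a - b) ^ 2 * b ^ (q - 1) ≤ (a - b) * (a ^ q - b ^ q) := by
  have e : ∀ x : ℝ, 0 ≤ x → x ^ q = x ^ 2 * x ^ (q - 2) ∧ x ^ (q - 1) = x * x ^ (q - 2) := by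
    intro x hx
    constructor
    · rw [← Real.rpow_natCast, ← Real.rpow_add' hx (by push_cast; linarith)]
      congr 1; push_cast; ring
    · nth_rewrite 2 [← Real.rpow_one x]
      rw [← Real.rpow_add' hx (by linarith)]
      congr 1; ring
  rw [(e a ha).1, (e a ha).2, (e b hb).1, (e b hb).2]
  have key : 0 ≤ (a - b) * (a ^ (q - 2) - b ^ (q - 2)) := by
    rcases le_total a b with h | h
    · have := Real.rpow_le_rpow ha h (by linarith : 0 ≤ q - 2)
      nlinarith
    · have := Real.rpow_le_rpow hb h (by linarith : 0 ≤ q - 2)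
      nlinarith
  nlinarith [mul_nonneg (mul_nonneg ha hb) key]

lemma case2 {UA UB V : Matrix n n ℂ} (hA : Un UA) (hB : Un UB) (hV : Un V) {a b d : n → ℝ}
    (ha : ∀ i, 0 ≤ a i) (hb : ∀ i, 0 ≤ b i) (hD : Fn UA a - Fn UB b = Fn V d)
    {q : ℝ} (hq : 2 ≤ q) :
    ∑ i, |d i| * |d i| ^ q ≤
      tr (Fn V d * (Fn UA (fun i => a i ^ q) - Fn UB (fun i => b i ^ q))) := by
  set Ar := Fn UA (fun i => a i ^ (q - 1)) with hAr
  set Br := Fn UB (fun i => b i ^ (q - 1)) with hBr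
  have hDD : Fn V d * Fn V d = Fn V (fun i => d i ^ 2) := by
    rw [Fn_mul hV]; congr 1; ext i; ring
  have step1 : tr (Ar * Fn V (fun i => d i ^ 2)) + tr (Br * Fn V (fun i => d i ^ 2)) ≤
      tr (Fn V d * (Fn UA (fun i => a i ^ q) - Fn UB (fun i => b i ^ q))) := by
    have x1 : tr (Ar * Fn V (fun i => d i ^ 2)) = tr ((Fn V d)ᴴ * (Ar * Fn V d)) := by
      rw [Fn_herm, tr_comm (Fn V d), Matrix.mul_assoc, hDD]
    have x2 : tr (Br * Fn V (fun i => d i ^ 2)) = tr ((Fn V d)ᴴ * (Fn V d * Br)) := by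
      rw [Fn_herm, ← Matrix.mul_assoc, hDD, tr_comm]
    have x3 : ∀ X, tr (Fn V d * X) = tr ((Fn V d)ᴴ * X) := fun X => by rw [Fn_herm]
    rw [x1, x2, x3, tr_two hA hB, tr_two hA hB, tr_two hA hB, ← Finset.sum_add_distrib]
    refine Finset.sum_le_sum fun j _ => ?_
    rw [← Finset.sum_add_distrib]
    refine Finset.sum_le_sum fun i _ => ?_
    rw [left_Fn hA, right_Fn hB, ← hD, diff_Fn hA hB, diff_Fn hA hB]
    generalize (UAᴴ * UB) i j = w
    have hw : ∀ s t : ℝ, (star ((s : ℂ) * w) * ((t : ℂ) * w)).re = s * t * Complex.normSq w := by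
      intro s t
      simp [Complex.normSq_apply]; ring
    have c1 : ∀ s t : ℝ, (s : ℂ) * ((t : ℂ) * w) = ((s * t : ℝ) : ℂ) * w := by
      intro s t; push_cast; ring
    rw [c1, c1, hw, hw, hw, ← add_mul]
    refine mul_le_mul_of_nonneg_right ?_ (Complex.normSq_nonneg w)
    refine le_of_eq_of_le ?_ (scal hq (ha i) (hb j))
    ring
  refine le_trans ?_ step1
  rw [tr_mul_Fn, tr_mul_Fn, ← Finset.sum_add_distrib]
  refine Finset.sum_le_sum fun k _ => ?_
  have hφ : ConvexOn ℝ (Set.Ici 0) (fun x : ℝ => x ^ (q - 1)) :=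
    convexOn_rpow (by linarith)
  have jA := jensen hA hV a ha _ hφ k
  have jB := jensen hB hV b hb _ hφ k
  have pA := diag_re_nonneg (Fn_psd UA a ha) V k
  have pB := diag_re_nonneg (Fn_psd UB b hb) V k
  have pA' := diag_re_nonneg (Fn_psd UA (fun i => a i ^ (q - 1))
    fun i => Real.rpow_nonneg (ha i) _) V k
  have pB' := diag_re_nonneg (Fn_psd UB (fun i => b i ^ (q - 1))
    fun i => Real.rpow_nonneg (hb i) _) V k
  have hd : ((Vᴴ * Fn UA a * V) k k).re - ((Vᴴ * Fn UB b * V) k k).re = d k := by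
    rw [← Complex.sub_re, ← Matrix.sub_apply, ← Matrix.sub_mul, ← Matrix.mul_sub, hD, conj_Fn hV]
    simp
  have hpow : |d k| * |d k| ^ q = d k ^ 2 * |d k| ^ (q - 1) := by
    rw [← sq_abs (d k), pow_two, mul_assoc]
    congr 1
    nth_rewrite 2 [← Real.rpow_one |d k|]
    rw [← Real.rpow_add' (abs_nonneg _) (by linarith)]
    congr 1; ring
  rw [hpow, ← mul_add]
  refine mul_le_mul_of_nonneg_left ?_ (sq_nonneg _)
  rcases le_total 0 (d k) with h | h
  · rw [abs_of_nonneg h]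
    have := Real.rpow_le_rpow h (by linarith : d k ≤ ((Vᴴ * Fn UA a * V) k k).re)
      (by linarith : 0 ≤ q - 1)
    linarith
  · rw [abs_of_nonpos h]
    have := Real.rpow_le_rpow (by linarith : 0 ≤ -d k)
      (by linarith : -d k ≤ ((Vᴴ * Fn UB b * V) k k).re)
      (by linarith : 0 ≤ q - 1)
    linarith

lemma allcase {UA UB V : Matrix n n ℂ} (hA : Un UA) (hB : Un UB) (hV : Un V) {a b d : n → ℝ}
    (ha : ∀ i, 0 ≤ a i) (hb : ∀ i, 0 ≤ b i) (hD : Fn UA a - Fn UB b = Fn V d)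
    {q : ℝ} (hq : 1 ≤ q) :
    ∑ i, |d i| * |d i| ^ q ≤
      tr (Fn V d * (Fn UA (fun i => a i ^ q) - Fn UB (fun i => b i ^ q))) := by
  rcases hq.eq_or_lt with h | h
  · subst h
    simp only [Real.rpow_one]
    rw [hD, Fn_mul hV, tr_Fn hV]
    simp
  · rcases lt_or_ge q 2 with h2 | h2
    · exact case12 hA hB hV ha hb hD ⟨h, h2⟩
    · exact case2 hA hB hV ha hb hD h2

end Ric

theorem stmt_7 {n : Type*} [Fintype n] [DecidableEq n] (p : ℝ) (hp : 2 ≤ p)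
    (A B : Matrix n n ℂ) (hA : A.PosSemidef) (hB : B.PosSemidef) :
    Matrix.trace (cfc (fun x : ℝ => x ^ p) (matAbs (A - B))) ≤
      Matrix.trace ((A - B) *
        (cfc (fun x : ℝ => x ^ (p - 1)) A - cfc (fun x : ℝ => x ^ (p - 1)) B)) := by
  have hDh : (A - B).IsHermitian := hA.1.sub hB.1
  obtain ⟨UA, a, hUA, hAe, hAf, ha⟩ := Ric.exists_spec hA.1
  obtain ⟨UB, b, hUB, hBe, hBf, hb⟩ := Ric.exists_spec hB.1
  obtain ⟨V, d, hV, hDe, hDf, -⟩ := Ric.exists_spec hDh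
  have ha := ha hA
  have hb := hb hB
  have hsa : IsSelfAdjoint (A - B) := hDh
  have habs : cfc (fun x : ℝ => x ^ p) (matAbs (A - B)) = Ric.Fn V (fun i => |d i| ^ p) := by
    have e1 : (A - B)ᴴ * (A - B) = cfc (fun x : ℝ => x * x) (A - B) := by
      rw [hDh.eq, hDf]
      conv_lhs => rw [hDe]
      rw [Ric.Fn_mul hV]
    have hc : Continuous (fun x : ℝ => x ^ p) := Real.continuous_rpow_const (by linarith)
    rw [matAbs, e1, ← cfc_comp' Real.sqrt (fun x : ℝ => x * x) (A - B),
      ← cfc_comp' (fun x : ℝ => x ^ p) (fun x : ℝ => √(x * x)) (A - B) hc.continuousOn, hDf]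
    simp only [Real.sqrt_mul_self_eq_abs]
  have main := Ric.allcase hUA hUB hV ha hb (by rw [← hAe, ← hBe, ← hDe])
    (by linarith : 1 ≤ p - 1)
  have hL : ∑ i, |d i| * |d i| ^ (p - 1) = Ric.tr (Ric.Fn V (fun i => |d i| ^ p)) := by
    rw [Ric.tr_Fn hV]
    refine Finset.sum_congr rfl fun i _ => ?_
    nth_rewrite 1 [← Real.rpow_one |d i|]
    rw [← Real.rpow_add' (abs_nonneg _) (by linarith)]
    congr 1; ring
  rw [hL, ← hDe] at main
  rw [habs, hAf, hBf]
  have im0 : ∀ X Y : Matrix n n ℂ, Xᴴ = X → Yᴴ = Y → (trace (X * Y)).im = 0 := by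
    intro X Y hX hY
    have : star (trace (X * Y)) = trace (X * Y) := by
      rw [← trace_conjTranspose, conjTranspose_mul, hX, hY, trace_mul_comm]
    exact Complex.conj_eq_iff_im.1 this
  refine Complex.le_def.2 ⟨main, ?_⟩
  rw [im0 _ _ hDh.eq (by rw [conjTranspose_sub, Ric.Fn_herm, Ric.Fn_herm])]
  have := im0 1 (Ric.Fn V (fun i => |d i| ^ p)) (by simp) (Ric.Fn_herm _ _)
  rwa [Matrix.one_mul] at this
end

section
/- Let f be a nonnegative operator monotone function on [0,∞) with f(0) = 0. Then for any positive semidefinite n×n complex matrices A, B, Tr((A - B)(f(A) - f(B))) ≤ Tr(|A - B| f(|A - B|)). -/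
open Matrix ComplexOrder

/-- `f` is operator monotone on `[0, ∞)`: for positive semidefinite matrices `X ≤ Y`
(of any size), `f(X) ≤ f(Y)` in the Loewner order. -/
def OperatorMonotone (f : ℝ → ℝ) : Prop :=
  ∀ (k : ℕ) (X Y : Matrix (Fin k) (Fin k) ℂ), X.PosSemidef → Y.PosSemidef →
    (Y - X).PosSemidef → (cfc f Y - cfc f X).PosSemidef

lemma aeval_conj {n : Type*} [Fintype n] [DecidableEq n] (U : Matrix n n ℂ) (h1 : U * Uᴴ = 1)
    (h2 : Uᴴ * U = 1) (d : n → ℝ) (q : Polynomial ℝ) :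
    Polynomial.aeval (U * diagonal (fun i => (d i : ℂ)) * Uᴴ) q =
      U * diagonal (fun i => ((q.eval (d i) : ℝ) : ℂ)) * Uᴴ := by
  induction q using Polynomial.induction_on' with
  | add p q hp hq =>
    rw [map_add, hp, hq, ← add_mul, ← mul_add, diagonal_add]
    simp
  | monomial k a =>
    rw [Polynomial.aeval_monomial]
    have hpow : ∀ k : ℕ, (U * diagonal (fun i => (d i : ℂ)) * Uᴴ) ^ k =
        U * diagonal (fun i => (d i : ℂ) ^ k) * Uᴴ := by
      intro k
      induction k with
      | zero => simp [h1]
      | succ k ih =>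
        rw [pow_succ, ih]
        calc _ = U * diagonal (fun i => (d i : ℂ) ^ k) * (Uᴴ * U) * diagonal (fun i => (d i : ℂ)) * Uᴴ := by
              simp only [mul_assoc]
          _ = _ := by rw [h2, mul_one, mul_assoc U, diagonal_mul_diagonal]; simp [pow_succ]
    rw [hpow]
    have : diagonal (fun i => ((((Polynomial.monomial k) a).eval (d i) : ℝ) : ℂ)) =
        a • diagonal (fun i => (d i : ℂ) ^ k) := by
      ext i j
      by_cases h : i = j
      · subst h; simp
      · simp [h]
    rw [this, Matrix.algebraMap_eq_diagonal]
    ext i j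
    simp [mul_assoc]

lemma conj_herm {n : Type*} [Fintype n] [DecidableEq n] (U : Matrix n n ℂ) (d : n → ℝ) :
    (U * diagonal (fun i => (d i : ℂ)) * Uᴴ).IsHermitian := by
  have : (diagonal (fun i => (d i : ℂ))).IsHermitian := by
    rw [Matrix.IsHermitian, diagonal_conjTranspose]
    congr 1; ext i; simp
  exact isHermitian_mul_mul_conjTranspose _ this

lemma cfc_conj {n : Type*} [Fintype n] [DecidableEq n] (U : Matrix n n ℂ) (h1 : U * Uᴴ = 1)
    (h2 : Uᴴ * U = 1) (d : n → ℝ) (f : ℝ → ℝ) :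
    cfc f (U * diagonal (fun i => (d i : ℂ)) * Uᴴ) =
      U * diagonal (fun i => (f (d i) : ℂ)) * Uᴴ := by
  have hA := conj_herm U d
  obtain ⟨q, hq⟩ := (Polynomial.exists_eval_eq_iff (Sum.elim d hA.eigenvalues)
    (f ∘ Sum.elim d hA.eigenvalues)).2 (fun i j h => by simp [h])
  have e1 : cfc f (U * diagonal (fun i => (d i : ℂ)) * Uᴴ) =
      cfc q.eval (U * diagonal (fun i => (d i : ℂ)) * Uᴴ) := by
    apply cfc_congr
    intro x hx
    rw [hA.spectrum_real_eq_range_eigenvalues] at hx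
    obtain ⟨i, rfl⟩ := hx
    exact (hq (Sum.inr i)).symm
  rw [e1, cfc_polynomial q _ hA.isSelfAdjoint, aeval_conj U h1 h2]
  congr 3
  ext i
  have := hq (Sum.inl i)
  simp at this
  rw [this]

lemma exists_conj {n : Type*} [Fintype n] [DecidableEq n] (A : Matrix n n ℂ) (hA : A.IsHermitian) :
    ∃ (U : Matrix n n ℂ) (d : n → ℝ), U * Uᴴ = 1 ∧ Uᴴ * U = 1 ∧
      A = U * diagonal (fun i => (d i : ℂ)) * Uᴴ ∧ (A.PosSemidef → ∀ i, 0 ≤ d i) := by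
  refine ⟨hA.eigenvectorUnitary, hA.eigenvalues, ?_, ?_, ?_, ?_⟩
  · exact Unitary.mul_star_self_of_mem hA.eigenvectorUnitary.2
  · exact Unitary.star_mul_self_of_mem hA.eigenvectorUnitary.2
  · exact hA.spectral_theorem
  · intro h; exact h.eigenvalues_nonneg

lemma conj_psd {n : Type*} [Fintype n] [DecidableEq n] (U : Matrix n n ℂ) (d : n → ℝ)
    (hd : ∀ i, 0 ≤ d i) :
    (U * diagonal (fun i => (d i : ℂ)) * Uᴴ).PosSemidef := by
  apply PosSemidef.mul_mul_conjTranspose_same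
  apply PosSemidef.diagonal
  intro i; simpa using hd i

lemma trace_mul_conj {n : Type*} [Fintype n] [DecidableEq n] (U D : Matrix n n ℂ) (d : n → ℝ) :
    (Matrix.trace (D * (U * diagonal (fun i => (d i : ℂ)) * Uᴴ))).re =
      ∑ i, ((Uᴴ * D * U) i i).re * d i := by
  have : Matrix.trace (D * (U * diagonal (fun i => (d i : ℂ)) * Uᴴ)) =
     Matrix.trace ((Uᴴ * D * U) * diagonal (fun i => (d i : ℂ))) := by
    rw [← mul_assoc, trace_mul_comm]; simp only [mul_assoc]
  rw [this, Matrix.trace]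
  simp

lemma trace_mul_herm_im {n : Type*} [Fintype n] [DecidableEq n] (A B : Matrix n n ℂ)
    (hA : A.IsHermitian) (hB : B.IsHermitian) : (Matrix.trace (A * B)).im = 0 := by
  have : star (Matrix.trace (A * B)) = Matrix.trace (A * B) := by
    rw [← trace_conjTranspose, conjTranspose_mul, hA.eq, hB.eq, trace_mul_comm]
  exact Complex.conj_eq_iff_im.1 this

lemma trace_mul_psd {n : Type*} [Fintype n] [DecidableEq n] (A B : Matrix n n ℂ)
    (hA : A.PosSemidef) (hB : B.PosSemidef) : 0 ≤ (Matrix.trace (A * B)).re := by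
  obtain ⟨U, d, -, -, rfl, h⟩ := exists_conj B hB.1
  rw [trace_mul_conj]
  apply Finset.sum_nonneg
  intro i _
  have := (hA.conjTranspose_mul_mul_same U).diag_nonneg (i := i)
  exact mul_nonneg (Complex.le_def.1 this).1 (h hB i)

lemma exists_inv {n : Type*} [Fintype n] [DecidableEq n] (B : Matrix n n ℂ) (hB : B.PosSemidef) :
    ∃ P : Matrix n n ℂ, P.PosSemidef ∧ P * (1 + B) = 1 ∧ (1 + B) * P = 1 := by
  have h : (1 + B).PosDef := PosDef.one.add_posSemidef hB
  have hu : IsUnit (1 + B).det := (Matrix.isUnit_iff_isUnit_det _).1 h.isUnit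
  exact ⟨(1 + B)⁻¹, h.inv.posSemidef, Matrix.nonsing_inv_mul _ hu, Matrix.mul_nonsing_inv _ hu⟩

lemma inv_var {n : Type*} [Fintype n] [DecidableEq n] (Z Zi Y : Matrix n n ℂ)
    (hZ : Z.PosSemidef) (hZi : Zi.IsHermitian) (hY : Y.IsHermitian) (h1 : Zi * Z = 1)
    (h2 : Z * Zi = 1) :
    (Zi - Y - Y + Y * Z * Y).PosSemidef := by
  have : Zi - Y - Y + Y * Z * Y = (Zi - Y) * Z * (Zi - Y)ᴴ := by
    rw [conjTranspose_sub, hZi.eq, hY.eq]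
    have : (Zi - Y) * Z * (Zi - Y) = (Zi * Z) * Zi - (Zi * Z) * Y - Y * (Z * Zi) + Y * Z * Y := by
      noncomm_ring
    rw [this, h1, h2]; simp
  rw [this]
  exact hZ.mul_mul_conjTranspose_same _

lemma inv_anti {n : Type*} [Fintype n] [DecidableEq n] (A B P Q : Matrix n n ℂ)
    (hA : A.PosSemidef) (hBA : (B - A).PosSemidef) (hP : P.IsHermitian) (hQ : Q.IsHermitian)
    (h1 : P * (1 + A) = 1) (h2 : (1 + A) * P = 1) (h3 : Q * (1 + B) = 1) :
    (P - Q).PosSemidef := by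
  have a := inv_var (1 + A) P Q (PosSemidef.one.add hA) hP hQ h1 h2
  have b := hBA.mul_mul_conjTranspose_same Q
  rw [hQ.eq] at b
  have : P - Q = (P - Q - Q + Q * (1 + A) * Q) + Q * (B - A) * Q := by
    have e : Q * (B - A) * Q = Q * (1 + B) * Q - Q * (1 + A) * Q := by noncomm_ring
    rw [e, h3]; noncomm_ring
  rw [this]; exact a.add b

lemma key_pos {n : Type*} [Fintype n] [DecidableEq n] (B C P Q K : Matrix n n ℂ)
    (hB : B.PosSemidef) (hC : C.PosSemidef) (hP : P.PosSemidef) (hK : K.PosSemidef)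
    (hP1 : P * (1 + B) = 1) (hP2 : (1 + B) * P = 1)
    (hQ1 : Q * (1 + (B + C)) = 1)
    (hK1 : K * (1 + C) = 1) (hK2 : (1 + C) * K = 1) :
    (trace (C * (P - Q))).re ≤ (trace (C * (1 - K))).re := by
  obtain ⟨R, hR, hRR⟩ : ∃ R : Matrix n n ℂ, R.IsHermitian ∧ R * R = C := by
    obtain ⟨U, d, h1, h2, h, hd⟩ := exists_conj C hC.1
    refine ⟨U * diagonal (fun i => ((√(d i) : ℝ) : ℂ)) * Uᴴ, conj_herm U _, ?_⟩
    rw [h]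
    calc _ = U * diagonal (fun i => ((√(d i) : ℝ) : ℂ)) * (Uᴴ * U) *
            diagonal (fun i => ((√(d i) : ℝ) : ℂ)) * Uᴴ := by simp only [mul_assoc]
      _ = _ := by
        rw [h2, mul_one, mul_assoc U, diagonal_mul_diagonal]
        congr 3; ext i
        rw [← Complex.ofReal_mul, Real.mul_self_sqrt (hd hC i)]
  have hM : (R * P * R).PosSemidef := by
    have := hP.mul_mul_conjTranspose_same R
    rwa [hR.eq] at this
  obtain ⟨Y, hY, hY1, hY2⟩ := exists_inv _ hM
  have hPQ : P - Q - Q * C * P = 0 := by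
    have : P - Q = (Q * (1 + (B + C))) * P - Q * ((1 + B) * P) := by rw [hQ1, hP2]; simp
    rw [this]; noncomm_ring
  have hY3 : 1 - R * Q * R = Y := by
    have e : (1 - R * Q * R) * (1 + R * P * R) = 1 := by
      have : (1 - R * Q * R) * (1 + R * P * R) =
        1 + R * (P - Q - Q * (R * R) * P) * R := by noncomm_ring
      rw [this, hRR, hPQ]; simp
    calc _ = (1 - R * Q * R) * ((1 + R * P * R) * Y) := by rw [hY2, mul_one]
      _ = Y := by rw [← mul_assoc, e, one_mul]
  have hCM : (C - R * P * R).PosSemidef := by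
    have hP1' : (1 - P).PosSemidef := by
      refine inv_anti 0 B 1 P PosSemidef.zero (by simpa using hB) isHermitian_one hP.1
        (by simp) (by simp) hP1
    have := hP1'.mul_mul_conjTranspose_same R
    rw [hR.eq] at this
    have e : R * (1 - P) * R = R * R - R * P * R := by noncomm_ring
    rwa [e, hRR] at this
  have hv := (inv_var (1 + C) K Y (PosSemidef.one.add hC) hK.1 hY.1 hK1 hK2).trace_nonneg
  have hv2 : 0 ≤ (trace (K - Y + Y * (C - R * P * R) * Y)).re := by
    have e : K - Y + Y * (C - R * P * R) * Y = K - Y - Y + Y * (1 + C) * Y := by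
      have : Y * (C - R * P * R) * Y = Y * (1 + C) * Y - Y * (1 + R * P * R) * Y := by
        noncomm_ring
      rw [this, hY1]; noncomm_ring
    rw [e]; exact (Complex.le_def.1 hv).1
  have hYY : (1 - Y * Y).PosSemidef := by
    have e : 1 - Y * Y = Y * (R * P * R + R * P * R + (R * P * R)ᴴ * (R * P * R)) * Yᴴ := by
      rw [hY.1.eq, hM.1.eq]
      have : Y * (R * P * R + R * P * R + (R * P * R) * (R * P * R)) * Y =
        (Y * (1 + R * P * R)) * ((1 + R * P * R) * Y) - Y * Y := by noncomm_ring
      rw [this, hY1, hY2, one_mul]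
    rw [e]
    exact ((hM.add hM).add (posSemidef_conjTranspose_mul_self _)).mul_mul_conjTranspose_same _
  have hw := trace_mul_psd _ _ hYY hCM
  have t1 : trace (Y * (C - R * P * R) * Y) = trace (Y * Y * (C - R * P * R)) := by
    rw [trace_mul_comm]; simp only [mul_assoc]
  have t2 : trace (C * P) = trace (R * P * R) := by
    rw [← hRR, trace_mul_comm (R * P) R]; simp only [mul_assoc]
  have t3 : trace (C * Q) = trace (1 - Y) := by
    rw [← hRR, ← hY3]
    rw [mul_assoc, trace_mul_comm]; simp
  have t4 : C * K = 1 - K := by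
    have : C * K = (1 + C) * K - K := by noncomm_ring
    rw [this, hK2]
  have hw' : (1 - Y * Y) * (C - R * P * R) = C - R * P * R - Y * Y * (C - R * P * R) := by
    noncomm_ring
  rw [hw'] at hw
  rw [mul_sub, mul_sub, t4, mul_one]
  simp only [trace_sub, trace_add, Complex.sub_re, Complex.add_re, t1, t2, t3] at *
  linarith

lemma key_gen {n : Type*} [Fintype n] [DecidableEq n] (A B Dp Dm PA PB K : Matrix n n ℂ)
    (hA : A.PosSemidef) (hB : B.PosSemidef) (hDp : Dp.PosSemidef) (hDm : Dm.PosSemidef)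
    (hAB : A - B = Dp - Dm) (hpm : Dp * Dm = 0) (hmp : Dm * Dp = 0)
    (hPA : PA.PosSemidef) (hPB : PB.PosSemidef)
    (hPA1 : PA * (1 + A) = 1) (hPA2 : (1 + A) * PA = 1)
    (hPB1 : PB * (1 + B) = 1) (hPB2 : (1 + B) * PB = 1)
    (hK2 : (1 + (Dp + Dm)) * K = 1) :
    (trace ((A - B) * (PB - PA))).re ≤ (trace ((Dp + Dm) * (1 - K))).re := by
  have half : ∀ (A B Dp Dm PA PB K : Matrix n n ℂ)
    (hA : A.PosSemidef) (hB : B.PosSemidef) (hDp : Dp.PosSemidef) (hDm : Dm.PosSemidef)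
    (hAB : A - B = Dp - Dm) (hpm : Dp * Dm = 0)
    (hPA : PA.PosSemidef) (hPB : PB.PosSemidef)
    (hPA1 : PA * (1 + A) = 1) (hPA2 : (1 + A) * PA = 1)
    (hPB1 : PB * (1 + B) = 1) (hPB2 : (1 + B) * PB = 1)
    (hK2 : (1 + (Dp + Dm)) * K = 1),
    (trace (Dp * (PB - PA))).re ≤ (trace (Dp * (1 - K))).re := by
    intro A B Dp Dm PA PB K hA hB hDp hDm hAB hpm hPA hPB hPA1 hPA2 hPB1 hPB2 hK2
    obtain ⟨Q, hQ, hQ1, hQ2⟩ := exists_inv _ (hB.add hDp)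
    obtain ⟨L, hL, hL1, hL2⟩ := exists_inv _ hDp
    have h1 := key_pos B Dp PB Q L hB hDp hPB hL hPB1 hPB2 hQ1 hL1 hL2
    have h2 : (PA - Q).PosSemidef := by
      refine inv_anti A (B + Dp) PA Q hA ?_ hPA.1 hQ.1 hPA1 hPA2 hQ1
      have : B + Dp - A = Dm := by
        have : B + Dp - A = Dp - (A - B) := by abel
        rw [this, hAB]; abel
      rwa [this]
    have h3 := trace_mul_psd _ _ hDp h2
    have h4 : L * Dp = Dp * K := by
      have : L * Dp * (1 + (Dp + Dm)) = Dp := by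
        have : L * Dp * (1 + (Dp + Dm)) = L * (1 + Dp) * Dp + L * (Dp * Dm) := by noncomm_ring
        rw [this, hL1, hpm]; simp
      calc L * Dp = L * Dp * ((1 + (Dp + Dm)) * K) := by rw [hK2, mul_one]
        _ = Dp * K := by rw [← mul_assoc, this]
    have h5 : trace (Dp * L) = trace (Dp * K) := by rw [trace_mul_comm, h4]
    simp only [mul_sub, trace_sub, Complex.sub_re, h5] at *
    linarith
  have a := half A B Dp Dm PA PB K hA hB hDp hDm hAB hpm hPA hPB hPA1 hPA2 hPB1 hPB2 hK2
  have b := half B A Dm Dp PB PA K hB hA hDm hDp (by rw [← neg_sub, hAB]; abel) hmp hPB hPA hPB1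
    hPB2 hPA1 hPA2 (by rwa [add_comm Dm])
  rw [hAB]
  simp only [mul_sub, sub_mul, add_mul, trace_sub, trace_add, Complex.sub_re, Complex.add_re] at *
  linarith

open Polynomial in
inductive GoodPoly : ℕ → ℝ[X] → Prop
  | sq (n : ℕ) (q : ℝ[X]) (h : 2 * q.natDegree ≤ n) : GoodPoly n (q * q)
  | xsq (n : ℕ) (q : ℝ[X]) (h : 2 * q.natDegree + 1 ≤ n) : GoodPoly n (X * (q * q))
  | add (n : ℕ) (p q : ℝ[X]) : GoodPoly n p → GoodPoly n q → GoodPoly n (p + q)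

open Polynomial in
lemma GoodPoly.mono {n m : ℕ} {p : ℝ[X]} (h : GoodPoly n p) (hnm : n ≤ m) : GoodPoly m p := by
  induction h with
  | sq q h => exact .sq _ _ (by omega)
  | xsq q h => exact .xsq _ _ (by omega)
  | add p q _ _ h1 h2 => exact .add _ _ _ h1 h2

open Polynomial in
lemma GoodPoly.mul {n m : ℕ} {p q : ℝ[X]} (hp : GoodPoly n p) (hq : GoodPoly m q) :
    GoodPoly (n + m) (p * q) := by
  induction hp with
  | add p p' _ _ h1 h2 => rw [add_mul]; exact .add _ _ _ (h1) (h2)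
  | sq r hr =>
    induction hq with
    | add q q' _ _ h1 h2 => rw [mul_add]; exact .add _ _ _ (h1) (h2)
    | sq t ht =>
      have e : r * r * (t * t) = (r * t) * (r * t) := by ring
      have := natDegree_mul_le (p := r) (q := t)
      rw [e]; exact .sq _ _ (by omega)
    | xsq t ht =>
      have e : r * r * (X * (t * t)) = X * ((r * t) * (r * t)) := by ring
      have := natDegree_mul_le (p := r) (q := t)
      rw [e]; exact .xsq _ _ (by omega)
  | xsq r hr =>
    induction hq with
    | add q q' _ _ h1 h2 => rw [mul_add]; exact .add _ _ _ (h1) (h2)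
    | sq t ht =>
      have e : X * (r * r) * (t * t) = X * ((r * t) * (r * t)) := by ring
      have := natDegree_mul_le (p := r) (q := t)
      rw [e]; exact .xsq _ _ (by omega)
    | xsq t ht =>
      have e : X * (r * r) * (X * (t * t)) = (X * (r * t)) * (X * (r * t)) := by ring
      have := natDegree_mul_le (p := r) (q := t)
      have h2 := natDegree_mul_le (p := (X : ℝ[X])) (q := r * t)
      rw [natDegree_X] at h2
      rw [e]; exact .sq _ _ (by omega)

open Polynomial in
lemma GoodPoly.const (n : ℕ) (a : ℝ) (ha : 0 ≤ a) : GoodPoly n (C a) := by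
  have : (C a : ℝ[X]) = C √a * C √a := by rw [← C_mul, Real.mul_self_sqrt ha]
  rw [this]; exact .sq _ _ (by simp)

open Polynomial in
lemma poly_nonneg_fill (g : ℝ[X]) (a : ℝ) (h : ∀ s, a < s → 0 ≤ g.eval s) : 0 ≤ g.eval a := by
  have : Filter.Tendsto (fun s => g.eval s) (nhdsWithin a (Set.Ioi a)) (nhds (g.eval a)) :=
    (g.continuous.tendsto a).mono_left nhdsWithin_le_nhds
  exact ge_of_tendsto this (by filter_upwards [self_mem_nhdsWithin] with s hs using h s hs)

open Polynomial in
lemma poly_nonpos_fill (g : ℝ[X]) (a : ℝ) (ha : 0 < a) (h : ∀ s, 0 < s → s < a → g.eval s ≤ 0) :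
    g.eval a ≤ 0 := by
  have : Filter.Tendsto (fun s => g.eval s) (nhdsWithin a (Set.Iio a)) (nhds (g.eval a)) :=
    (g.continuous.tendsto a).mono_left nhdsWithin_le_nhds
  exact le_of_tendsto this (by
    filter_upwards [Ioo_mem_nhdsLT ha] with s hs using h s hs.1 hs.2)

open Polynomial in
lemma goodPoly_of_nonneg (N : ℕ) : ∀ p : ℝ[X], p.natDegree ≤ N → (∀ s, 0 < s → 0 ≤ p.eval s) →
    GoodPoly N p := by
  induction N using Nat.strong_induction_on with
  | _ N ih =>
  intro p hN hp
  by_cases hd : p.natDegree = 0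
  · rw [eq_C_of_natDegree_eq_zero hd] at hp ⊢
    exact .const _ _ (by simpa using hp 1 one_pos)
  have hp0 : p ≠ 0 := by rintro rfl; simp at hd
  obtain ⟨z, hz⟩ := IsAlgClosed.exists_aeval_eq_zero ℂ p (by
    rw [degree_eq_natDegree hp0]; exact_mod_cast hd)
  by_cases him : z.im = 0
  · have hz' : p.eval z.re = 0 := by
      have e : z = ((z.re : ℝ) : ℂ) := by apply Complex.ext <;> simp [him]
      rw [e] at hz
      have := Polynomial.aeval_algebraMap_apply_eq_algebraMap_eval (A := ℂ) z.re p
      rw [Complex.coe_algebraMap] at this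
      rw [hz] at this
      exact_mod_cast this.symm
    obtain ⟨g, rfl⟩ := dvd_iff_isRoot.2 hz'
    have hg0 : g ≠ 0 := right_ne_zero_of_mul hp0
    rw [natDegree_mul (left_ne_zero_of_mul hp0) hg0, natDegree_X_sub_C] at hN
    generalize z.re = a at *
    by_cases ha : a ≤ 0
    · have hg : GoodPoly (N - 1) g := by
        refine ih _ (by omega) _ (by omega) ?_
        intro s hs
        have := hp s hs
        rw [eval_mul] at this
        simp only [eval_sub, eval_X, eval_C] at this
        exact nonneg_of_mul_nonneg_right this (by linarith)
      have h1 : GoodPoly 1 (X - C a) := by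
        have e : X - C a = X * ((1:ℝ[X]) * 1) + C (-a) := by simp [sub_eq_add_neg]
        rw [e]
        exact .add _ _ _ (.xsq _ _ (by simp)) (.const _ _ (by linarith))
      exact (h1.mul hg).mono (by omega)
    · push Not at ha
      have hgr : ∀ s, a < s → 0 ≤ g.eval s := by
        intro s hs
        have := hp s (ha.trans hs)
        rw [eval_mul] at this
        simp only [eval_sub, eval_X, eval_C] at this
        exact nonneg_of_mul_nonneg_right this (by linarith)
      have hgl : ∀ s, 0 < s → s < a → g.eval s ≤ 0 := by
        intro s hs0 hs
        have := hp s hs0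
        rw [eval_mul] at this
        simp only [eval_sub, eval_X, eval_C] at this
        nlinarith
      have hga : g.eval a = 0 := le_antisymm (poly_nonpos_fill g a ha hgl) (poly_nonneg_fill g a hgr)
      obtain ⟨h, rfl⟩ := dvd_iff_isRoot.2 hga
      rw [natDegree_mul (left_ne_zero_of_mul hg0) (right_ne_zero_of_mul hg0),
        natDegree_X_sub_C] at hN
      have hhr : ∀ s, a < s → 0 ≤ h.eval s := by
        intro s hs
        have := hgr s hs
        rw [eval_mul] at this
        simp only [eval_sub, eval_X, eval_C] at this
        exact nonneg_of_mul_nonneg_right this (by linarith)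
      have hh : GoodPoly (N - 2) h := by
        refine ih _ (by omega) _ (by omega) ?_
        intro s hs
        rcases lt_trichotomy s a with h1 | rfl | h1
        · have := hgl s hs h1
          rw [eval_mul] at this
          simp only [eval_sub, eval_X, eval_C] at this
          nlinarith
        · exact poly_nonneg_fill _ _ hhr
        · exact hhr s h1
      have h1 : GoodPoly 2 ((X - C a) * (X - C a)) := .sq _ _ (by simp)
      rw [← mul_assoc]
      exact (h1.mul hh).mono (by omega)
  · obtain ⟨g, hg⟩ := p.quadratic_dvd_of_aeval_eq_zero_im_ne_zero hz him
    have hn : ‖z‖ ^ 2 = z.re * z.re + z.im * z.im := by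
      rw [← Complex.normSq_eq_norm_sq, Complex.normSq_apply]
    have e : X ^ 2 - C (2 * z.re) * X + C (‖z‖ ^ 2) =
        (X - C z.re) * (X - C z.re) + C (z.im * z.im) := by
      rw [hn]; simp only [map_mul, map_add, C_ofNat]; ring
    rw [e] at hg
    have hdeg : ((X - C z.re) * (X - C z.re) + C (z.im * z.im)).natDegree = 2 := by
      rw [natDegree_add_C, natDegree_mul (X_sub_C_ne_zero _) (X_sub_C_ne_zero _), natDegree_X_sub_C]
    have h1 : GoodPoly 2 ((X - C z.re) * (X - C z.re) + C (z.im * z.im)) :=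
      .add _ _ _ (.sq _ _ (by simp)) (.const _ _ (mul_self_nonneg _))
    subst hg
    rw [natDegree_mul (left_ne_zero_of_mul hp0) (right_ne_zero_of_mul hp0), hdeg] at hN
    have hh : GoodPoly (N - 2) g := by
      refine ih _ (by omega) _ (by omega) ?_
      intro s hs
      have := hp s hs
      rw [eval_mul] at this
      simp only [eval_sub, eval_X, eval_C, eval_mul, eval_add] at this
      refine nonneg_of_mul_nonneg_right this ?_
      have : 0 < z.im * z.im := mul_self_pos.2 him
      nlinarith [mul_self_nonneg (s - z.re)]
    exact (h1.mul hh).mono (by omega)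

lemma real_quad {k : ℕ} (W : Matrix (Fin k) (Fin k) ℝ) (d v : Fin k → ℝ) :
    v ⬝ᵥ (W * diagonal d * Wᵀ) *ᵥ v = ∑ j, d j * (∑ i, v i * W i j) ^ 2 := by
  rw [dotProduct_mulVec, ← vecMul_vecMul, ← vecMul_vecMul, ← dotProduct_mulVec, mulVec_transpose]
  simp only [dotProduct, vecMul_diagonal]
  apply Finset.sum_congr rfl
  intro j _
  simp only [vecMul, dotProduct]
  ring

lemma psd_of_complex {k : ℕ} (M : Matrix (Fin k) (Fin k) ℝ)
    (hM : (M.map (fun t : ℝ => (t : ℂ))).PosSemidef) (v : Fin k → ℝ) : 0 ≤ v ⬝ᵥ M *ᵥ v := by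
  have h := hM.dotProduct_mulVec_nonneg (fun i => (v i : ℂ))
  have e : star (fun i => (v i : ℂ)) ⬝ᵥ (M.map (fun t : ℝ => (t : ℂ))) *ᵥ (fun i => (v i : ℂ)) =
      ((v ⬝ᵥ M *ᵥ v : ℝ) : ℂ) := by
    simp [dotProduct, mulVec]
  rw [e] at h
  exact_mod_cast h

/-- Operator monotonicity for a real pair `diag x ≤ W diag y Wᵀ`. -/
lemma opmono_real (f : ℝ → ℝ) (hf : OperatorMonotone f) {k : ℕ} (x y a : Fin k → ℝ)
    (hx : ∀ i, 0 ≤ x i) (hy : ∀ i, 0 ≤ y i)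
    (W : Matrix (Fin k) (Fin k) ℝ) (hW : Wᵀ * W = 1)
    (hYX : W * diagonal y * Wᵀ - diagonal x = vecMulVec a a) (v : Fin k → ℝ) :
    ∑ i, f (x i) * v i ^ 2 ≤ ∑ j, f (y j) * (∑ i, v i * W i j) ^ 2 := by
  have hW' : W * Wᵀ = 1 := mul_eq_one_comm.1 hW
  let φ : ℝ →+* ℂ := Complex.ofRealHom
  set U : Matrix (Fin k) (Fin k) ℂ := W.map φ with hU
  have hUH : Uᴴ = Wᵀ.map φ := by
    ext i j; simp [hU, φ, conjTranspose_apply]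
  have h1 : U * Uᴴ = 1 := by
    rw [hUH, hU, ← Matrix.map_mul, hW']; ext i j; simp [Matrix.one_apply, apply_ite]
  have h2 : Uᴴ * U = 1 := by
    rw [hUH, hU, ← Matrix.map_mul, hW]; ext i j; simp [Matrix.one_apply, apply_ite]
  have hdiag : ∀ d : Fin k → ℝ, (diagonal d).map φ = diagonal (fun i => (d i : ℂ)) := by
    intro d; rw [diagonal_map (by simp)]; rfl
  have hconj : ∀ d : Fin k → ℝ, U * diagonal (fun i => (d i : ℂ)) * Uᴴ =
      (W * diagonal d * Wᵀ).map φ := by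
    intro d; rw [Matrix.map_mul, Matrix.map_mul, hdiag, hUH]
  have hX : diagonal (fun i => (x i : ℂ)) =
      (1 : Matrix (Fin k) (Fin k) ℂ) * diagonal (fun i => (x i : ℂ)) * 1ᴴ := by simp
  have key := hf k (diagonal (fun i => (x i : ℂ))) (U * diagonal (fun i => (y i : ℂ)) * Uᴴ)
    (by rw [hX]; exact conj_psd _ _ hx) (conj_psd _ _ hy) (by
      have : U * diagonal (fun i => (y i : ℂ)) * Uᴴ - diagonal (fun i => (x i : ℂ)) =
          vecMulVec (fun i => (a i : ℂ)) (star (fun i => (a i : ℂ))) := by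
        rw [hconj, ← hdiag, ← Matrix.map_sub φ (by simp), hYX]
        ext i j; simp [vecMulVec_apply, φ]
      rw [this]; exact posSemidef_vecMulVec_self_star _)
  rw [cfc_conj U h1 h2, hX, cfc_conj 1 (by simp) (by simp)] at key
  simp only [one_mul, conjTranspose_one, mul_one] at key
  rw [hconj (fun i => f (y i)), ← hdiag (fun i => f (x i)), ← Matrix.map_sub φ (by simp)] at key
  have := psd_of_complex _ key v
  rw [sub_mulVec, dotProduct_sub, real_quad] at this
  have e : v ⬝ᵥ (diagonal fun i => f (x i)) *ᵥ v = ∑ i, f (x i) * v i ^ 2 := by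
    simp only [dotProduct, mulVec_diagonal]
    exact Finset.sum_congr rfl fun i _ => by ring
  rw [e] at this
  linarith

open Polynomial in
lemma lagrange_id {k : ℕ} (x : Fin k → ℝ) (hx : Function.Injective x) (g : ℝ[X])
    (hg : g.natDegree < k) (z : ℝ) (hz : ∀ i, z ≠ x i) :
    ∑ i, (∏ l ∈ Finset.univ.erase i, (x i - x l))⁻¹ * g.eval (x i) / (z - x i) =
      g.eval z / ∏ i, (z - x i) := by
  have hk : k ≠ 0 := by omega
  have h1 := Lagrange.eq_interpolate (s := Finset.univ) (v := x) (f := g) hx.injOn (by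
    simp only [Finset.card_univ, Fintype.card_fin]
    exact (degree_le_natDegree).trans_lt (by exact_mod_cast hg))
  have h2 := Lagrange.eval_interpolate_not_at_node (s := Finset.univ) (v := x) (x := z)
    (fun i => g.eval (x i)) (fun i _ => hz i)
  rw [← h1, Lagrange.eval_nodal] at h2
  have h3 : ∏ i, (z - x i) ≠ 0 := Finset.prod_ne_zero_iff.2 fun i _ => sub_ne_zero.2 (hz i)
  rw [eq_div_iff h3, h2, mul_comm]
  congr 1
  apply Finset.sum_congr rfl
  intro i _
  rw [Lagrange.nodalWeight, Finset.prod_inv_distrib]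
  ring

open Polynomial in
lemma claim1 (f : ℝ → ℝ) (hf : OperatorMonotone f) {k : ℕ} (x y : Fin k → ℝ)
    (hx0 : ∀ i, 0 ≤ x i) (hxy : ∀ i, x i < y i) (hyx : ∀ i j, i < j → y i < x j)
    (r : ℝ[X]) (hr : r.natDegree < k) :
    0 ≤ ∑ i, (r.eval (x i)) ^ 2 * f (x i) /
          ((∏ l ∈ Finset.univ.erase i, (x i - x l)) * ∏ m, (x i - y m)) +
        ∑ j, (r.eval (y j)) ^ 2 * f (y j) /
          ((∏ l ∈ Finset.univ.erase j, (y j - y l)) * ∏ i, (y j - x i)) := by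
  have hxm : StrictMono x := fun i j h => (hxy i).trans (hyx i j h)
  have hym : StrictMono y := fun i j h => (hyx i j h).trans (hxy j)
  have hne : ∀ i j, y j ≠ x i := by
    intro i j
    rcases lt_trichotomy i j with h | rfl | h
    · exact ((hxy i).trans (hym h)).ne'
    · exact (hxy i).ne'
    · exact (hyx j i h).ne
  have hsub : ∀ i j, y j - x i ≠ 0 := fun i j => sub_ne_zero.2 (hne i j)
  -- weights
  let px : Fin k → ℝ := fun i => ∏ l ∈ Finset.univ.erase i, (x i - x l)
  let py : Fin k → ℝ := fun j => ∏ l ∈ Finset.univ.erase j, (y j - y l)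
  let qx : Fin k → ℝ := fun i => ∏ m, (x i - y m)
  let qy : Fin k → ℝ := fun j => ∏ i, (y j - x i)
  have ha : ∀ i, 0 < -(qx i / px i) := by
    intro i
    have e : -(qx i / px i) = (y i - x i) * ∏ m ∈ Finset.univ.erase i, ((x i - y m) / (x i - x m)) := by
      simp only [qx, px]
      rw [← Finset.mul_prod_erase _ _ (Finset.mem_univ i), Finset.prod_div_distrib]
      ring
    rw [e]
    refine mul_pos (sub_pos.2 (hxy i)) (Finset.prod_pos fun m hm => ?_)
    rcases lt_or_gt_of_ne (Finset.ne_of_mem_erase hm) with h | h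
    · exact div_pos (sub_pos.2 (hyx _ _ h)) (sub_pos.2 (hxm h))
    · exact div_pos_of_neg_of_neg (sub_neg.2 ((hxm h).trans (hxy m))) (sub_neg.2 (hxm h))
  have hb : ∀ j, 0 < qy j / py j := by
    intro j
    have e : qy j / py j = (y j - x j) * ∏ m ∈ Finset.univ.erase j, ((y j - x m) / (y j - y m)) := by
      simp only [qy, py]
      rw [← Finset.mul_prod_erase _ _ (Finset.mem_univ j), Finset.prod_div_distrib]
      ring
    rw [e]
    refine mul_pos (sub_pos.2 (hxy j)) (Finset.prod_pos fun m hm => ?_)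
    rcases lt_or_gt_of_ne (Finset.ne_of_mem_erase hm) with h | h
    · exact div_pos (sub_pos.2 ((hxy m).trans (hym h))) (sub_pos.2 (hym h))
    · exact div_pos_of_neg_of_neg (sub_neg.2 (hyx _ _ h)) (sub_neg.2 (hym h))
  let α : Fin k → ℝ := fun i => √(-(qx i / px i))
  let β : Fin k → ℝ := fun j => √(qy j / py j)
  have hα : ∀ i, α i * α i = -(qx i / px i) := fun i => Real.mul_self_sqrt (ha i).le
  have hβ : ∀ i, β i * β i = (qy i / py i) := fun i => Real.mul_self_sqrt (hb i).le
  have hα0 : ∀ i, α i ≠ 0 := fun i => (Real.sqrt_pos.2 (ha i)).ne'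
  have hpx : ∀ i, px i ≠ 0 := fun i h => by have := ha i; simp [h] at this
  have hqx : ∀ i, qx i ≠ 0 := fun i h => by have := ha i; simp [h] at this
  have hpy : ∀ i, py i ≠ 0 := fun i h => by have := hb i; simp [h] at this
  have hqy : ∀ i, qy i ≠ 0 := fun i h => by have := hb i; simp [h] at this
  -- auxiliary polynomials
  let g : Fin k → ℝ[X] := fun j => Lagrange.nodal (Finset.univ.erase j) y
  have hgd : ∀ j, (g j).natDegree = k - 1 := by
    intro j; simp [g, Lagrange.natDegree_nodal, Finset.card_erase_of_mem]
  have hgk : ∀ j, (g j).natDegree < k := by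
    intro j; have := j.2; rw [hgd]; omega
  have hgx : ∀ i j, (g j).eval (x i) * (y j - x i) = - qx i := by
    intro i j
    simp only [g, qx, Lagrange.eval_nodal]
    rw [← Finset.mul_prod_erase _ _ (Finset.mem_univ j)]
    ring
  have hgy : ∀ j l, (g j).eval (y l) = if j = l then py l else 0 := by
    intro j l
    split_ifs with h
    · subst h; simp only [g, py, Lagrange.eval_nodal]
    · simp only [g, Lagrange.eval_nodal]
      exact Finset.prod_eq_zero (Finset.mem_erase.2 ⟨Ne.symm h, Finset.mem_univ l⟩) (sub_self _)
  let W : Matrix (Fin k) (Fin k) ℝ := Matrix.of fun i j => α i * β j / (y j - x i)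
  have hαg : ∀ i j, α i * α i / (y j - x i) = (px i)⁻¹ * (g j).eval (x i) := by
    intro i j
    rw [hα, div_eq_iff (hsub i j), mul_assoc, hgx]
    field_simp
  have hW : Wᵀ * W = 1 := by
    ext j l
    rw [Matrix.mul_apply, Matrix.one_apply]
    simp only [Matrix.transpose_apply, W, Matrix.of_apply]
    have e : ∀ i, α i * β j / (y j - x i) * (α i * β l / (y l - x i)) =
        β j * β l * ((px i)⁻¹ * (g j).eval (x i) / (y l - x i)) := by
      intro i; rw [← hαg]; ring
    simp only [e]
    rw [← Finset.mul_sum, lagrange_id x hxm.injective (g j) (hgk j) (y l) (fun i => hne i l), hgy]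
    split_ifs with h
    · subst h
      rw [hβ]
      change qy j / py j * (py j / qy j) = 1
      have := hpy j; have := hqy j
      field_simp
    · simp
  have hW' : W * Wᵀ = 1 := mul_eq_one_comm.1 hW
  have hαW : α ᵥ* W = β := by
    ext j
    simp only [vecMul, dotProduct, W, Matrix.of_apply]
    have e : ∀ i, α i * (α i * β j / (y j - x i)) = β j * ((g j).eval (x i) / px i) := by
      intro i
      have := hαg i j
      rw [div_eq_inv_mul ((g j).eval (x i)) (px i), ← this]; ring
    simp only [e]
    have hc := Lagrange.coeff_eq_sum (s := Finset.univ) (v := x) hxm.injective.injOn (P := g j) (by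
      simp only [Finset.card_univ, Fintype.card_fin]
      exact (degree_le_natDegree).trans_lt (by exact_mod_cast hgk j))
    rw [Finset.card_univ, Fintype.card_fin, ← hgd j] at hc
    have hm : (g j).coeff (g j).natDegree = 1 := (Lagrange.nodal_monic : (g j).Monic)
    rw [← Finset.mul_sum, ← hc, hm, mul_one]
  have hβW : W *ᵥ β = α := by
    rw [← hαW, ← mulVec_transpose, mulVec_mulVec, hW', one_mulVec]
  have hYX : W * diagonal y * Wᵀ - diagonal x = vecMulVec α α := by
    have e : W * diagonal y = diagonal x * W + vecMulVec α β := by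
      ext i j
      simp only [mul_diagonal, diagonal_mul, Matrix.add_apply, vecMulVec_apply, W, Matrix.of_apply]
      have := hsub i j
      field_simp
      ring
    rw [e, add_mul, mul_assoc, hW', mul_one, add_sub_cancel_left, vecMulVec_mul, vecMul_transpose, hβW]
  have main := opmono_real f hf x y α hx0 (fun i => (hx0 i).trans (hxy i).le) W hW hYX
    (fun i => r.eval (x i) / (px i * α i))
  have s1 : ∀ i, f (x i) * (r.eval (x i) / (px i * α i)) ^ 2 =
      - ((r.eval (x i)) ^ 2 * f (x i) / (px i * qx i)) := by
    intro i
    have : (px i * α i) ^ 2 = - (px i * qx i) := by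
      rw [mul_pow, sq (α i), hα]; have := hpx i; field_simp
    rw [div_pow, this, div_neg]; ring
  have s2 : ∀ j, ∑ i, r.eval (x i) / (px i * α i) * W i j = β j * (r.eval (y j) / qy j) := by
    intro j
    have := lagrange_id x hxm.injective r hr (y j) (fun i => hne i j)
    change _ = r.eval (y j) / qy j at this
    rw [← this, Finset.mul_sum]
    apply Finset.sum_congr rfl
    intro i _
    change _ = β j * ((px i)⁻¹ * r.eval (x i) / (y j - x i))
    simp only [W, Matrix.of_apply]
    have := hα0 i; have := hpx i; have := hsub i j
    field_simp
  have s3 : ∀ j, f (y j) * (β j * (r.eval (y j) / qy j)) ^ 2 =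
      (r.eval (y j)) ^ 2 * f (y j) / (py j * qy j) := by
    intro j
    rw [mul_pow, sq (β j), hβ]
    have := hpy j; have := hqy j
    field_simp
  simp only [s1, s2, s3, Finset.sum_neg_distrib] at main
  change 0 ≤ ∑ i, (r.eval (x i)) ^ 2 * f (x i) / (px i * qx i) +
    ∑ j, (r.eval (y j)) ^ 2 * f (y j) / (py j * qy j)
  linarith

open Polynomial in
lemma claim2_even (f : ℝ → ℝ) (hf : OperatorMonotone f) (T : Finset ℝ) (hT : ∀ t ∈ T, 0 ≤ t)
    (k : ℕ) (hk : T.card = k * 2) (r : ℝ[X]) (hr : r.natDegree < k) :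
    ∑ t ∈ T, (r.eval t) ^ 2 * f t / ∏ u ∈ T.erase t, (u - t) ≤ 0 := by
  let e := T.orderEmbOfFin hk
  let x : Fin k → ℝ := fun i => e (finProdFinEquiv (i, 0))
  let y : Fin k → ℝ := fun i => e (finProdFinEquiv (i, 1))
  have hxT : ∀ i, x i ∈ T := fun i => T.orderEmbOfFin_mem hk _
  have hyT : ∀ i, y i ∈ T := fun i => T.orderEmbOfFin_mem hk _
  have hxy : ∀ i, x i < y i := by
    intro i
    apply e.strictMono
    rw [Fin.lt_def]; simp [finProdFinEquiv]
  have hyx : ∀ i j, i < j → y i < x j := by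
    intro i j h
    apply e.strictMono
    rw [Fin.lt_def] at *; simp [finProdFinEquiv]; omega
  have hxm : StrictMono x := fun i j h => (hxy i).trans (hyx i j h)
  have hym : StrictMono y := fun i j h => (hyx i j h).trans (hxy j)
  have hne : ∀ i j, y j ≠ x i := by
    intro i j
    rcases lt_trichotomy i j with h | rfl | h
    · exact ((hxy i).trans (hym h)).ne'
    · exact (hxy i).ne'
    · exact (hyx j i h).ne
  have himg : T = Finset.univ.image e := by
    rw [← Finset.coe_inj]; simp [e]
  have hsum : ∀ F : ℝ → ℝ, ∑ t ∈ T, F t = ∑ i, F (x i) + ∑ i, F (y i) := by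
    intro F
    conv_lhs => rw [himg]
    rw [Finset.sum_image (fun a _ b _ h => e.injective h), ← finProdFinEquiv.sum_comp,
      Fintype.sum_prod_type]
    simp only [Fin.sum_univ_two, Finset.sum_add_distrib]
    rfl
  have hprod : ∀ F : ℝ → ℝ, ∏ t ∈ T, F t = (∏ i, F (x i)) * ∏ i, F (y i) := by
    intro F
    conv_lhs => rw [himg]
    rw [Finset.prod_image (fun a _ b _ h => e.injective h), ← finProdFinEquiv.prod_comp,
      Fintype.prod_prod_type]
    simp only [Fin.prod_univ_two, Finset.prod_mul_distrib]
    rfl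
  have herase : ∀ t ∈ T, ∏ u ∈ T.erase t, (u - t) = ∏ u ∈ T, if u = t then 1 else u - t := by
    intro t ht
    rw [← Finset.mul_prod_erase T _ ht, if_pos rfl, one_mul]
    exact Finset.prod_congr rfl fun u hu => (if_neg (Finset.ne_of_mem_erase hu)).symm
  have hk1 : ((-1 : ℝ)) ^ (k - 1) * (-1) ^ k = -1 := by
    rw [← pow_add]; exact Odd.neg_one_pow ⟨k - 1, by omega⟩
  have hflip : ∀ (s : Finset (Fin k)) (z : Fin k → ℝ) (t : ℝ),
      ∏ l ∈ s, (z l - t) = (-1) ^ s.card * ∏ l ∈ s, (t - z l) := by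
    intro s z t
    rw [← Finset.prod_neg]; exact Finset.prod_congr rfl fun _ _ => by ring
  have hX : ∀ i, ∏ u ∈ T.erase (x i), (u - x i) =
      -((∏ l ∈ Finset.univ.erase i, (x i - x l)) * ∏ m, (x i - y m)) := by
    intro i
    rw [herase _ (hxT i), hprod, ← Finset.mul_prod_erase _ _ (Finset.mem_univ i), if_pos rfl, one_mul]
    have e1 : (∏ l ∈ Finset.univ.erase i, if x l = x i then 1 else x l - x i) =
        ∏ l ∈ Finset.univ.erase i, (x l - x i) := Finset.prod_congr rfl fun l hl =>
      if_neg (fun h => Finset.ne_of_mem_erase hl (hxm.injective h))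
    have e2 : (∏ l, if y l = x i then 1 else y l - x i) = ∏ l, (y l - x i) :=
      Finset.prod_congr rfl fun l hl => if_neg (hne i l)
    rw [e1, e2, hflip, hflip, Finset.card_erase_of_mem (Finset.mem_univ _), Finset.card_univ,
      Fintype.card_fin]
    linear_combination ((∏ l ∈ Finset.univ.erase i, (x i - x l)) * ∏ m, (x i - y m)) * hk1
  have hY : ∀ i, ∏ u ∈ T.erase (y i), (u - y i) =
      -((∏ l ∈ Finset.univ.erase i, (y i - y l)) * ∏ m, (y i - x m)) := by
    intro i
    rw [herase _ (hyT i), hprod,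
      ← Finset.mul_prod_erase _ (fun l => if y l = y i then 1 else y l - y i) (Finset.mem_univ i),
      if_pos rfl, one_mul]
    have e1 : (∏ l ∈ Finset.univ.erase i, if y l = y i then 1 else y l - y i) =
        ∏ l ∈ Finset.univ.erase i, (y l - y i) := Finset.prod_congr rfl fun l hl =>
      if_neg (fun h => Finset.ne_of_mem_erase hl (hym.injective h))
    have e2 : (∏ l, if x l = y i then 1 else x l - y i) = ∏ l, (x l - y i) :=
      Finset.prod_congr rfl fun l hl => if_neg (hne l i).symm
    rw [e1, e2, hflip, hflip, Finset.card_erase_of_mem (Finset.mem_univ _), Finset.card_univ,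
      Fintype.card_fin]
    linear_combination ((∏ l ∈ Finset.univ.erase i, (y i - y l)) * ∏ m, (y i - x m)) * hk1
  have main := claim1 f hf x y (fun i => hT _ (hxT i)) hxy hyx r hr
  rw [hsum]
  simp only [hX, hY, div_neg, Finset.sum_neg_distrib]
  linarith

open Polynomial in
lemma claim2 (f : ℝ → ℝ) (hf : OperatorMonotone f) (T : Finset ℝ) (hT : ∀ t ∈ T, 0 ≤ t)
    (r : ℝ[X]) (hr : 2 * r.natDegree + 2 ≤ T.card) :
    ∑ t ∈ T, (r.eval t) ^ 2 * f t / ∏ u ∈ T.erase t, (u - t) ≤ 0 := by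
  rcases Nat.even_or_odd' T.card with ⟨k, hk | hk⟩
  · exact claim2_even f hf T hT k (by omega) r (by omega)
  -- odd case: add a large point `τ`
  set F : ℝ → ℝ := fun t => (r.eval t) ^ 2 * f t / ∏ u ∈ T.erase t, (u - t) with hF
  have hbig : ∀ᶠ τ : ℝ in Filter.atTop, ∑ t ∈ T, F t * (1 - t * τ⁻¹) ≤ 0 := by
    have hlt : ∀ᶠ τ : ℝ in Filter.atTop, ∀ t ∈ T, t < τ := by
      rw [Filter.eventually_all_finset]
      intro t _
      exact Filter.eventually_gt_atTop t
    filter_upwards [hlt, Filter.eventually_gt_atTop 0] with τ hτ hτ0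
    have hτT : τ ∉ T := fun h => lt_irrefl _ (hτ τ h)
    have := claim2_even f hf (insert τ T) (by
      intro t ht
      rcases Finset.mem_insert.1 ht with rfl | h
      · exact hτ0.le
      · exact hT t h) (k + 1) (by rw [Finset.card_insert_of_notMem hτT]; omega)
      (r * (C τ - X)) (by
        have h1 := natDegree_mul_le (p := r) (q := C τ - X)
        have h2 : (C τ - X : ℝ[X]).natDegree ≤ 1 :=
          (natDegree_sub_le _ _).trans (by simp)
        omega)
    rw [Finset.sum_insert hτT] at this
    simp only [eval_mul, eval_sub, eval_C, eval_X, sub_self, mul_zero, ne_eq, OfNat.ofNat_ne_zero,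
      not_false_eq_true, zero_pow, zero_mul, zero_div, zero_add] at this
    have e : ∑ t ∈ T, F t * (1 - t * τ⁻¹) = τ⁻¹ * ∑ t ∈ T, (r.eval t * (τ - t)) ^ 2 * f t /
        ∏ u ∈ (insert τ T).erase t, (u - t) := by
      rw [Finset.mul_sum]
      apply Finset.sum_congr rfl
      intro t ht
      have hne : τ ≠ t := (hτ t ht).ne'
      rw [Finset.erase_insert_of_ne hne, Finset.prod_insert (fun h => hτT (Finset.mem_of_mem_erase h))]
      have h1 : ∏ u ∈ T.erase t, (u - t) ≠ 0 := Finset.prod_ne_zero_iff.2 fun u hu =>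
        sub_ne_zero.2 (Finset.ne_of_mem_erase hu)
      have h2 : τ - t ≠ 0 := sub_ne_zero.2 hne
      simp only [hF]
      field_simp
    rw [e]
    exact mul_nonpos_of_nonneg_of_nonpos (by positivity) this
  have hlim : Filter.Tendsto (fun τ : ℝ => ∑ t ∈ T, F t * (1 - t * τ⁻¹)) Filter.atTop
      (nhds (∑ t ∈ T, F t * (1 - t * 0))) := by
    apply tendsto_finsetSum
    intro t _
    exact (tendsto_const_nhds.sub (tendsto_inv_atTop_zero.const_mul t)).const_mul _
  simp only [mul_zero, sub_zero, mul_one] at hlim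
  exact le_of_tendsto hlim hbig

open Polynomial in
lemma lowner_finset (f : ℝ → ℝ) (hf : OperatorMonotone f) (hf0 : f 0 = 0) (T : Finset ℝ)
    (hT : ∀ t ∈ T, 0 < t) (c : ℝ → ℝ)
    (hc : ∀ s, 0 < s → 0 ≤ ∑ t ∈ T, c t * (t / (t + s))) : 0 ≤ ∑ t ∈ T, c t * f t := by
  rcases T.eq_empty_or_nonempty with rfl | hTn
  · simp
  have hcard : 0 < T.card := hTn.card_pos
  let w : ℝ → ℝ := fun t => ∏ u ∈ T.erase t, (u - t)
  have hw : ∀ t ∈ T, w t ≠ 0 := fun t _ => Finset.prod_ne_zero_iff.2 fun u hu =>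
        sub_ne_zero.2 (Finset.ne_of_mem_erase hu)
  let Q : ℝ[X] := ∑ t ∈ T, C (c t * t) * ∏ u ∈ T.erase t, (X + C u)
  have hQd : Q.natDegree ≤ T.card - 1 := by
    apply natDegree_sum_le_of_forall_le
    intro t ht
    refine (natDegree_C_mul_le _ _).trans ((natDegree_prod_le _ _).trans ?_)
    simp [Finset.card_erase_of_mem ht]
  have hQs : ∀ s, 0 < s → 0 ≤ Q.eval s := by
    intro s hs
    have e : Q.eval s = (∏ u ∈ T, (s + u)) * ∑ t ∈ T, c t * (t / (t + s)) := by
      simp only [Q, eval_finsetSum, eval_mul, eval_C, eval_prod, eval_add, eval_X]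
      rw [Finset.mul_sum]
      apply Finset.sum_congr rfl
      intro t ht
      rw [← Finset.mul_prod_erase T _ ht]
      have : t + s ≠ 0 := by have := hT t ht; positivity
      field_simp
      ring
    rw [e]
    refine mul_nonneg (Finset.prod_nonneg fun u hu => ?_) (hc s hs)
    have := hT u hu; positivity
  have hQt : ∀ t ∈ T, Q.eval (-t) = c t * t * w t := by
    intro t ht
    simp only [Q, eval_finsetSum, eval_mul, eval_C, eval_prod, eval_add, eval_X]
    rw [Finset.sum_eq_single_of_mem t ht]
    · congr 1
      exact Finset.prod_congr rfl fun u _ => by ring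
    · intro b hb hbt
      rw [Finset.prod_eq_zero (Finset.mem_erase.2 ⟨Ne.symm hbt, ht⟩) (by ring), mul_zero]
  have hgood := goodPoly_of_nonneg _ Q hQd hQs
  have hL : ∀ p : ℝ[X], GoodPoly (T.card - 1) p → 0 ≤ ∑ t ∈ T, p.eval (-t) * f t / (t * w t) := by
    intro p hp
    induction hp with
    | add p q _ _ h1 h2 =>
      simp only [eval_add, add_mul, add_div, Finset.sum_add_distrib]
      exact add_nonneg h1 h2
    | xsq q h =>
      have hd : (q.comp (-X)).natDegree = q.natDegree := by simp [natDegree_comp]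
      have := claim2 f hf T (fun t ht => (hT t ht).le) (q.comp (-X)) (by omega)
      have e : ∑ t ∈ T, (X * (q * q)).eval (-t) * f t / (t * w t) =
          - ∑ t ∈ T, ((q.comp (-X)).eval t) ^ 2 * f t / ∏ u ∈ T.erase t, (u - t) := by
        rw [← Finset.sum_neg_distrib]
        apply Finset.sum_congr rfl
        intro t ht
        have h1 := hw t ht
        have h2 := (hT t ht).ne'
        change _ = - (((q.comp (-X)).eval t) ^ 2 * f t / w t)
        simp only [eval_mul, eval_X, eval_comp, eval_neg]
        field_simp
      rw [e]; linarith
    | sq q h =>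
      have hd : (q.comp (-X)).natDegree = q.natDegree := by simp [natDegree_comp]
      have h0 : (0 : ℝ) ∉ T := fun h => lt_irrefl _ (hT 0 h)
      have := claim2 f hf (insert 0 T) (by
        intro t ht
        rcases Finset.mem_insert.1 ht with rfl | h
        · exact le_rfl
        · exact (hT t h).le) (q.comp (-X)) (by rw [Finset.card_insert_of_notMem h0]; omega)
      rw [Finset.sum_insert h0, hf0, mul_zero, zero_div, zero_add] at this
      have e : ∑ t ∈ T, (q * q).eval (-t) * f t / (t * w t) =
          - ∑ t ∈ T, ((q.comp (-X)).eval t) ^ 2 * f t / ∏ u ∈ (insert 0 T).erase t, (u - t) := by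
        rw [← Finset.sum_neg_distrib]
        apply Finset.sum_congr rfl
        intro t ht
        have h1 := hw t ht
        have h2 := (hT t ht).ne'
        rw [Finset.erase_insert_of_ne h2.symm,
          Finset.prod_insert (fun h => h0 (Finset.mem_of_mem_erase h))]
        change _ = - (((q.comp (-X)).eval t) ^ 2 * f t / ((0 - t) * w t))
        simp only [eval_mul, eval_X, eval_comp, eval_neg]
        rw [zero_sub]
        field_simp
      rw [e]; linarith
  have := hL Q hgood
  convert this using 1
  apply Finset.sum_congr rfl
  intro t ht
  have h1 := hw t ht
  have h2 := (hT t ht).ne'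
  rw [hQt t ht]
  field_simp

lemma lowner_index (f : ℝ → ℝ) (hf : OperatorMonotone f) (hf0 : f 0 = 0) {ι : Type*} [Fintype ι]
    (a : ι → ℝ) (ha : ∀ i, 0 ≤ a i) (c : ι → ℝ)
    (hc : ∀ s, 0 < s → 0 ≤ ∑ i, c i * (a i / (a i + s))) : 0 ≤ ∑ i, c i * f (a i) := by
  classical
  let T : Finset ℝ := (Finset.univ.image a).erase 0
  let c' : ℝ → ℝ := fun t => ∑ i with a i = t, c i
  have hs : ∀ g : ℝ → ℝ, g 0 = 0 → ∑ t ∈ T, c' t * g t = ∑ i, c i * g (a i) := by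
    intro g hg
    have h1 : ∑ t ∈ T, c' t * g t = ∑ t ∈ Finset.univ.image a, c' t * g t := by
      apply Finset.sum_subset (Finset.erase_subset _ _)
      intro t ht ht'
      have : t = 0 := by
        by_contra h
        exact ht' (Finset.mem_erase.2 ⟨h, ht⟩)
      rw [this, hg, mul_zero]
    rw [h1, ← Finset.sum_fiberwise_of_maps_to (s := Finset.univ) (t := Finset.univ.image a) (g := a)
      (fun i hi => Finset.mem_image_of_mem a hi)]
    apply Finset.sum_congr rfl
    intro t _
    simp only [c']
    rw [Finset.sum_mul]
    apply Finset.sum_congr rfl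
    intro i hi
    rw [(Finset.mem_filter.1 hi).2]
  rw [← hs f hf0]
  apply lowner_finset f hf hf0 T
  · intro t ht
    obtain ⟨h0, h1⟩ := Finset.mem_erase.1 ht
    obtain ⟨i, -, rfl⟩ := Finset.mem_image.1 h1
    exact lt_of_le_of_ne (ha i) (Ne.symm h0)
  · intro s hs0
    rw [hs (fun t => t / (t + s)) (by simp)]
    exact hc s hs0

/-- `U diag(d) Uᴴ`. -/
noncomputable def cdiag {n : Type*} [Fintype n] [DecidableEq n] (U : Matrix n n ℂ) (d : n → ℝ) :
    Matrix n n ℂ := U * diagonal (fun i => (d i : ℂ)) * Uᴴ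

lemma cdiag_mul {n : Type*} [Fintype n] [DecidableEq n] (U : Matrix n n ℂ) (h2 : Uᴴ * U = 1)
    (d e : n → ℝ) : cdiag U d * cdiag U e = cdiag U (fun i => d i * e i) := by
  simp only [cdiag]
  calc _ = U * diagonal (fun i => (d i : ℂ)) * (Uᴴ * U) * diagonal (fun i => (e i : ℂ)) * Uᴴ := by
        simp only [mul_assoc]
    _ = _ := by rw [h2, mul_one, mul_assoc U, diagonal_mul_diagonal]; simp

lemma cdiag_add {n : Type*} [Fintype n] [DecidableEq n] (U : Matrix n n ℂ)
    (d e : n → ℝ) : cdiag U d + cdiag U e = cdiag U (fun i => d i + e i) := by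
  simp only [cdiag]
  rw [← add_mul, ← mul_add, diagonal_add]; simp

lemma cdiag_sub {n : Type*} [Fintype n] [DecidableEq n] (U : Matrix n n ℂ)
    (d e : n → ℝ) : cdiag U d - cdiag U e = cdiag U (fun i => d i - e i) := by
  simp only [cdiag]
  rw [← sub_mul, ← mul_sub, diagonal_sub]; simp

lemma cdiag_one {n : Type*} [Fintype n] [DecidableEq n] (U : Matrix n n ℂ) (h1 : U * Uᴴ = 1) :
    1 = cdiag U (fun _ => 1) := by
  simp [cdiag, h1]

lemma cdiag_zero {n : Type*} [Fintype n] [DecidableEq n] (U : Matrix n n ℂ) :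
    cdiag U (fun _ => 0) = 0 := by
  simp [cdiag]

lemma cdiag_smul {n : Type*} [Fintype n] [DecidableEq n] (U : Matrix n n ℂ) (c : ℝ) (d : n → ℝ) :
    cdiag U (fun i => c * d i) = (c : ℂ) • cdiag U d := by
  simp only [cdiag]
  have : diagonal (fun i => ((c * d i : ℝ) : ℂ)) = (c : ℂ) • diagonal (fun i => (d i : ℂ)) := by
    ext i j; by_cases h : i = j
    · subst h; simp
    · simp [h]
  rw [this]; simp

lemma cdiag_inv {n : Type*} [Fintype n] [DecidableEq n] (U : Matrix n n ℂ) (h1 : U * Uᴴ = 1)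
    (h2 : Uᴴ * U = 1) (a : n → ℝ) (ha : ∀ i, 0 ≤ a i) (s : ℝ) (hs : 0 < s) :
    (1 - cdiag U (fun i => a i / (a i + s))).PosSemidef ∧
    (1 - cdiag U (fun i => a i / (a i + s))) * (1 + cdiag U (fun i => s⁻¹ * a i)) = 1 ∧
    (1 + cdiag U (fun i => s⁻¹ * a i)) * (1 - cdiag U (fun i => a i / (a i + s))) = 1 := by
  have hne : ∀ i, a i + s ≠ 0 := fun i => by have := ha i; positivity
  rw [cdiag_one U h1, cdiag_sub, cdiag_add, cdiag_mul U h2, cdiag_mul U h2]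
  refine ⟨?_, ?_, ?_⟩
  · apply conj_psd
    intro i
    have : 1 - a i / (a i + s) = s / (a i + s) := by have := hne i; field_simp; ring
    rw [this]; have := ha i; positivity
  · congr 1; ext i; have := hne i; field_simp; ring
  · congr 1; ext i; have := hne i; field_simp; ring

lemma matAbs_cdiag {n : Type*} [Fintype n] [DecidableEq n] (U : Matrix n n ℂ) (h1 : U * Uᴴ = 1)
    (h2 : Uᴴ * U = 1) (d : n → ℝ) : matAbs (cdiag U d) = cdiag U (fun i => |d i|) := by
  have hh : (cdiag U d)ᴴ = cdiag U d := conj_herm U d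
  rw [matAbs, hh, cdiag_mul U h2]
  refine (cfc_conj U h1 h2 _ _).trans ?_
  simp only [Real.sqrt_mul_self_eq_abs]
  rfl

lemma phi_ineq {n : Type*} [Fintype n] [DecidableEq n] (U V W : Matrix n n ℂ)
    (hU1 : U * Uᴴ = 1) (hU2 : Uᴴ * U = 1) (hV1 : V * Vᴴ = 1) (hV2 : Vᴴ * V = 1)
    (hW1 : W * Wᴴ = 1) (hW2 : Wᴴ * W = 1) (a b d : n → ℝ) (ha : ∀ i, 0 ≤ a i) (hb : ∀ i, 0 ≤ b i)
    (hD : cdiag U a - cdiag V b = cdiag W d) (s : ℝ) (hs : 0 < s) :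
    (trace (cdiag W d * (cdiag U (fun i => a i / (a i + s)) - cdiag V (fun i => b i / (b i + s))))).re
      ≤ (trace (cdiag W (fun i => |d i|) * cdiag W (fun i => |d i| / (|d i| + s)))).re := by
  obtain ⟨p1, p2, p3⟩ := cdiag_inv U hU1 hU2 a ha s hs
  obtain ⟨q1, q2, q3⟩ := cdiag_inv V hV1 hV2 b hb s hs
  obtain ⟨k1, k2, k3⟩ := cdiag_inv W hW1 hW2 (fun i => |d i|) (fun i => abs_nonneg _) s hs
  have hsi : 0 < s⁻¹ := by positivity
  have hE : cdiag W (fun i => s⁻¹ * max (d i) 0) + cdiag W (fun i => s⁻¹ * max (-d i) 0) =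
      cdiag W (fun i => s⁻¹ * |d i|) := by
    rw [cdiag_add]; congr 1; ext i
    rw [← mul_add]; congr 1
    rcases le_total 0 (d i) with h | h
    · rw [max_eq_left h, max_eq_right (by linarith), abs_of_nonneg h, add_zero]
    · rw [max_eq_right h, max_eq_left (by linarith), abs_of_nonpos h, zero_add]
  have hDD : cdiag W (fun i => s⁻¹ * max (d i) 0) - cdiag W (fun i => s⁻¹ * max (-d i) 0) =
      cdiag W (fun i => s⁻¹ * d i) := by
    rw [cdiag_sub]; congr 1; ext i
    rw [← mul_sub]; congr 1
    rcases le_total 0 (d i) with h | h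
    · rw [max_eq_left h, max_eq_right (by linarith), sub_zero]
    · rw [max_eq_right h, max_eq_left (by linarith)]; ring
  have hz : ∀ i, max (d i) 0 * max (-d i) 0 = 0 := by
    intro i
    rcases le_total 0 (d i) with h | h
    · rw [max_eq_right (b := (0:ℝ)) (a := - d i) (by linarith), mul_zero]
    · rw [max_eq_right h, zero_mul]
  have hAB : cdiag U (fun i => s⁻¹ * a i) - cdiag V (fun i => s⁻¹ * b i) =
      cdiag W (fun i => s⁻¹ * d i) := by
    rw [cdiag_smul, cdiag_smul, cdiag_smul, ← smul_sub, hD]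
  have key := key_gen (cdiag U (fun i => s⁻¹ * a i)) (cdiag V (fun i => s⁻¹ * b i))
    (cdiag W (fun i => s⁻¹ * max (d i) 0)) (cdiag W (fun i => s⁻¹ * max (-d i) 0)) _ _ _
    (conj_psd _ _ fun i => mul_nonneg hsi.le (ha i))
    (conj_psd _ _ fun i => mul_nonneg hsi.le (hb i))
    (conj_psd _ _ fun i => mul_nonneg hsi.le (le_max_right _ _))
    (conj_psd _ _ fun i => mul_nonneg hsi.le (le_max_right _ _))
    (hAB.trans hDD.symm)
    (by
      rw [cdiag_mul W hW2, ← cdiag_zero W]; congr 1; ext i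
      linear_combination s⁻¹ * s⁻¹ * hz i)
    (by
      rw [cdiag_mul W hW2, ← cdiag_zero W]; congr 1; ext i
      linear_combination s⁻¹ * s⁻¹ * hz i)
    p1 q1 p2 p3 q2 q3 (by rw [hE]; exact k3)
  rw [hE, hAB, sub_sub_cancel, sub_sub_sub_cancel_left, cdiag_smul, cdiag_smul, smul_mul_assoc,
    smul_mul_assoc, trace_smul, trace_smul, smul_eq_mul, smul_eq_mul, Complex.re_ofReal_mul,
    Complex.re_ofReal_mul] at key
  exact le_of_mul_le_mul_left key hsi

theorem stmt_8 {n : Type*} [Fintype n] [DecidableEq n] (f : ℝ → ℝ)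
    (hf : OperatorMonotone f) (hf0 : f 0 = 0) (hfnn : ∀ x, 0 ≤ x → 0 ≤ f x)
    (A B : Matrix n n ℂ) (hA : A.PosSemidef) (hB : B.PosSemidef) :
    Matrix.trace ((A - B) * (cfc f A - cfc f B)) ≤
      Matrix.trace (matAbs (A - B) * cfc f (matAbs (A - B))) := by
  obtain ⟨U, a, hU1, hU2, hAU, ha⟩ := exists_conj A hA.1
  obtain ⟨V, b, hV1, hV2, hBV, hb⟩ := exists_conj B hB.1
  obtain ⟨W, d, hW1, hW2, hDW, -⟩ := exists_conj (A - B) (hA.1.sub hB.1)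
  have ha := ha hA
  have hb := hb hB
  change A = cdiag U a at hAU
  change B = cdiag V b at hBV
  change A - B = cdiag W d at hDW
  have cU : ∀ g : ℝ → ℝ, cfc g (cdiag U a) = cdiag U (fun i => g (a i)) :=
    fun g => cfc_conj U hU1 hU2 a g
  have cV : ∀ g : ℝ → ℝ, cfc g (cdiag V b) = cdiag V (fun i => g (b i)) :=
    fun g => cfc_conj V hV1 hV2 b g
  have cW : ∀ g : ℝ → ℝ, cfc g (cdiag W (fun i => |d i|)) = cdiag W (fun i => g (|d i|)) :=
    fun g => cfc_conj W hW1 hW2 _ g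
  have hD : cdiag U a - cdiag V b = cdiag W d := by rw [← hAU, ← hBV, hDW]
  rw [hDW, hAU, hBV, matAbs_cdiag W hW1 hW2, cU, cV, cW]
  have herm : ∀ (Z : Matrix n n ℂ) (z : n → ℝ), (cdiag Z z).IsHermitian := fun Z z => conj_herm Z z
  rw [Complex.le_def]
  refine ⟨?_, ?_⟩
  · -- the real functional
    let c : n ⊕ (n ⊕ n) → ℝ := Sum.elim
      (fun i => ((Wᴴ * cdiag W (fun i => |d i|) * W) i i).re)
      (Sum.elim (fun i => -((Uᴴ * cdiag W d * U) i i).re) (fun i => ((Vᴴ * cdiag W d * V) i i).re))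
    let p : n ⊕ (n ⊕ n) → ℝ := Sum.elim (fun i => |d i|) (Sum.elim a b)
    have hfun : ∀ g : ℝ → ℝ, ∑ i, c i * g (p i) =
        (trace (cdiag W (fun i => |d i|) * cdiag W (fun i => g (|d i|)))).re -
        (trace (cdiag W d * (cdiag U (fun i => g (a i)) - cdiag V (fun i => g (b i))))).re := by
      intro g
      have e1 := trace_mul_conj W (cdiag W (fun i => |d i|)) (fun i => g (|d i|))
      have e2 := trace_mul_conj U (cdiag W d) (fun i => g (a i))
      have e3 := trace_mul_conj V (cdiag W d) (fun i => g (b i))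
      rw [mul_sub, trace_sub, Complex.sub_re]
      change _ = (trace (_ * (W * _ * _))).re - ((trace (_ * (U * _ * _))).re -
        (trace (_ * (V * _ * _))).re)
      rw [e1, e2, e3]
      simp only [Fintype.sum_sum_type, c, p, Sum.elim_inl, Sum.elim_inr, neg_mul,
        Finset.sum_neg_distrib]
      ring
    have main := lowner_index f hf hf0 p (by
      rintro (i | i | i)
      · exact abs_nonneg _
      · exact ha i
      · exact hb i) c (by
      intro s hs
      rw [hfun (fun t => t / (t + s))]
      exact sub_nonneg.2 (phi_ineq U V W hU1 hU2 hV1 hV2 hW1 hW2 a b d ha hb hD s hs))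
    rw [hfun f] at main
    exact sub_nonneg.1 main
  · rw [trace_mul_herm_im _ _ (herm _ _) ((herm _ _).sub (herm _ _)),
      trace_mul_herm_im _ _ (herm _ _) (herm _ _)]
end

section
/- Let f be a nonnegative operator monotone function on [0,∞) with f(0) = 0, and let A ≥ B ≥ 0 be n×n Hermitian matrices. Then Tr((A - B)(f(A) - f(B))) ≤ Tr((A - B) f(A - B)). -/
open Matrix ComplexOrder

namespace Stmt9

open Polynomial in
theorem exists_poly (f : ℝ → ℝ) (S : Set ℝ) (hS : S.Finite) :
    ∃ p : ℝ[X], ∀ x ∈ S, p.eval x = f x := by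
  classical
  refine ⟨Lagrange.interpolate hS.toFinset id f, fun x hx => ?_⟩
  exact Lagrange.eval_interpolate_at_node (v := id) f (Function.injective_id.injOn)
    (hS.mem_toFinset.2 hx)

theorem cont_spec {n : Type*} [Fintype n] [DecidableEq n] (f : ℝ → ℝ) (X : Matrix n n ℂ) :
    ContinuousOn f (spectrum ℝ X) :=
  (Matrix.finite_real_spectrum (A := X)).continuousOn f

theorem cfc_eq_aeval {n : Type*} [Fintype n] [DecidableEq n] {f : ℝ → ℝ}
    {p : Polynomial ℝ} {X : Matrix n n ℂ} (hX : X.IsHermitian)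
    (h : ∀ x ∈ spectrum ℝ X, p.eval x = f x) : cfc f X = Polynomial.aeval X p := by
  have hX' : IsSelfAdjoint X := hX
  rw [← cfc_polynomial p X hX']
  exact cfc_congr (fun x hx => (h x hx).symm)

theorem map_cfc {n m : Type*} [Fintype n] [DecidableEq n] [Fintype m] [DecidableEq m]
    (φ : Matrix n n ℂ →ₐ[ℝ] Matrix m m ℂ) (f : ℝ → ℝ) {X : Matrix n n ℂ} (hX : X.IsHermitian)
    (hφ : (φ X).IsHermitian) : cfc f (φ X) = φ (cfc f X) := by
  obtain ⟨p, hp⟩ := exists_poly f (spectrum ℝ X ∪ spectrum ℝ (φ X))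
    (Matrix.finite_real_spectrum.union Matrix.finite_real_spectrum)
  rw [cfc_eq_aeval hX (fun x hx => hp x (Or.inl hx)),
    cfc_eq_aeval hφ (fun x hx => hp x (Or.inr hx)), Polynomial.aeval_algHom_apply]

theorem aeval_fromBlocks {n m : Type*} [Fintype n] [DecidableEq n] [Fintype m] [DecidableEq m]
    (X : Matrix n n ℂ) (Y : Matrix m m ℂ) (p : Polynomial ℝ) :
    Polynomial.aeval (fromBlocks X 0 0 Y) p =
      fromBlocks (Polynomial.aeval X p) 0 0 (Polynomial.aeval Y p) := by
  induction p using Polynomial.induction_on' with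
  | add p q hp hq => simp [hp, hq, fromBlocks_add]
  | monomial k a =>
    simp only [Polynomial.aeval_monomial, fromBlocks_diagonal_pow, Algebra.algebraMap_eq_smul_one,
      smul_mul_assoc, one_mul, fromBlocks_smul, smul_zero]

theorem cfc_fromBlocks {n m : Type*} [Fintype n] [DecidableEq n] [Fintype m] [DecidableEq m]
    (f : ℝ → ℝ) {X : Matrix n n ℂ} {Y : Matrix m m ℂ} (hX : X.IsHermitian) (hY : Y.IsHermitian) :
    cfc f (fromBlocks X 0 0 Y) = fromBlocks (cfc f X) 0 0 (cfc f Y) := by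
  obtain ⟨p, hp⟩ := exists_poly f
    (spectrum ℝ X ∪ spectrum ℝ Y ∪ spectrum ℝ (fromBlocks X 0 0 Y))
    ((Matrix.finite_real_spectrum.union Matrix.finite_real_spectrum).union
      Matrix.finite_real_spectrum)
  rw [cfc_eq_aeval hX (fun x hx => hp x (Or.inl (Or.inl hx))),
    cfc_eq_aeval hY (fun x hx => hp x (Or.inl (Or.inr hx))),
    cfc_eq_aeval (hX.fromBlocks (by simp) hY) (fun x hx => hp x (Or.inr hx)), aeval_fromBlocks]

theorem opmono {f : ℝ → ℝ} (hf : OperatorMonotone f) {n : Type*} [Fintype n] [DecidableEq n]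
    {X Y : Matrix n n ℂ} (hX : X.PosSemidef) (hY : Y.PosSemidef) (h : (Y - X).PosSemidef) :
    (cfc f Y - cfc f X).PosSemidef := by
  let e := Fintype.equivFin n
  let φ := (Matrix.reindexAlgEquiv ℝ ℂ e).toAlgHom
  have key : ∀ Z : Matrix n n ℂ, φ Z = Z.submatrix e.symm e.symm := fun Z => rfl
  have hX' : (φ X).PosSemidef := by rw [key]; exact hX.submatrix _
  have hY' : (φ Y).PosSemidef := by rw [key]; exact hY.submatrix _
  have h' : (φ Y - φ X).PosSemidef := by rw [← map_sub, key]; exact h.submatrix _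
  have := hf _ _ _ hX' hY' h'
  rw [map_cfc φ f hX.1 hX'.1, map_cfc φ f hY.1 hY'.1, ← map_sub, key] at this
  exact (posSemidef_submatrix_equiv e.symm).1 this

theorem cfc_psd {n : Type*} [Fintype n] [DecidableEq n] {g : ℝ → ℝ} {X : Matrix n n ℂ}
    (hX : X.IsHermitian) (h : ∀ i, 0 ≤ g (hX.eigenvalues i)) : (cfc g X).PosSemidef := by
  rw [hX.cfc_eq, Matrix.IsHermitian.cfc, Unitary.conjStarAlgAut_apply, star_eq_conjTranspose]
  apply PosSemidef.mul_mul_conjTranspose_same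
  apply PosSemidef.diagonal
  intro i
  simpa using h i

theorem smul_one_psd {n : Type*} [Fintype n] [DecidableEq n] {r : ℝ} (hr : 0 ≤ r) :
    (r • (1 : Matrix n n ℂ)).PosSemidef := PosSemidef.one.smul hr

theorem cfc_sub_const {n : Type*} [Fintype n] [DecidableEq n] {X : Matrix n n ℂ}
    (hX : X.IsHermitian) (m : ℝ) : cfc (fun x => m - x) X = m • 1 - X := by
  have hX' : IsSelfAdjoint X := hX
  rw [cfc_sub (fun _ => m) (fun x => x) X (cont_spec _ _) (cont_spec _ _), cfc_const m X,
    cfc_id' ℝ X, Algebra.algebraMap_eq_smul_one]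

theorem cfc_add_shift {n : Type*} [Fintype n] [DecidableEq n] {X : Matrix n n ℂ}
    (hX : X.IsHermitian) (f : ℝ → ℝ) (m : ℝ) : cfc f (X + m • 1) = cfc (fun x => f (x + m)) X := by
  have hX' : IsSelfAdjoint X := hX
  have h1 : cfc (fun x => x + m) X = X + m • 1 := by
    rw [cfc_add (a := X) (fun x => x) (fun _ => m) (cont_spec _ _) (cont_spec _ _), cfc_const m X,
      cfc_id' ℝ X, Algebra.algebraMap_eq_smul_one]
  rw [← h1, ← cfc_comp' f (fun x => x + m) X
    ((Matrix.finite_real_spectrum.image _).continuousOn f) (cont_spec _ _)]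

theorem cfc_smul_one {n : Type*} [Fintype n] [DecidableEq n] 
    (f : ℝ → ℝ) (m : ℝ) : cfc f (m • (1 : Matrix n n ℂ)) = f m • 1 := by
  rw [← Algebra.algebraMap_eq_smul_one, ← Algebra.algebraMap_eq_smul_one, cfc_algebraMap]

theorem exists_bound {n : Type*} [Fintype n] [DecidableEq n] {X : Matrix n n ℂ}
    (hX : X.IsHermitian) : ∃ m : ℝ, 0 < m ∧ ∀ m', m ≤ m' → (m' • 1 - X).PosSemidef := by
  refine ⟨1 + ∑ i, |hX.eigenvalues i|, by positivity, fun m' hm => ?_⟩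
  rw [← cfc_sub_const hX]
  apply cfc_psd hX
  intro i
  have := Finset.single_le_sum (f := fun i => |hX.eigenvalues i|) (fun i _ => abs_nonneg _)
    (Finset.mem_univ i)
  have h2 := le_abs_self (hX.eigenvalues i)
  linarith

theorem blk_psd {n m : Type*} [Fintype n] [DecidableEq n] [Fintype m] [DecidableEq m]
    {X : Matrix n n ℂ} {Y : Matrix m m ℂ} (hX : X.PosSemidef) (hY : Y.PosSemidef) :
    (fromBlocks X 0 0 Y).PosSemidef := by
  refine PosSemidef.of_dotProduct_mulVec_nonneg (hX.1.fromBlocks (by simp) hY.1) fun x => ?_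
  have h1 := hX.dotProduct_mulVec_nonneg (x ∘ Sum.inl)
  have h2 := hY.dotProduct_mulVec_nonneg (x ∘ Sum.inr)
  convert add_nonneg h1 h2 using 1
  simp [fromBlocks_mulVec, dotProduct, Fintype.sum_sum_type]

/-- weak operator concavity (Hansen's dilation trick) -/
theorem weak_concave {f : ℝ → ℝ} (hf : OperatorMonotone f)
    {n : Type*} [Fintype n] [DecidableEq n] {X Y : Matrix n n ℂ} (hX : X.PosSemidef)
    (hY : Y.PosSemidef) (a b : ℝ) (hab : a ^ 2 + b ^ 2 = 1) (ε : ℝ) (hε : 0 < ε) :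
    (cfc f (a ^ 2 • X + b ^ 2 • Y + ε • 1) - (a ^ 2 • cfc f X + b ^ 2 • cfc f Y)).PosSemidef := by
  have hconj : ∀ P Q : Matrix n n ℂ,
      (fromBlocks (a • 1) (b • 1) (-b • 1) (a • 1) : Matrix (n ⊕ n) (n ⊕ n) ℂ)
        * fromBlocks P 0 0 Q
        * (fromBlocks (a • 1) (-b • 1) (b • 1) (a • 1) : Matrix (n ⊕ n) (n ⊕ n) ℂ) =
      fromBlocks (a ^ 2 • P + b ^ 2 • Q) ((a * b) • (Q - P)) ((a * b) • (Q - P))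
        (b ^ 2 • P + a ^ 2 • Q) := by
    intro P Q
    simp only [fromBlocks_multiply]
    congr 1 <;> simp [smul_smul] <;> module
  set U : Matrix (n ⊕ n) (n ⊕ n) ℂ := fromBlocks (a • 1) (b • 1) (-b • 1) (a • 1) with hU
  set V : Matrix (n ⊕ n) (n ⊕ n) ℂ := fromBlocks (a • 1) (-b • 1) (b • 1) (a • 1) with hV
  have hUV : U * V = 1 := by
    have := hconj 1 1
    rw [fromBlocks_one, mul_one] at this
    rw [this, ← fromBlocks_one]
    congr 1
    · rw [← add_smul, hab, one_smul]
    · simp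
    · simp
    · rw [← add_smul, add_comm, hab, one_smul]
  have hVU : V * U = 1 := mul_eq_one_comm.1 hUV
  have hVstar : Uᴴ = V := by
    rw [hU, hV, fromBlocks_conjTranspose]
    congr 1 <;> simp
  let φ : Matrix (n ⊕ n) (n ⊕ n) ℂ →ₐ[ℝ] Matrix (n ⊕ n) (n ⊕ n) ℂ :=
    { toFun := fun Z => U * Z * V
      map_one' := by rw [mul_one, hUV]
      map_mul' := fun x y => by
        calc U * (x * y) * V = U * x * 1 * y * V := by simp only [mul_assoc, mul_one]
          _ = _ := by rw [← hVU]; simp only [mul_assoc]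
      map_zero' := by simp
      map_add' := fun x y => by rw [mul_add, add_mul]
      commutes' := fun r => by
        simp only [Algebra.algebraMap_eq_smul_one, mul_smul_comm, smul_mul_assoc, mul_one, hUV] }
  have hφ : ∀ Z, φ Z = U * Z * V := fun Z => rfl
  have hblk : (fromBlocks X 0 0 Y).PosSemidef := by
    exact blk_psd hX hY
  have hφpsd : (φ (fromBlocks X 0 0 Y)).PosSemidef := by
    rw [hφ, ← hVstar]; exact hblk.mul_mul_conjTranspose_same U
  set Z := a ^ 2 • X + b ^ 2 • Y with hZ
  set D := (a * b) • (Y - X) with hD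
  set W := b ^ 2 • X + a ^ 2 • Y with hW
  have hZp : Z.PosSemidef := (hX.smul (sq_nonneg a)).add (hY.smul (sq_nonneg b))
  have hDh : D.IsHermitian := by
    have := (hY.1.sub hX.1)
    rw [IsHermitian, hD, conjTranspose_smul, this.eq]; simp
  have hWp : W.PosSemidef := (hX.smul (sq_nonneg b)).add (hY.smul (sq_nonneg a))
  have hφ1 : φ (fromBlocks X 0 0 Y) = fromBlocks Z D D W := by rw [hφ, hconj]
  obtain ⟨m, hm, hmb⟩ := exists_bound (X := W + ε⁻¹ • (D * D)) (by
    refine hWp.1.add ?_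
    rw [IsHermitian, conjTranspose_smul, conjTranspose_mul, hDh.eq]; simp)
  have hεp : (ε • (1 : Matrix n n ℂ)).PosDef := PosDef.one.smul hε
  have hdiff : (fromBlocks (Z + ε • 1) 0 0 (m • 1) - fromBlocks Z D D W).PosSemidef := by
    have e1 : fromBlocks (Z + ε • 1) 0 0 (m • 1) - fromBlocks Z D D W =
        fromBlocks (ε • 1) (-D) (-D)ᴴ (m • 1 - W) := by
      rw [sub_eq_add_neg, fromBlocks_neg, fromBlocks_add]
      congr 1
      · abel
      · simp
      · simp [hDh.eq]
    rw [e1]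
    have : Invertible (ε • (1 : Matrix n n ℂ)) := hεp.isUnit.invertible
    rw [PosDef.fromBlocks₁₁ _ _ hεp]
    have e2 : (ε • (1 : Matrix n n ℂ))⁻¹ = ε⁻¹ • 1 := by
      apply Matrix.inv_eq_right_inv
      simp [smul_smul, hε.ne']
    have e3 : m • 1 - W - (-D)ᴴ * (ε • (1 : Matrix n n ℂ))⁻¹ * (-D) =
        m • 1 - (W + ε⁻¹ • (D * D)) := by
      rw [e2]
      simp [hDh.eq]
      abel
    rw [e3]
    exact hmb m le_rfl
  have hZε : (Z + ε • 1).PosSemidef := hZp.add hεp.posSemidef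
  have hbig : (fromBlocks (Z + ε • 1) 0 0 (m • (1 : Matrix n n ℂ))).PosSemidef := by
    have := hdiff.add (hφ1 ▸ hφpsd)
    simpa using this
  have hfin := opmono hf hφpsd hbig (hφ1 ▸ hdiff)
  rw [map_cfc φ f hblk.1 hφpsd.1, cfc_fromBlocks f hX.1 hY.1, hφ, hconj,
    cfc_fromBlocks f hZε.1 (smul_one_psd hm.le).1] at hfin
  have := hfin.submatrix (Sum.inl : n → n ⊕ n)
  convert this using 1
  ext i j
  simp

theorem trace_pair {n : Type*} [Fintype n] [DecidableEq n] {X Y : Matrix n n ℂ}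
    (hX : X.IsHermitian) (hY : Y.IsHermitian) : ∃ w : n → n → ℝ, (∀ i j, 0 ≤ w i j) ∧
      ∀ p q : ℝ → ℝ, (trace (cfc p X * cfc q Y)).re =
        ∑ i, ∑ j, w i j * (p (hX.eigenvalues i) * q (hY.eigenvalues j)) := by
  set U : Matrix n n ℂ := (hX.eigenvectorUnitary : Matrix n n ℂ) with hU
  set V : Matrix n n ℂ := (hY.eigenvectorUnitary : Matrix n n ℂ) with hV
  refine ⟨fun i j => Complex.normSq ((Uᴴ * V) i j), fun i j => Complex.normSq_nonneg _, ?_⟩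
  intro p q
  rw [hX.cfc_eq, hY.cfc_eq, Matrix.IsHermitian.cfc, Matrix.IsHermitian.cfc,
    Unitary.conjStarAlgAut_apply, Unitary.conjStarAlgAut_apply]
  simp only [Unitary.coe_star, star_eq_conjTranspose]
  change (trace (U * diagonal _ * Uᴴ * (V * diagonal _ * Vᴴ))).re = _
  have : ∀ D E : Matrix n n ℂ, trace (U * D * Uᴴ * (V * E * Vᴴ)) =
      trace ((D * (Uᴴ * V)) * (E * (Uᴴ * V)ᴴ)) := by
    intro D E
    rw [conjTranspose_mul, conjTranspose_conjTranspose, mul_assoc, mul_assoc, trace_mul_comm]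
    simp only [mul_assoc]
  rw [this]
  simp only [trace, diag, mul_apply (M := diagonal _ * _), diagonal_mul, conjTranspose_apply,
    Complex.re_sum]
  refine Finset.sum_congr rfl fun i _ => Finset.sum_congr rfl fun j _ => ?_
  simp [Complex.normSq_apply]
  ring

theorem cfc_self {n : Type*} [Fintype n] [DecidableEq n] {X : Matrix n n ℂ}
    (hX : X.IsHermitian) : cfc (fun x : ℝ => x) X = X := by
  have hX' : IsSelfAdjoint X := hX
  exact cfc_id' ℝ X

theorem cfc_one' {n : Type*} [Fintype n] [DecidableEq n] {X : Matrix n n ℂ}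
    (hX : X.IsHermitian) : cfc (fun _ : ℝ => (1 : ℝ)) X = 1 := by
  have hX' : IsSelfAdjoint X := hX
  exact cfc_const_one ℝ X

theorem cfc_herm {n : Type*} [Fintype n] [DecidableEq n] (f : ℝ → ℝ) (X : Matrix n n ℂ) :
    (cfc f X).IsHermitian := cfc_predicate (p := IsSelfAdjoint) f X

/-- trace pairing with a psd matrix is monotone -/
theorem tr_nonneg {n : Type*} [Fintype n] [DecidableEq n] {P Q : Matrix n n ℂ}
    (hP : P.PosSemidef) (hQ : Q.PosSemidef) : 0 ≤ (trace (P * Q)).re := by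
  obtain ⟨w, hw, h⟩ := trace_pair hP.1 hQ.1
  have := h (fun x => x) (fun x => x)
  rw [cfc_self hP.1, cfc_self hQ.1] at this
  rw [this]
  refine Finset.sum_nonneg fun i _ => Finset.sum_nonneg fun j _ => mul_nonneg (hw i j)
    (mul_nonneg (hP.eigenvalues_nonneg i) (hQ.eigenvalues_nonneg j))

theorem tr_mono {n : Type*} [Fintype n] [DecidableEq n] {P X Y : Matrix n n ℂ}
    (hP : P.PosSemidef) (h : (Y - X).PosSemidef) : (trace (P * X)).re ≤ (trace (P * Y)).re := by
  have := tr_nonneg hP h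
  rw [mul_sub, trace_sub, Complex.sub_re] at this
  linarith

theorem tr_im {n : Type*} [Fintype n] [DecidableEq n] {P X : Matrix n n ℂ}
    (hP : P.IsHermitian) (hX : X.IsHermitian) : (trace (P * X)).im = 0 := by
  have h : star (trace (P * X)) = trace (P * X) := by
    rw [← trace_conjTranspose, conjTranspose_mul, hP.eq, hX.eq, trace_mul_comm]
  exact Complex.conj_eq_iff_im.1 h

/-- Klein's inequality -/
theorem klein {n : Type*} [Fintype n] [DecidableEq n] {f F : ℝ → ℝ}
    (hF : ∀ x y, 0 ≤ x → 0 ≤ y → f x * (y - x) ≤ F y - F x) {X Y : Matrix n n ℂ}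
    (hX : X.PosSemidef) (hY : Y.PosSemidef) :
    (trace ((Y - X) * cfc f X)).re ≤ (trace (cfc F Y)).re - (trace (cfc F X)).re := by
  obtain ⟨w, hw, h⟩ := trace_pair hX.1 hY.1
  have e1 : (trace (cfc F Y)).re = (trace (cfc (fun _ => (1:ℝ)) X * cfc F Y)).re := by
    rw [cfc_one' hX.1, one_mul]
  have e2 : (trace (cfc F X)).re = (trace (cfc F X * cfc (fun _ => (1:ℝ)) Y)).re := by
    rw [cfc_one' hY.1, mul_one]
  have e3 : (trace (Y * cfc f X)).re = (trace (cfc f X * cfc (fun x : ℝ => x) Y)).re := by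
    rw [cfc_self hY.1, trace_mul_comm]
  have e4 : (trace (X * cfc f X)).re =
      (trace (cfc (fun x => x * f x) X * cfc (fun _ => (1:ℝ)) Y)).re := by
    rw [cfc_one' hY.1, mul_one]
    rw [cfc_mul (fun x : ℝ => x) f X (cont_spec _ _) (cont_spec _ _), cfc_self hX.1]
  rw [sub_mul, trace_sub, Complex.sub_re, e1, e2, e3, e4]
  simp only [h, ← Finset.sum_sub_distrib, ← mul_sub]
  refine Finset.sum_le_sum fun i _ => Finset.sum_le_sum fun j _ =>
    mul_le_mul_of_nonneg_left ?_ (hw i j)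
  have := hF _ _ (hX.eigenvalues_nonneg i) (hY.eigenvalues_nonneg j)
  linarith

theorem scalar_mono {f : ℝ → ℝ} (hf : OperatorMonotone f) {x y : ℝ} (hx : 0 ≤ x) (hxy : x ≤ y) :
    f x ≤ f y := by
  have h := opmono hf (n := Unit) (smul_one_psd hx) (smul_one_psd (hx.trans hxy))
    (by rw [← sub_smul]; exact smul_one_psd (sub_nonneg.2 hxy))
  rw [cfc_smul_one, cfc_smul_one, ← sub_smul] at h
  have := h.diag_nonneg (i := ())
  simpa using (Complex.le_def.1 this).1

theorem scalar_ratio {f : ℝ → ℝ} (hf : OperatorMonotone f) (hf0 : f 0 = 0)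
    {x y : ℝ} (hx : 0 < x) (hxy : x ≤ y) : x * f y ≤ y * f x := by
  have hy : 0 < y := hx.trans_le hxy
  have key : ∀ η, 0 < η → η < x → (x - η) * f y ≤ y * f x := by
    intro η h0 h1
    set a := Real.sqrt ((x - η) / y)
    set b := Real.sqrt (1 - (x - η) / y)
    have hr : (x - η) / y ≤ 1 := by rw [div_le_one hy]; linarith
    have ha : a ^ 2 = (x - η) / y := Real.sq_sqrt (div_nonneg (by linarith) hy.le)
    have hb : b ^ 2 = 1 - (x - η) / y := Real.sq_sqrt (by linarith)
    have h := weak_concave hf (n := Unit) (smul_one_psd hy.le) (smul_one_psd le_rfl) a b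
      (by rw [ha, hb]; ring) η h0
    rw [smul_smul, smul_smul, ← add_smul, ← add_smul, cfc_smul_one, cfc_smul_one, cfc_smul_one,
      smul_smul, smul_smul, ← add_smul, ← sub_smul, hf0, ha] at h
    have h2 := h.diag_nonneg (i := ())
    have h3 : 0 ≤ f ((x - η) / y * y + b ^ 2 * 0 + η) - ((x - η) / y * f y + b ^ 2 * 0) := by
      simpa using (Complex.le_def.1 h2).1
    rw [div_mul_cancel₀ _ hy.ne', mul_zero, add_zero, add_zero, sub_add_cancel, div_mul_eq_mul_div,
      sub_nonneg, div_le_iff₀ hy] at h3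
    linarith
  have ht : Filter.Tendsto (fun η : ℝ => (x - η) * f y) (nhdsWithin 0 (Set.Ioi 0))
      (nhds ((x - 0) * f y)) :=
    ((by fun_prop : Continuous fun η : ℝ => (x - η) * f y).tendsto 0).mono_left nhdsWithin_le_nhds
  have := le_of_tendsto ht (b := y * f x) (by
    filter_upwards [Ioo_mem_nhdsGT hx] with η hη using key η hη.1 hη.2)
  simpa using this

theorem scalar_subadd {f : ℝ → ℝ} (hf : OperatorMonotone f) (hf0 : f 0 = 0)
    {x y : ℝ} (hx : 0 ≤ x) (hy : 0 ≤ y) : f (x + y) ≤ f x + f y := by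
  rcases hx.eq_or_lt with rfl | hx
  · simp [hf0]
  rcases hy.eq_or_lt with rfl | hy
  · simp [hf0]
  have h1 := scalar_ratio hf hf0 hx (show x ≤ x + y by linarith)
  have h2 := scalar_ratio hf hf0 hy (show y ≤ x + y by linarith)
  have : (x + y) * f (x + y) ≤ (x + y) * (f x + f y) := by linarith
  exact le_of_mul_le_mul_left this (by linarith)

theorem exists_primitive {f : ℝ → ℝ} (hf : OperatorMonotone f) :
    ∃ F : ℝ → ℝ, Continuous F ∧ ∀ x y, 0 ≤ x → 0 ≤ y → f x * (y - x) ≤ F y - F x := by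
  set g : ℝ → ℝ := fun x => f (max x 0)
  have hg : Monotone g := fun x y h => scalar_mono hf (le_max_right _ _) (max_le_max_right 0 h)
  have hi : ∀ a b, IntervalIntegrable g MeasureTheory.volume a b :=
    fun a b => hg.intervalIntegrable
  refine ⟨fun x => ∫ t in (0:ℝ)..x, g t, intervalIntegral.continuous_primitive hi 0, ?_⟩
  intro x y hx hy
  have hgx : g x = f x := by simp [g, hx]
  rw [intervalIntegral.integral_interval_sub_left (hi _ _) (hi _ _), ← hgx]
  rcases le_total x y with h | h
  · have := intervalIntegral.integral_mono_on h (by simp) (hi x y)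
      (f := fun _ => g x) (fun t ht => hg ht.1)
    simp at this
    linarith
  · rw [intervalIntegral.integral_symm]
    have := intervalIntegral.integral_mono_on h (hi y x) (by simp)
      (g := fun _ => g x) (fun t ht => hg ht.2)
    simp at this
    linarith

/-- trace functional -/
noncomputable def Phi {n : Type*} [Fintype n] [DecidableEq n] (F : ℝ → ℝ) (X : Matrix n n ℂ) : ℝ :=
  (trace (cfc F X)).re

theorem Phi_cont {n : Type*} [Fintype n] [DecidableEq n] {F : ℝ → ℝ} (hF : Continuous F)
    {X : Matrix n n ℂ} (hX : X.IsHermitian) : Continuous fun γ : ℝ => Phi F (X + γ • 1) := by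
  obtain ⟨w, -, h⟩ := trace_pair hX hX
  have : ∀ γ : ℝ, Phi F (X + γ • 1) = ∑ i, ∑ j, w i j * (F (hX.eigenvalues i + γ) * 1) := by
    intro γ
    have := h (fun x => F (x + γ)) (fun _ => 1)
    rw [cfc_one' hX, mul_one] at this
    rw [Phi, cfc_add_shift hX, this]
  simp only [this]
  fun_prop

theorem step {f F : ℝ → ℝ} (hf : OperatorMonotone f)
    (hF : ∀ x y, 0 ≤ x → 0 ≤ y → f x * (y - x) ≤ F y - F x)
    {n : Type*} [Fintype n] [DecidableEq n] {X H K : Matrix n n ℂ} (hX : X.PosSemidef)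
    (hH : H.PosSemidef) (hK : K.PosSemidef) {γ η : ℝ} (hη : 0 < η) (hγ : 0 ≤ γ)
    (hb : (γ • 1 - (K + η • 1)).PosSemidef) :
    (Phi F (X + K) - Phi F X) + (Phi F (X + (H + H) + K) - Phi F (X + (H + H))) ≤
      2 * (Phi F (X + H + γ • 1 + K) - Phi F (X + H + γ • 1)) := by
  have hX2 := hX.add (hH.add hH)
  have hXK := hX.add hK
  have hX2K := hX2.add hK
  have k1 := klein hF hXK hX
  have k2 := klein hF hX2K hX2
  have hs : (Real.sqrt (1/2)) ^ 2 = 1/2 := Real.sq_sqrt (by norm_num)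
  have c := weak_concave hf hXK hX2K (Real.sqrt (1/2)) (Real.sqrt (1/2)) (by rw [hs]; norm_num) η hη
  rw [hs] at c
  have e : (1/2 : ℝ) • (X + K) + (1/2 : ℝ) • (X + (H + H) + K) = X + H + K := by module
  rw [e] at c
  have c2 := tr_mono hK c
  have hg := (hX.add hH).add (smul_one_psd (n := n) hγ)
  have m := tr_mono hK (opmono hf ((hX.add hH).add hK |>.add (smul_one_psd hη.le)) hg (by
    convert hb using 1; abel))
  have k3 := klein hF hg (hg.add hK)
  rw [show X - (X + K) = -K by abel, neg_mul, trace_neg, Complex.neg_re] at k1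
  rw [show X + (H + H) - (X + (H + H) + K) = -K by abel, neg_mul, trace_neg, Complex.neg_re] at k2
  rw [add_sub_cancel_left] at k3
  simp only [mul_add, mul_smul_comm, trace_add, trace_smul, Complex.add_re, Complex.smul_re,
    smul_eq_mul] at c2
  simp only [Phi]
  linarith

theorem step_sum {f F : ℝ → ℝ} (hf : OperatorMonotone f)
    (hF : ∀ x y, 0 ≤ x → 0 ≤ y → f x * (y - x) ≤ F y - F x)
    {n : Type*} [Fintype n] [DecidableEq n] {X H K : Matrix n n ℂ} (hX : X.PosSemidef)
    (hH : H.PosSemidef) (hK : K.PosSemidef) {γ η : ℝ} (hη : 0 < η) (hγ : 0 ≤ γ)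
    (hb : (γ • 1 - (K + η • 1)).PosSemidef) (j : ℕ) :
    (Phi F (X + (j : ℝ) • K) - Phi F X) +
      (Phi F (X + (H + H) + (j : ℝ) • K) - Phi F (X + (H + H))) ≤
      2 * (Phi F (X + H + γ • 1 + (j : ℝ) • K) - Phi F (X + H + γ • 1)) := by
  induction j with
  | zero => simp
  | succ j ih =>
    have hj : ((j : ℝ) • K).PosSemidef := hK.smul (Nat.cast_nonneg j)
    have := step hf hF (hX.add hj) hH hK hη hγ hb
    rw [show X + (j : ℝ) • K + K = X + ((j + 1 : ℕ) : ℝ) • K by push_cast; module,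
      show X + (j : ℝ) • K + (H + H) + K = X + (H + H) + ((j + 1 : ℕ) : ℝ) • K by
        push_cast; module,
      show X + (j : ℝ) • K + (H + H) = X + (H + H) + (j : ℝ) • K by module,
      show X + (j : ℝ) • K + H + γ • 1 + K = X + H + γ • 1 + ((j + 1 : ℕ) : ℝ) • K by
        push_cast; module,
      show X + (j : ℝ) • K + H + γ • 1 = X + H + γ • 1 + (j : ℝ) • K by module] at this
    linarith

theorem W_concave {f F : ℝ → ℝ} (hf : OperatorMonotone f) (hFc : Continuous F)
    (hF : ∀ x y, 0 ≤ x → 0 ≤ y → f x * (y - x) ≤ F y - F x)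
    {n : Type*} [Fintype n] [DecidableEq n] {X H B : Matrix n n ℂ} (hX : X.PosSemidef)
    (hH : H.PosSemidef) (hB : B.PosSemidef) :
    (Phi F (X + B) - Phi F X) + (Phi F (X + (H + H) + B) - Phi F (X + (H + H))) ≤
      2 * (Phi F (X + H + B) - Phi F (X + H)) := by
  obtain ⟨β, hβ, hbd⟩ := exists_bound hB.1
  have key : ∀ N : ℕ,
      (Phi F (X + B) - Phi F X) + (Phi F (X + (H + H) + B) - Phi F (X + (H + H))) ≤
      2 * (Phi F (X + H + B + ((β + 1) * (1 / ((N : ℝ) + 1))) • 1) -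
        Phi F (X + H + ((β + 1) * (1 / ((N : ℝ) + 1))) • 1)) := by
    intro N
    have hN : (0 : ℝ) < 1 / ((N : ℝ) + 1) := by positivity
    have := step_sum hf hF (K := (1 / ((N : ℝ) + 1)) • B) hX hH (hB.smul hN.le)
      (γ := (β + 1) * (1 / ((N : ℝ) + 1))) hN (by positivity) (by
        convert (hbd β le_rfl).smul hN.le using 1
        module) (N + 1)
    rw [show ((N + 1 : ℕ) : ℝ) • (1 / ((N : ℝ) + 1)) • B = B by
      rw [smul_smul]; push_cast; rw [mul_one_div_cancel (by positivity), one_smul],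
      show X + H + ((β + 1) * (1 / ((N : ℝ) + 1))) • 1 + B =
        X + H + B + ((β + 1) * (1 / ((N : ℝ) + 1))) • 1 by abel] at this
    exact this
  have hXH := hX.add hH
  have hc : Continuous fun γ : ℝ => 2 * (Phi F (X + H + B + γ • 1) - Phi F (X + H + γ • 1)) :=
    continuous_const.mul ((Phi_cont hFc (hXH.add hB).1).sub (Phi_cont hFc hXH.1))
  have ht : Filter.Tendsto (fun N : ℕ => (β + 1) * (1 / ((N : ℝ) + 1))) Filter.atTop
      (nhds ((β + 1) * 0)) := tendsto_one_div_add_atTop_nhds_zero_nat.const_mul _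
  rw [mul_zero] at ht
  have := ge_of_tendsto' ((hc.tendsto 0).comp ht) key
  simpa using this

theorem W_diff {f F : ℝ → ℝ} (hf : OperatorMonotone f) (hFc : Continuous F)
    (hF : ∀ x y, 0 ≤ x → 0 ≤ y → f x * (y - x) ≤ F y - F x)
    {n : Type*} [Fintype n] [DecidableEq n] {X H B : Matrix n n ℂ} (hX : X.PosSemidef)
    (hH : H.PosSemidef) (hB : B.PosSemidef) (k : ℕ) :
    (Phi F (X + (k : ℝ) • H + H + B) - Phi F (X + (k : ℝ) • H + H)) -
      (Phi F (X + (k : ℝ) • H + B) - Phi F (X + (k : ℝ) • H)) ≤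
    (Phi F (X + H + B) - Phi F (X + H)) - (Phi F (X + B) - Phi F X) := by
  induction k with
  | zero => simp
  | succ k ih =>
    have hk : ((k : ℝ) • H).PosSemidef := hH.smul (Nat.cast_nonneg k)
    have := W_concave hf hFc hF (hX.add hk) hH hB
    rw [show X + ((k + 1 : ℕ) : ℝ) • H + H = X + (k : ℝ) • H + (H + H) by push_cast; module,
      show X + ((k + 1 : ℕ) : ℝ) • H = X + (k : ℝ) • H + H by push_cast; module]
    linarith

theorem main_ineq {f : ℝ → ℝ} (hf : OperatorMonotone f)
    {n : Type*} [Fintype n] [DecidableEq n] {X C B : Matrix n n ℂ} (hX : X.PosSemidef)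
    (hC : C.PosSemidef) (hB : B.PosSemidef) (N : ℕ) :
    (trace (C * cfc f (X + C + B))).re + (trace (C * cfc f X)).re ≤
      (trace (C * cfc f (X + (1 / ((N : ℝ) + 1)) • C + B))).re +
      (trace (C * cfc f (X + C + (1 / ((N : ℝ) + 1)) • C))).re := by
  obtain ⟨F, hFc, hF⟩ := exists_primitive hf
  have hN : (0 : ℝ) < 1 / ((N : ℝ) + 1) := by positivity
  set r := 1 / ((N : ℝ) + 1) with hr
  have hH : (r • C).PosSemidef := hC.smul hN.le
  have d := W_diff hf hFc hF hX hH hB (N + 1)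
  rw [show ((N + 1 : ℕ) : ℝ) • r • C = C by
      rw [smul_smul, hr]; push_cast; rw [mul_one_div_cancel (by positivity), one_smul]] at d
  have k1 := klein hF (hX.add hC |>.add hB) (hX.add hC |>.add hH |>.add hB)
  have k2 := klein hF (hX.add hC |>.add hH) (hX.add hC)
  have k3 := klein hF (hX.add hH |>.add hB) (hX.add hB)
  have k4 := klein hF hX (hX.add hH)
  rw [show X + C + r • C + B - (X + C + B) = r • C by abel] at k1
  rw [show X + C - (X + C + r • C) = -(r • C) by abel] at k2
  rw [show X + B - (X + r • C + B) = -(r • C) by abel] at k3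
  rw [add_sub_cancel_left] at k4
  simp only [Phi] at d
  simp only [neg_mul, trace_neg, Complex.neg_re, smul_mul_assoc, trace_smul, Complex.smul_re,
    smul_eq_mul] at k1 k2 k3 k4
  refine le_of_mul_le_mul_left ?_ hN
  rw [mul_add, mul_add]
  linarith

theorem delta_ineq {f : ℝ → ℝ} (hf : OperatorMonotone f) (hf0 : f 0 = 0)
    (hfnn : ∀ x, 0 ≤ x → 0 ≤ f x)
    {n : Type*} [Fintype n] [DecidableEq n] {C B : Matrix n n ℂ} 
    (hC : C.PosSemidef) (hB : B.PosSemidef) {δ : ℝ} (hδ : 0 < δ) :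
    (trace (C * cfc f (B + C))).re ≤ (trace (C * cfc f B)).re + (trace (C * cfc f C)).re +
      ((f (δ + δ) - f δ) * (trace C).re + (δ + δ) * ∑ i, f (hC.1.eigenvalues i)) := by
  obtain ⟨m, hm, hbd⟩ := exists_bound hC.1
  obtain ⟨N, hN⟩ := exists_nat_one_div_lt (div_pos hδ hm)
  have hN0 : (0 : ℝ) < 1 / ((N : ℝ) + 1) := by positivity
  have hd : (δ • (1 : Matrix n n ℂ)).PosSemidef := smul_one_psd hδ.le
  have hdd : ((δ + δ) • (1 : Matrix n n ℂ)).PosSemidef := smul_one_psd (by linarith)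
  have main := main_ineq hf hd hC hB N
  set r := 1 / ((N : ℝ) + 1) with hr
  have hH : (r • C).PosSemidef := hC.smul hN0.le
  have hrC : (δ • 1 - r • C).PosSemidef := by
    have h1 := (hbd m le_rfl).smul hN0.le
    have h2 : ((δ - r * m) • (1 : Matrix n n ℂ)).PosSemidef :=
      smul_one_psd (by rw [lt_div_iff₀ hm] at hN; linarith)
    convert h1.add h2 using 1
    module
  have a1 := tr_mono hC (opmono hf (hB.add hC) (hd.add hC |>.add hB)
    (by convert hd using 1; abel))
  have a2 := tr_mono hC (opmono hf (hd.add hH |>.add hB) (hB.add hdd)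
    (by convert hrC using 1; module))
  have a3 := tr_mono hC (opmono hf (hd.add hC |>.add hH) (hC.add hdd)
    (by convert hrC using 1; module))
  have a4 : (trace (C * cfc f (B + (δ + δ) • 1))).re ≤
      (trace (C * cfc f B)).re + f (δ + δ) * (trace C).re := by
    obtain ⟨w, hw, h⟩ := trace_pair hC.1 hB.1
    have e1 := h (fun x => x) (fun x => f (x + (δ + δ)))
    have e2 := h (fun x => x) f
    have e3 := h (fun x => x) (fun _ => 1)
    rw [cfc_self hC.1] at e1 e2 e3
    rw [cfc_one' hB.1, mul_one] at e3
    rw [cfc_add_shift hB.1, e1, e2, e3, Finset.mul_sum, ← Finset.sum_add_distrib]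
    refine Finset.sum_le_sum fun i _ => ?_
    rw [Finset.mul_sum, ← Finset.sum_add_distrib]
    refine Finset.sum_le_sum fun j _ => ?_
    have s := scalar_subadd hf hf0 (hB.eigenvalues_nonneg j) (show 0 ≤ δ + δ by linarith)
    have := mul_le_mul_of_nonneg_left s (mul_nonneg (hw i j) (hC.eigenvalues_nonneg i))
    linarith
  have tr_sum : ∀ g : ℝ → ℝ, (trace (C * cfc g C)).re =
      ∑ i, hC.1.eigenvalues i * g (hC.1.eigenvalues i) := by
    intro g
    have : C * cfc g C = cfc (fun x : ℝ => x * g x) C := by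
      rw [cfc_mul (fun x : ℝ => x) g C (cont_spec _ _) (cont_spec _ _), cfc_self hC.1]
    rw [this, hC.1.cfc_eq, Matrix.IsHermitian.cfc, Unitary.conjStarAlgAut_apply, trace_mul_comm,
      ← mul_assoc]
    simp [trace]
  have a5 : (trace (C * cfc f (C + (δ + δ) • 1))).re ≤
      (trace (C * cfc f C)).re + (δ + δ) * ∑ i, f (hC.1.eigenvalues i) := by
    rw [cfc_add_shift hC.1, tr_sum, tr_sum, Finset.mul_sum, ← Finset.sum_add_distrib]
    refine Finset.sum_le_sum fun i _ => ?_
    rcases (hC.eigenvalues_nonneg i).eq_or_lt with h | h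
    · rw [← h, hf0]; simp
    · have := scalar_ratio hf hf0 h (show _ ≤ hC.1.eigenvalues i + (δ + δ) by linarith)
      linarith
  have a6 : (trace (C * cfc f (δ • (1 : Matrix n n ℂ)))).re = f δ * (trace C).re := by
    rw [cfc_smul_one, mul_smul_comm, mul_one, trace_smul, Complex.smul_re, smul_eq_mul]
  linarith

theorem final_ineq {f : ℝ → ℝ} (hf : OperatorMonotone f) (hf0 : f 0 = 0)
    (hfnn : ∀ x, 0 ≤ x → 0 ≤ f x)
    {n : Type*} [Fintype n] [DecidableEq n] {C B : Matrix n n ℂ}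
    (hC : C.PosSemidef) (hB : B.PosSemidef) :
    (trace (C * cfc f (B + C))).re ≤ (trace (C * cfc f B)).re + (trace (C * cfc f C)).re := by
  set g : ℝ → ℝ := fun x => f (max x 0)
  have hg : Monotone g := fun x y h => scalar_mono hf (le_max_right _ _) (max_le_max_right 0 h)
  have hl := hg.tendsto_nhdsGT 0
  set c := sInf (g '' Set.Ioi 0)
  have hfl : Filter.Tendsto f (nhdsWithin 0 (Set.Ioi 0)) (nhds c) :=
    hl.congr' (by
      filter_upwards [self_mem_nhdsWithin] with x hx
      simp [g, (Set.mem_Ioi.1 hx).le])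
  have hid : Filter.Tendsto (fun x : ℝ => x) (nhdsWithin 0 (Set.Ioi 0)) (nhds 0) :=
    tendsto_nhdsWithin_of_tendsto_nhds Filter.tendsto_id
  have hdd : Filter.Tendsto (fun x : ℝ => x + x) (nhdsWithin 0 (Set.Ioi 0)) (nhds 0) := by
    simpa using hid.add hid
  have hdd' : Filter.Tendsto (fun x : ℝ => x + x) (nhdsWithin 0 (Set.Ioi 0))
      (nhdsWithin 0 (Set.Ioi 0)) := by
    refine tendsto_nhdsWithin_iff.2 ⟨hdd, ?_⟩
    filter_upwards [self_mem_nhdsWithin] with x hx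
    exact Set.mem_Ioi.2 (add_pos (Set.mem_Ioi.1 hx) (Set.mem_Ioi.1 hx))
  have ht := (((hfl.comp hdd').sub hfl).mul_const (trace C).re).add
    (hdd.mul_const (∑ i, f (hC.1.eigenvalues i)))
  have ht2 := ht.const_add ((trace (C * cfc f B)).re + (trace (C * cfc f C)).re)
  have := ge_of_tendsto ht2 (b := (trace (C * cfc f (B + C))).re) (by
    filter_upwards [self_mem_nhdsWithin] with δ hδ
    exact delta_ineq hf hf0 hfnn hC hB hδ)
  simpa using this

end Stmt9

theorem stmt_9 {n : Type*} [Fintype n] [DecidableEq n] (f : ℝ → ℝ)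
    (hf : OperatorMonotone f) (hf0 : f 0 = 0) (hfnn : ∀ x, 0 ≤ x → 0 ≤ f x)
    (A B : Matrix n n ℂ) (hA : A.PosSemidef) (hB : B.PosSemidef)
    (hAB : (A - B).PosSemidef) :
    Matrix.trace ((A - B) * (cfc f A - cfc f B)) ≤
      Matrix.trace ((A - B) * cfc f (A - B)) := by
  rw [Complex.le_def]
  constructor
  · have h := Stmt9.final_ineq hf hf0 hfnn hAB hB
    rw [add_sub_cancel] at h
    rw [mul_sub, trace_sub, Complex.sub_re]
    linarith
  · rw [Stmt9.tr_im hAB.1 ((Stmt9.cfc_herm f A).sub (Stmt9.cfc_herm f B)),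
      Stmt9.tr_im hAB.1 (Stmt9.cfc_herm f _)]
end

section
/- Let f be a nonnegative operator convex function on [0,∞) with f(0) = 0. Then for any positive semidefinite n×n complex matrices A, B, Tr((A - B)(f(A) - f(B))) ≥ Tr(|A - B| f(|A - B|)). -/
open Matrix ComplexOrder

/-- `f` is operator convex on `[0, ∞)`: for positive semidefinite matrices `X, Y`
(of any size) and `t ∈ [0, 1]`, `f(tX + (1-t)Y) ≤ t f(X) + (1-t) f(Y)` in the Loewner order. -/
def OperatorConvex (f : ℝ → ℝ) : Prop :=
  ∀ (k : ℕ) (X Y : Matrix (Fin k) (Fin k) ℂ) (t : ℝ), X.PosSemidef → Y.PosSemidef →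
    0 ≤ t → t ≤ 1 →
    (t • cfc f X + (1 - t) • cfc f Y - cfc f (t • X + (1 - t) • Y)).PosSemidef

namespace Aux10

variable {n : Type*} [Fintype n] [DecidableEq n]

lemma contOn (f : ℝ → ℝ) (X : Matrix n n ℂ) : ContinuousOn f (spectrum ℝ X) :=
  (X.finite_real_spectrum).continuousOn f

lemma contOn_image (f g : ℝ → ℝ) (X : Matrix n n ℂ) : ContinuousOn f (g '' spectrum ℝ X) :=
  ((X.finite_real_spectrum).image g).continuousOn f

lemma sa {X : Matrix n n ℂ} (hX : X.PosSemidef) : IsSelfAdjoint X := hX.1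

/-- Joint spectral formula for the trace of a product. -/
lemma trace_formula (X Y : Matrix n n ℂ) (hX : X.IsHermitian) (hY : Y.IsHermitian) :
    ∃ w : n → n → ℝ, (∀ i j, 0 ≤ w i j) ∧ ∀ g h : ℝ → ℝ,
      (cfc g X * cfc h Y).trace.re =
        ∑ i, ∑ j, w i j * (g (hX.eigenvalues i) * h (hY.eigenvalues j)) := by
  set U : Matrix n n ℂ := (hX.eigenvectorUnitary : Matrix n n ℂ) with hU
  set V : Matrix n n ℂ := (hY.eigenvectorUnitary : Matrix n n ℂ) with hV
  refine ⟨fun i j => Complex.normSq ((star U * V) i j), fun i j => Complex.normSq_nonneg _, ?_⟩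
  intro g h
  rw [hX.cfc_eq, hY.cfc_eq, Matrix.IsHermitian.cfc, Matrix.IsHermitian.cfc,
    Unitary.conjStarAlgAut_apply, Unitary.conjStarAlgAut_apply, ← hU, ← hV]
  have e : (U * diagonal (RCLike.ofReal ∘ g ∘ hX.eigenvalues) * star U *
      (V * diagonal (RCLike.ofReal ∘ h ∘ hY.eigenvalues) * star V)).trace =
      (diagonal (RCLike.ofReal ∘ g ∘ hX.eigenvalues) * (star U * V) *
        (diagonal (RCLike.ofReal ∘ h ∘ hY.eigenvalues) * star (star U * V))).trace := by
    rw [star_mul, star_star, Matrix.mul_assoc, Matrix.mul_assoc, Matrix.trace_mul_comm]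
    simp only [Matrix.mul_assoc]
  rw [e, Matrix.trace, Complex.re_sum]
  refine Finset.sum_congr rfl fun i _ => ?_
  rw [Matrix.diag_apply, Matrix.mul_apply, Complex.re_sum]
  refine Finset.sum_congr rfl fun j _ => ?_
  rw [Matrix.diagonal_mul, Matrix.diagonal_mul, Matrix.star_apply]
  beta_reduce
  generalize (star U * V) i j = z
  simp [Complex.normSq_apply]
  ring

lemma trace_nonneg (P M : Matrix n n ℂ) (hP : P.PosSemidef) (hM : M.PosSemidef) :
    0 ≤ (P * M).trace.re := by
  obtain ⟨w, hw, H⟩ := trace_formula P M hP.1 hM.1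
  have h := H id id
  rw [cfc_id ℝ P (sa hP), cfc_id ℝ M (sa hM)] at h
  rw [h]
  exact Finset.sum_nonneg fun i _ => Finset.sum_nonneg fun j _ =>
    mul_nonneg (hw i j) (mul_nonneg (hP.eigenvalues_nonneg i) (hM.eigenvalues_nonneg j))

/-- Klein inequality. -/
lemma klein (F f : ℝ → ℝ) (hF : ∀ x y, 0 ≤ x → 0 ≤ y → (y - x) * f x ≤ F y - F x)
    (X Y : Matrix n n ℂ) (hX : X.PosSemidef) (hY : Y.PosSemidef) :
    ((Y - X) * cfc f X).trace.re ≤ (cfc F Y).trace.re - (cfc F X).trace.re := by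
  obtain ⟨w, hw, H⟩ := trace_formula Y X hY.1 hX.1
  have h1 := H F (fun _ => 1)
  have h2 := H (fun _ => 1) F
  have h3 := H id f
  have h4 := H (fun _ => 1) (fun x => x * f x)
  have e4 : cfc (fun x => x * f x) X = X * cfc f X := by
    rw [cfc_mul (fun x => x) f X (contOn _ _) (contOn _ _), cfc_id' ℝ X (sa hX)]
  rw [cfc_const_one ℝ X (sa hX), mul_one] at h1
  rw [cfc_const_one ℝ Y (sa hY), one_mul] at h2 h4
  rw [cfc_id ℝ Y (sa hY)] at h3
  rw [e4] at h4
  rw [sub_mul, Matrix.trace_sub, Complex.sub_re, h1, h2, h3, h4, ← Finset.sum_sub_distrib,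
    ← Finset.sum_sub_distrib]
  refine Finset.sum_le_sum fun i _ => ?_
  rw [← Finset.sum_sub_distrib, ← Finset.sum_sub_distrib]
  refine Finset.sum_le_sum fun j _ => ?_
  have := mul_le_mul_of_nonneg_left (hF _ _ (hX.eigenvalues_nonneg j) (hY.eigenvalues_nonneg i))
    (hw i j)
  simp only [id]
  linarith

lemma cfc_reindex {m : Type*} [Fintype m] [DecidableEq m] (e : n ≃ m) (f : ℝ → ℝ)
    (X : Matrix n n ℂ) (hX : X.IsHermitian) :
    cfc f (X.submatrix e.symm e.symm) = (cfc f X).submatrix e.symm e.symm := by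
  let φ : Matrix n n ℂ →⋆ₐ[ℝ] Matrix m m ℂ :=
    { Matrix.reindexAlgEquiv ℝ ℂ e with
      map_star' := fun M => by
        simp [Matrix.star_eq_conjTranspose, Matrix.conjTranspose_submatrix]
      map_zero' := by simp
      map_one' := by simp
      commutes' := fun r => (Matrix.reindexAlgEquiv ℝ ℂ e).commutes r }
  have hφ : ∀ M, φ M = M.submatrix e.symm e.symm := fun M => rfl
  have hc : Continuous φ := by
    have : (φ : Matrix n n ℂ → Matrix m m ℂ) = fun M => M.submatrix e.symm e.symm := rfl
    rw [this]
    fun_prop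
  have hs : IsSelfAdjoint (φ X) := by
    rw [hφ]; exact hX.submatrix _
  have := StarAlgHomClass.map_cfc φ f X (contOn _ _) hc hX hs
  rw [hφ, hφ] at this
  exact this.symm

lemma opconv {f : ℝ → ℝ} (hf : OperatorConvex f) (X Y : Matrix n n ℂ) (hX : X.PosSemidef)
    (hY : Y.PosSemidef) (t : ℝ) (h0 : 0 ≤ t) (h1 : t ≤ 1) :
    (t • cfc f X + (1 - t) • cfc f Y - cfc f (t • X + (1 - t) • Y)).PosSemidef := by
  let e := Fintype.equivFin n
  have := hf (Fintype.card n) (X.submatrix e.symm e.symm) (Y.submatrix e.symm e.symm) t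
    (hX.submatrix _) (hY.submatrix _) h0 h1
  have hZ : (t • X + (1 - t) • Y).PosSemidef :=
    (hX.smul h0).add (hY.smul (sub_nonneg.2 h1))
  have e1 : t • X.submatrix e.symm e.symm + (1 - t) • Y.submatrix e.symm e.symm =
    (t • X + (1 - t) • Y).submatrix e.symm e.symm := rfl
  rw [e1, cfc_reindex e f _ hX.1, cfc_reindex e f _ hY.1, cfc_reindex e f _ hZ.1] at this
  exact (Matrix.posSemidef_submatrix_equiv e.symm).1 this

/-- `T f P X = Re Tr (P f(X))`. -/
noncomputable def T (f : ℝ → ℝ) (P X : Matrix n n ℂ) : ℝ := (P * cfc f X).trace.re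

lemma T_conv {f : ℝ → ℝ} (hf : OperatorConvex f) (P X Y Z : Matrix n n ℂ) (hP : P.PosSemidef)
    (hX : X.PosSemidef) (hY : Y.PosSemidef) (t : ℝ) (h0 : 0 ≤ t) (h1 : t ≤ 1)
    (hZ : Z = t • X + (1 - t) • Y) :
    T f P Z ≤ t * T f P X + (1 - t) * T f P Y := by
  have := trace_nonneg P _ hP (opconv hf X Y hX hY t h0 h1)
  rw [← hZ] at this
  simp only [mul_sub, mul_add, Matrix.mul_smul, Matrix.trace_sub, Matrix.trace_add,
    Matrix.trace_smul, Complex.sub_re, Complex.add_re, Complex.smul_re, smul_eq_mul] at this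
  unfold T
  linarith

lemma scalar_conv {f : ℝ → ℝ} (hf : OperatorConvex f) (x y t : ℝ) (hx : 0 ≤ x) (hy : 0 ≤ y)
    (h0 : 0 ≤ t) (h1 : t ≤ 1) : f (t * x + (1 - t) * y) ≤ t * f x + (1 - t) * f y := by
  have hp : ∀ r : ℝ, 0 ≤ r → (algebraMap ℝ (Matrix (Fin 1) (Fin 1) ℂ) r).PosSemidef := by
    intro r hr
    rw [Algebra.algebraMap_eq_smul_one]
    exact Matrix.PosSemidef.one.smul hr
  have hT : ∀ r : ℝ, T f (1 : Matrix (Fin 1) (Fin 1) ℂ) (algebraMap ℝ _ r) = f r := by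
    intro r
    unfold T
    rw [cfc_algebraMap r f]
    simp [Matrix.trace, Algebra.algebraMap_eq_smul_one]
  have := T_conv hf (1 : Matrix (Fin 1) (Fin 1) ℂ) _ _ (algebraMap ℝ _ (t * x + (1 - t) * y))
    Matrix.PosSemidef.one (hp x hx) (hp y hy) t h0 h1
    (by simp [Algebra.algebraMap_eq_smul_one, add_smul, mul_smul])
  rwa [hT, hT, hT] at this

lemma mono {f : ℝ → ℝ} (hf : OperatorConvex f) (hf0 : f 0 = 0) (hfnn : ∀ x, 0 ≤ x → 0 ≤ f x)
    (x y : ℝ) (hx : 0 ≤ x) (hxy : x ≤ y) : f x ≤ f y := by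
  rcases (hx.trans hxy).eq_or_lt with h | h
  · have : x = 0 := by linarith
    rw [this, h]
  · have h1 : x / y ≤ 1 := (div_le_one h).2 hxy
    have := scalar_conv hf y 0 (x / y) h.le le_rfl (by positivity) h1
    rw [hf0, div_mul_cancel₀ _ h.ne'] at this
    have h2 := mul_le_mul_of_nonneg_right h1 (hfnn y h.le)
    simp only [mul_zero, add_zero] at this
    linarith

/-- A primitive of `f`. -/
lemma exists_prim {f : ℝ → ℝ} (hm : ∀ x y, 0 ≤ x → x ≤ y → f x ≤ f y) :
    ∃ F : ℝ → ℝ, ∀ x y, 0 ≤ x → 0 ≤ y → (y - x) * f x ≤ F y - F x := by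
  let g : ℝ → ℝ := fun x => f (max x 0)
  have hg : Monotone g := fun x y hxy => hm _ _ (le_max_right _ _) (max_le_max_right 0 hxy)
  have hi : ∀ a b, IntervalIntegrable g MeasureTheory.volume a b :=
    fun a b => hg.intervalIntegrable
  refine ⟨fun x => ∫ t in (0 : ℝ)..x, g t, fun x y hx hy => ?_⟩
  have hgx : g x = f x := by simp [g, max_eq_left hx]
  simp only
  rw [intervalIntegral.integral_interval_sub_left (hi _ _) (hi _ _), ← hgx]
  rcases le_total x y with h | h
  · have := intervalIntegral.integral_mono_on h (intervalIntegrable_const (c := g x)) (hi x y)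
      (fun t ht => hg ht.1)
    simpa using this
  · have := intervalIntegral.integral_mono_on h (hi y x) (intervalIntegrable_const (c := g x))
      (fun t ht => hg ht.2)
    rw [intervalIntegral.integral_symm]
    simp only [intervalIntegral.integral_const, smul_eq_mul] at this
    linarith

lemma le_zero_of_nat (a C : ℝ) (h : ∀ m : ℕ, 0 < m → a ≤ C / m) : a ≤ 0 := by
  by_contra! ha
  obtain ⟨m, hm⟩ := exists_nat_gt (|C| / a)
  have hm0 : (0 : ℝ) < m := lt_of_le_of_lt (by positivity) hm
  have h1 := h m (by exact_mod_cast hm0)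
  rw [div_lt_iff₀ ha] at hm
  rw [le_div_iff₀ hm0] at h1
  linarith [le_abs_self C]

lemma riemann (G1 G2 g1 g2 : ℝ → ℝ)
    (h1 : ∀ s s', 0 ≤ s → s ≤ s' → (s' - s) * g1 s ≤ G1 s' - G1 s)
    (h2 : ∀ s s', 0 ≤ s → s ≤ s' → G2 s' - G2 s ≤ (s' - s) * g2 s')
    (h3 : ∀ s, 0 ≤ s → g2 s ≤ g1 s) : G2 1 - G2 0 ≤ G1 1 - G1 0 := by
  have key : ∀ m : ℕ, 0 < m → (G2 1 - G2 0) - (G1 1 - G1 0) ≤ (g2 1 - g2 0) / m := by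
    intro m hm
    have hm0 : (0 : ℝ) < m := by exact_mod_cast hm
    have ind : ∀ k : ℕ, G2 (k / m) - G2 0 ≤ G1 (k / m) - G1 0 + (g2 (k / m) - g2 0) / m := by
      intro k
      induction k with
      | zero => simp
      | succ k ih =>
        have hk : (0 : ℝ) ≤ k / m := by positivity
        have hd : ((k + 1 : ℕ) : ℝ) / m - k / m = 1 / m := by
          push_cast; field_simp; ring
        have hle : (k : ℝ) / m ≤ ((k + 1 : ℕ) : ℝ) / m := by
          have : (0 : ℝ) < 1 / m := by positivity
          linarith
        have a1 := h1 _ _ hk hle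
        have a2 := h2 _ _ hk hle
        have a3 := mul_le_mul_of_nonneg_left (h3 _ hk) (by positivity : (0 : ℝ) ≤ 1 / m)
        rw [hd] at a1 a2
        have : ∀ x y : ℝ, (x - y) / m = 1 / m * x - 1 / m * y := fun x y => by ring
        rw [this] at ih ⊢
        linarith
    have := ind m
    rw [div_self hm0.ne'] at this
    linarith
  have := le_zero_of_nat _ _ key
  linarith

lemma klein_path (F f : ℝ → ℝ) (hF : ∀ x y, 0 ≤ x → 0 ≤ y → (y - x) * f x ≤ F y - F x)
    (X Y K : Matrix n n ℂ) (hX : X.PosSemidef) (hY : Y.PosSemidef) (c : ℝ) (hK : Y - X = c • K) :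
    c * T f K X ≤ (cfc F Y).trace.re - (cfc F X).trace.re ∧
    (cfc F Y).trace.re - (cfc F X).trace.re ≤ c * T f K Y := by
  have h1 := klein F f hF X Y hX hY
  have h2 := klein F f hF Y X hY hX
  have hK' : X - Y = (-c) • K := by rw [neg_smul, ← hK]; abel
  rw [hK, smul_mul_assoc, Matrix.trace_smul, Complex.smul_re, smul_eq_mul] at h1
  rw [hK', smul_mul_assoc, Matrix.trace_smul, Complex.smul_re, smul_eq_mul] at h2
  unfold T
  constructor <;> linarith

lemma T_zero {f : ℝ → ℝ} (hf0 : f 0 = 0) (P : Matrix n n ℂ) : T f P 0 = 0 := by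
  unfold T
  rw [cfc_apply_zero, hf0]
  simp

lemma superadd {f : ℝ → ℝ} (hf : OperatorConvex f) (hf0 : f 0 = 0)
    (hfnn : ∀ x, 0 ≤ x → 0 ≤ f x) (B P : Matrix n n ℂ) (hB : B.PosSemidef) (hP : P.PosSemidef) :
    T f P P ≤ T f P (B + P) - T f P B := by
  obtain ⟨F, hF⟩ := exists_prim (mono hf hf0 hfnn)
  have psd : ∀ s t : ℝ, 0 ≤ s → 0 ≤ t → (s • B + t • P).PosSemidef := fun s t hs ht =>
    (hB.smul hs).add (hP.smul ht)
  let G : ℝ → ℝ → ℝ := fun s t => (cfc F (s • B + t • P)).trace.re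
  let g : ℝ → ℝ → ℝ := fun s t => T f B (s • B + t • P)
  have hs : ∀ t s s', 0 ≤ t → 0 ≤ s → s ≤ s' →
      (s' - s) * g s t ≤ G s' t - G s t ∧ G s' t - G s t ≤ (s' - s) * g s' t := by
    intro t s s' ht h0 h1
    exact klein_path F f hF _ _ B (psd s t h0 ht) (psd s' t (h0.trans h1) ht) (s' - s)
      (by module)
  have ht : ∀ s t t', 0 ≤ s → 0 ≤ t → t ≤ t' →
      (t' - t) * T f P (s • B + t • P) ≤ G s t' - G s t ∧
      G s t' - G s t ≤ (t' - t) * T f P (s • B + t' • P) := by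
    intro s t t' hs h0 h1
    exact klein_path F f hF _ _ P (psd s t hs h0) (psd s t' hs (h0.trans h1)) (t' - t)
      (by module)
  have four : ∀ h : ℝ, 0 ≤ h → h ≤ 1 →
      (G 1 h + G 1 (1 - h)) - (G 0 h + G 0 (1 - h)) ≤ (G 1 1 + G 1 0) - (G 0 1 + G 0 0) := by
    intro h h0 h1
    refine riemann (fun s => G s 1 + G s 0) (fun s => G s h + G s (1 - h))
      (fun s => g s 1 + g s 0) (fun s => g s h + g s (1 - h)) ?_ ?_ ?_
    · intro s s' h2 h3
      have a := (hs 1 s s' zero_le_one h2 h3).1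
      have b := (hs 0 s s' le_rfl h2 h3).1
      linarith
    · intro s s' h2 h3
      have a := (hs h s s' h0 h2 h3).2
      have b := (hs (1 - h) s s' (by linarith) h2 h3).2
      linarith
    · intro s h2
      have a := T_conv hf B (s • B + (1 : ℝ) • P) (s • B + (0 : ℝ) • P) (s • B + h • P) hB
        (psd s 1 h2 zero_le_one) (psd s 0 h2 le_rfl) h h0 h1 (by module)
      have b := T_conv hf B (s • B + (1 : ℝ) • P) (s • B + (0 : ℝ) • P) (s • B + (1 - h) • P) hB
        (psd s 1 h2 zero_le_one) (psd s 0 h2 le_rfl) (1 - h) (by linarith) (by linarith) (by module)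
      simp only [g]
      linarith
  have key : ∀ h : ℝ, 0 < h → h ≤ 1 →
      T f P P - (T f P (B + P) - T f P B) ≤ h * (T f P ((2 : ℝ) • P)) := by
    intro h h0 h1
    have f4 := four h h0.le h1
    have a := (ht 1 (1 - h) 1 zero_le_one (by linarith) (by linarith)).2
    have b := (ht 0 (1 - h) 1 le_rfl (by linarith) (by linarith)).1
    have c := (ht 1 0 h zero_le_one le_rfl h0.le).1
    have d := (ht 0 0 h le_rfl le_rfl h0.le).2
    simp only [one_smul, zero_smul, zero_add, add_zero, sub_zero, sub_sub_cancel] at a b c d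
    have hP2 : ((2 : ℝ) • P).PosSemidef := hP.smul (by norm_num)
    have e1 : T f P (h • P) ≤ h * T f P P + (1 - h) * T f P 0 :=
      T_conv hf P P 0 (h • P) hP hP Matrix.PosSemidef.zero h h0.le h1 (by module)
    have e2 := T_conv hf P ((1 - h) • P) ((2 : ℝ) • P) P hP (hP.smul (by linarith)) hP2
      (1 / (1 + h)) (by positivity) (by rw [div_le_one (by linarith)]; linarith)
      (by
        rw [smul_smul, smul_smul, ← add_smul]
        have : 1 / (1 + h) * (1 - h) + (1 - 1 / (1 + h)) * 2 = 1 := by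
          field_simp; ring
        rw [this, one_smul])
    rw [T_zero hf0] at e1
    have e3 : (1 + h) * T f P P ≤ T f P ((1 - h) • P) + h * T f P ((2 : ℝ) • P) := by
      have := mul_le_mul_of_nonneg_left e2 (by linarith : (0 : ℝ) ≤ 1 + h)
      refine this.trans (le_of_eq ?_)
      field_simp
      ring
    have e4 : h * (T f P ((1 - h) • P) + T f P B) ≤ h * (T f P (B + P) + T f P (h • P)) := by
      linarith
    have e5 := le_of_mul_le_mul_left e4 h0
    linarith
  have : T f P P - (T f P (B + P) - T f P B) ≤ 0 := by
    refine le_zero_of_nat _ (T f P ((2 : ℝ) • P)) fun m hm => ?_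
    have hm0 : (1 : ℝ) ≤ m := by exact_mod_cast hm
    have := key (1 / m) (by positivity) (by rw [div_le_one (by linarith)]; exact hm0)
    refine this.trans (le_of_eq ?_)
    ring
  linarith

lemma T_orth {f : ℝ → ℝ} (hf0 : f 0 = 0) (P M : Matrix n n ℂ) (hM : M.PosSemidef)
    (h : P * M = 0) : T f P M = 0 := by
  have e : cfc f M = M * cfc (fun x => f x / x) M := by
    conv_rhs => enter [1]; rw [← cfc_id' ℝ M (sa hM)]
    rw [← cfc_mul (fun x => x) _ M (contOn _ _) (contOn _ _)]
    congr 1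
    ext x
    by_cases hx : x = 0
    · simp [hx, hf0]
    · field_simp
  unfold T
  rw [e, ← Matrix.mul_assoc, h]
  simp

lemma step1 {f : ℝ → ℝ} (hf : OperatorConvex f) (hf0 : f 0 = 0)
    (A P N : Matrix n n ℂ) (hA : A.PosSemidef) (hP : P.PosSemidef) (hN : N.PosSemidef)
    (h : P * N = 0) : T f P (A + N) ≤ T f P A := by
  have : T f P (A + N) - T f P A ≤ 0 := by
    refine le_zero_of_nat _ (1 / 2 * T f P ((2 : ℝ) • A) - T f P A) fun m hm => ?_
    have hm0 : (1 : ℝ) ≤ m := by exact_mod_cast hm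
    have hmN : ((m : ℝ) • N).PosSemidef := hN.smul (by linarith)
    have h2N : ((2 * m : ℝ) • N).PosSemidef := hN.smul (by linarith)
    have h2A : ((2 : ℝ) • A).PosSemidef := hA.smul (by norm_num)
    have a := T_conv hf P ((2 : ℝ) • A) ((2 * m : ℝ) • N) (A + (m : ℝ) • N) hP h2A h2N (1 / 2)
      (by norm_num) (by norm_num) (by module)
    rw [T_orth hf0 P _ h2N (by rw [Matrix.mul_smul, h, smul_zero])] at a
    have b := T_conv hf P (A + (m : ℝ) • N) A (A + N) hP (hA.add hmN) hA (1 / m)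
      (by positivity) (by rw [div_le_one (by linarith)]; exact hm0)
      (by
        have : (1 / m : ℝ) * m = 1 := by field_simp
        rw [smul_add, smul_smul, this]
        module)
    have c := mul_le_mul_of_nonneg_left a (by positivity : (0 : ℝ) ≤ 1 / m)
    have : (1 / 2 * T f P ((2 : ℝ) • A) - T f P A) / m =
      1 / m * (1 / 2 * T f P ((2 : ℝ) • A)) - 1 / m * T f P A := by ring
    rw [this]
    linarith
  linarith

lemma core {f : ℝ → ℝ} (hf : OperatorConvex f) (hf0 : f 0 = 0)
    (hfnn : ∀ x, 0 ≤ x → 0 ≤ f x) (A B P N : Matrix n n ℂ) (hA : A.PosSemidef)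
    (hB : B.PosSemidef) (hP : P.PosSemidef) (hN : N.PosSemidef)
    (h : P * N = 0) (hAB : A + N = B + P) : T f P P ≤ T f P A - T f P B := by
  have a := step1 hf hf0 A P N hA hP hN h
  have b := superadd hf hf0 hfnn B P hB hP
  rw [hAB] at a
  linarith

lemma psd_cfc (g : ℝ → ℝ) (hg : ∀ x, 0 ≤ g x) (D : Matrix n n ℂ) : (cfc g D).PosSemidef := by
  have e : cfc g D = (cfc (fun x => Real.sqrt (g x)) D)ᴴ * cfc (fun x => Real.sqrt (g x)) D := by
    have : (cfc (fun x => Real.sqrt (g x)) D)ᴴ = cfc (fun x => Real.sqrt (g x)) D :=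
      cfc_predicate (p := IsSelfAdjoint) (fun x => Real.sqrt (g x)) D
    rw [this, ← cfc_mul _ _ D (contOn _ _) (contOn _ _)]
    congr 1
    ext x
    exact (Real.mul_self_sqrt (hg x)).symm
  rw [e]
  exact Matrix.posSemidef_conjTranspose_mul_self _

lemma im_trace (X Y : Matrix n n ℂ) (hX : X.IsHermitian) (hY : Y.IsHermitian) :
    (X * Y).trace.im = 0 := by
  have : star (X * Y).trace = (X * Y).trace := by
    rw [← Matrix.trace_conjTranspose, Matrix.conjTranspose_mul, hX.eq, hY.eq,
      Matrix.trace_mul_comm]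
  exact Complex.conj_eq_iff_im.1 this

lemma matAbs_eq (D : Matrix n n ℂ) (hD : D.IsHermitian) : matAbs D = cfc (fun x : ℝ => |x|) D := by
  have hs : IsSelfAdjoint D := hD
  unfold matAbs
  rw [hD.eq]
  have : D * D = cfc (fun x : ℝ => x * x) D := by
    rw [cfc_mul (fun x : ℝ => x) (fun x : ℝ => x) D (contOn _ _) (contOn _ _), cfc_id' ℝ D hs]
  rw [this, ← cfc_comp' Real.sqrt (fun x => x * x) D (contOn_image _ _ _) (contOn _ _) hs]
  congr 1
  ext x
  exact Real.sqrt_mul_self_eq_abs x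

end Aux10

theorem stmt_10 {n : Type*} [Fintype n] [DecidableEq n] (f : ℝ → ℝ)
    (hf : OperatorConvex f) (hf0 : f 0 = 0) (hfnn : ∀ x, 0 ≤ x → 0 ≤ f x)
    (A B : Matrix n n ℂ) (hA : A.PosSemidef) (hB : B.PosSemidef) :
    Matrix.trace (matAbs (A - B) * cfc f (matAbs (A - B))) ≤
      Matrix.trace ((A - B) * (cfc f A - cfc f B)) := by 
  set D := A - B with hDdef
  have hD : D.IsHermitian := hA.1.sub hB.1
  have hs : IsSelfAdjoint D := hD
  let p : ℝ → ℝ := fun x => max x 0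
  let q : ℝ → ℝ := fun x => max (-x) 0
  have hp : ∀ x, 0 ≤ p x := fun x => le_max_right _ _
  have hq : ∀ x, 0 ≤ q x := fun x => le_max_right _ _
  have hP := Aux10.psd_cfc p hp D
  have hN := Aux10.psd_cfc q hq D
  have hpq : ∀ x, p x * q x = 0 := by
    intro x
    rcases le_total x 0 with h | h
    · simp [p, max_eq_right h]
    · simp [q, max_eq_right (neg_nonpos.2 h)]
  have hPN : cfc p D * cfc q D = 0 := by
    rw [← cfc_mul p q D (Aux10.contOn _ _) (Aux10.contOn _ _)]
    simp only [hpq]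
    exact cfc_const_zero ℝ D
  have hNP : cfc q D * cfc p D = 0 := by
    rw [← cfc_mul q p D (Aux10.contOn _ _) (Aux10.contOn _ _)]
    simp only [mul_comm (q _), hpq]
    exact cfc_const_zero ℝ D
  have hsub : cfc p D - cfc q D = D := by
    rw [← cfc_sub p q D (Aux10.contOn _ _) (Aux10.contOn _ _)]
    conv_rhs => rw [← cfc_id' ℝ D hs]
    congr 1
    ext x
    rcases le_total x 0 with h | h
    · simp [p, q, max_eq_right h, max_eq_left (neg_nonneg.2 h)]
    · simp [p, q, max_eq_left h, max_eq_right (neg_nonpos.2 h)]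
  have hAB : A + cfc q D = B + cfc p D := by
    have h1 : cfc p D = D + cfc q D := by rw [← sub_eq_iff_eq_add]; exact hsub
    rw [h1, hDdef]
    abel
  have c1 := Aux10.core hf hf0 hfnn A B _ _ hA hB hP hN hPN hAB
  have c2 := Aux10.core hf hf0 hfnn B A _ _ hB hA hN hP hNP hAB.symm
  have hcomp : ∀ g : ℝ → ℝ, cfc g D * cfc f (cfc g D) = cfc (fun x => g x * f (g x)) D := by
    intro g
    rw [← cfc_comp' f g D (Aux10.contOn_image _ _ _) (Aux10.contOn _ _) hs,
      ← cfc_mul g _ D (Aux10.contOn _ _) (Aux10.contOn _ _)]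
  have hL : matAbs D * cfc f (matAbs D) =
      cfc p D * cfc f (cfc p D) + cfc q D * cfc f (cfc q D) := by
    rw [Aux10.matAbs_eq D hD, hcomp, hcomp, hcomp, ← cfc_add D _ _ (Aux10.contOn _ _) (Aux10.contOn _ _)]
    congr 1
    ext x
    rcases le_total x 0 with h | h
    · simp [p, q, max_eq_right h, max_eq_left (neg_nonneg.2 h), abs_of_nonpos h]
    · simp [p, q, max_eq_left h, max_eq_right (neg_nonpos.2 h), abs_of_nonneg h]
  have hfA : (cfc f A).IsHermitian := cfc_predicate (p := IsSelfAdjoint) f A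
  have hfB : (cfc f B).IsHermitian := cfc_predicate (p := IsSelfAdjoint) f B
  rw [Complex.le_def]
  constructor
  · rw [hL]
    have e : D * (cfc f A - cfc f B) = cfc p D * cfc f A - cfc p D * cfc f B
        + (cfc q D * cfc f B - cfc q D * cfc f A) := by
      conv_lhs => enter [1]; rw [← hsub]
      noncomm_ring
    rw [e]
    simp only [Matrix.trace_add, Matrix.trace_sub, Complex.add_re, Complex.sub_re]
    exact add_le_add c1 c2
  · rw [Aux10.im_trace D _ hD (hfA.sub hfB), Aux10.im_trace]
    · exact cfc_predicate (p := IsSelfAdjoint) _ _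
    · exact cfc_predicate (p := IsSelfAdjoint) _ _
end
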